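/- arXiv:1707.02209 — 2 statements merged into one kernel-verified Lean document; each statement's English description precedes it below -/
import Mathlib

section
/- Let a ∈ C²(ℝ₊ × ℝ₊), let c > 0 and μ ≥ 0 be constants, and let g ∈ C¹(ℝ₊ × ℝ) be such that there exists v_max > 0 with 0 < g(0,w) ≤ g(v,w) ≤ v_max for all v ≥ 0, w ∈ ℝ. Let θ, φ ∈ W^{2,∞}([0,1]) with φ(x) > 0 for all x ∈ [0,1], satisfying the compatibility conditions θ(0) = a(0, φ(0)), ∂a/∂t(0, φ(0)) + c·∂a/∂v(0, φ(0))·φ′(0) = −φ(0)·θ′(0), and φ′(1) = −μc⁻¹(φ(1) − g(φ(1), θ(1))). Then the initial-boundary value problem ∂w/∂t(t,x) + v(t,x)·∂w/∂x(t,x) = 0 and ∂v/∂t(t,x) − c·∂v/∂x(t,x) = 0 for all (t,x) ∈ ℝ₊ × [0,1], with boundary conditions w(t,0) = a(t, v(t,0)) and ∂v/∂t(t,1) = −μ(v(t,1) − g(v(t,1), w(t,1))) for all t ≥ 0, and initial conditions w(0,x) = θ(x), v(0,x) = φ(x) for all x ∈ [0,1], admits a unique solution w, v ∈ C¹(ℝ₊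 × [0,1]); this solution has Lipschitz derivatives on every compact subset of ℝ₊ × [0,1] and satisfies, for all (t,x) ∈ ℝ₊ × [0,1]: sup_{0≤x≤1}|w(t,x)| ≤ max(B_t, ‖θ‖_∞) and min(min_{0≤x≤1} φ(x), min{g(0,w) : |w| ≤ max(B_t, ‖θ‖_∞)}) ≤ v(t,x) ≤ max(max_{0≤x≤1} φ(x), v_max), where B_t := max{|a(s,v)| : s ∈ [0,t], 0 ≤ v ≤ max(max_{0≤x≤1} φ(x), v_max)}. -/
open Set

/-- `(w, v)` (with continuous partial derivatives `wt, wx, vt, vx`) is a classical `C¹`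
solution of the hyperbolic system (2.11)-(2.12): `∂w/∂t + v ∂w/∂x = 0`,
`∂v/∂t - c ∂v/∂x = 0` on `ℝ₊ × [0,1]`, with boundary conditions `w(t,0) = a(t, v(t,0))`
and `∂v/∂t(t,1) = -μ (v(t,1) - g(v(t,1), w(t,1)))`. -/
def IsSol2 (c μ : ℝ) (a g : ℝ → ℝ → ℝ) (w v wt wx vt vx : ℝ → ℝ → ℝ) : Prop :=
  ContinuousOn (fun q : ℝ × ℝ => w q.1 q.2) (Ici 0 ×ˢ Icc 0 1) ∧
  ContinuousOn (fun q : ℝ × ℝ => v q.1 q.2) (Ici 0 ×ˢ Icc 0 1) ∧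
  ContinuousOn (fun q : ℝ × ℝ => wt q.1 q.2) (Ici 0 ×ˢ Icc 0 1) ∧
  ContinuousOn (fun q : ℝ × ℝ => wx q.1 q.2) (Ici 0 ×ˢ Icc 0 1) ∧
  ContinuousOn (fun q : ℝ × ℝ => vt q.1 q.2) (Ici 0 ×ˢ Icc 0 1) ∧
  ContinuousOn (fun q : ℝ × ℝ => vx q.1 q.2) (Ici 0 ×ˢ Icc 0 1) ∧
  (∀ t ∈ Ici (0:ℝ), ∀ x ∈ Icc (0:ℝ) 1,
    HasDerivWithinAt (fun s => w s x) (wt t x) (Ici 0) t ∧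
    HasDerivWithinAt (fun y => w t y) (wx t x) (Icc 0 1) x ∧
    HasDerivWithinAt (fun s => v s x) (vt t x) (Ici 0) t ∧
    HasDerivWithinAt (fun y => v t y) (vx t x) (Icc 0 1) x) ∧
  (∀ t ∈ Ici (0:ℝ), ∀ x ∈ Icc (0:ℝ) 1,
    wt t x + v t x * wx t x = 0 ∧ vt t x - c * vx t x = 0) ∧
  (∀ t ∈ Ici (0:ℝ),
    w t 0 = a t (v t 0) ∧ vt t 1 = -μ * (v t 1 - g (v t 1) (w t 1)))

/-- `B_t = max {|a(s,u)| : s ∈ [0,t], 0 ≤ u ≤ Vb}`. -/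
noncomputable def Bt (a : ℝ → ℝ → ℝ) (Vb t : ℝ) : ℝ :=
  sSup {y : ℝ | ∃ s ∈ Icc (0:ℝ) t, ∃ u ∈ Icc (0:ℝ) Vb, y = |a s u|}

section

open Filter Topology

/-! ### Pointwise Lipschitz regularity -/

/-- `f` is Lipschitz on some neighbourhood of `x`. -/
def LipAt {X Y : Type*} [PseudoEMetricSpace X] [PseudoEMetricSpace Y] (f : X → Y) (x : X) : Prop :=
  ∃ K, ∃ s ∈ 𝓝 x, LipschitzOnWith K f s

namespace LipAt

variable {X Y Z : Type*} [PseudoEMetricSpace X] [PseudoEMetricSpace Y] [PseudoEMetricSpace Z]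

theorem continuousAt {f : X → Y} {x : X} (hf : LipAt f x) : ContinuousAt f x := by
  obtain ⟨K, s, hs, h⟩ := hf
  exact h.continuousOn.continuousAt hs

theorem comp {g : Y → Z} {f : X → Y} {x : X} (hg : LipAt g (f x)) (hf : LipAt f x) :
    LipAt (fun y => g (f y)) x := by
  have hc := hf.continuousAt
  obtain ⟨K, s, hs, h⟩ := hf
  obtain ⟨K', s', hs', h'⟩ := hg
  exact ⟨K' * K, s ∩ f ⁻¹' s', inter_mem hs (hc hs'),
    h'.comp (h.mono inter_subset_left) fun y hy => hy.2⟩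

theorem congr {f g : X → Y} {x : X} (hf : LipAt f x) (h : g =ᶠ[𝓝 x] f) : LipAt g x := by
  obtain ⟨K, s, hs, hK⟩ := hf
  refine ⟨K, s ∩ {y | g y = f y}, inter_mem hs h, fun y hy z hz => ?_⟩
  rw [hy.2, hz.2]
  exact hK hy.1 hz.1

theorem prodMk {f : X → Y} {g : X → Z} {x : X} (hf : LipAt f x) (hg : LipAt g x) :
    LipAt (fun y => (f y, g y)) x := by
  obtain ⟨K, s, hs, h⟩ := hf
  obtain ⟨K', s', hs', h'⟩ := hg
  exact ⟨max K K', s ∩ s', inter_mem hs hs',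
    (h.mono inter_subset_left).prodMk (h'.mono inter_subset_right)⟩

theorem of_contDiffAt {E F : Type*} [NormedAddCommGroup E] [NormedSpace ℝ E]
    [NormedAddCommGroup F] [NormedSpace ℝ F] {f : E → F} {x : E} (hf : ContDiffAt ℝ 1 f x) :
    LipAt f x :=
  hf.exists_lipschitzOnWith

theorem const (c : Y) (x : X) : LipAt (fun _ : X => c) x :=
  LocallyLipschitz.const c x

theorem of_lipschitzWith {K : NNReal} {f : X → Y} (hf : LipschitzWith K f) (x : X) : LipAt f x :=
  hf.locallyLipschitz x

theorem of_hasStrictDerivAt {f : ℝ → ℝ} {f' x : ℝ} (hf : HasStrictDerivAt f f' x) : LipAt f x :=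
  hf.hasStrictFDerivAt.exists_lipschitzOnWith

variable {f g : X → ℝ} {x : X}

theorem mul (hf : LipAt f x) (hg : LipAt g x) : LipAt (fun y => f y * g y) x :=
  (of_contDiffAt (f := fun p : ℝ × ℝ => p.1 * p.2) (by fun_prop)).comp (hf.prodMk hg)

theorem add (hf : LipAt f x) (hg : LipAt g x) : LipAt (fun y => f y + g y) x :=
  (of_contDiffAt (f := fun p : ℝ × ℝ => p.1 + p.2) (by fun_prop)).comp (hf.prodMk hg)

theorem neg (hf : LipAt f x) : LipAt (fun y => -f y) x :=
  (of_contDiffAt (f := fun p : ℝ => -p) (by fun_prop)).comp hf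

theorem sub (hf : LipAt f x) (hg : LipAt g x) : LipAt (fun y => f y - g y) x := by
  simpa only [sub_eq_add_neg] using hf.add hg.neg

theorem inv (hf : LipAt f x) (h : f x ≠ 0) : LipAt (fun y => (f y)⁻¹) x :=
  (of_contDiffAt (f := fun p : ℝ => p⁻¹) (contDiffAt_inv ℝ h)).comp hf

theorem div (hf : LipAt f x) (hg : LipAt g x) (h : g x ≠ 0) : LipAt (fun y => f y / g y) x := by
  simpa only [div_eq_mul_inv] using hf.mul (hg.inv h)

theorem max_const (hf : LipAt f x) (a : ℝ) : LipAt (fun y => max (f y) a) x :=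
  (LipAt.of_lipschitzWith (LipschitzWith.id.max_const a) (f x)).comp hf

theorem min_const (hf : LipAt f x) (a : ℝ) : LipAt (fun y => min (f y) a) x :=
  (LipAt.of_lipschitzWith (LipschitzWith.id.min_const a) (f x)).comp hf

/-- Two functions on the line which agree at the junction point glue to a Lipschitz function. -/
theorem ite_le {f g : ℝ → ℝ} {p : ℝ} (b : ℝ) (hf : p ≤ b → LipAt f p) (hg : b ≤ p → LipAt g p)
    (h : f b = g b) : LipAt (fun y => if y ≤ b then f y else g y) p := by
  rcases lt_trichotomy p b with hp | rfl | hp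
  · refine (hf hp.le).congr ?_
    filter_upwards [Iio_mem_nhds hp] with y hy
    exact if_pos (le_of_lt hy)
  · have hfm : LipAt (fun y => f (min y p)) p := by
      refine LipAt.comp (g := f) (f := fun y => min y p) ?_
        ((LipAt.of_lipschitzWith LipschitzWith.id p).min_const p)
      simpa using hf le_rfl
    have hgm : LipAt (fun y => g (max y p)) p := by
      refine LipAt.comp (g := g) (f := fun y => max y p) ?_
        ((LipAt.of_lipschitzWith LipschitzWith.id p).max_const p)
      simpa using hg le_rfl
    refine ((hfm.add hgm).sub (LipAt.const (f p) p)).congr (Eventually.of_forall fun y => ?_)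
    rcases le_or_gt y p with hy | hy
    · simp [hy, h]
    · simp [hy.le, not_le.2 hy]
  · refine (hg hp.le).congr ?_
    filter_upwards [Ioi_mem_nhds hp] with y hy
    exact if_neg (not_le.2 hy)

end LipAt

theorem LipAt.lipschitzOnWith_of_isCompact {X Y : Type*} [PseudoMetricSpace X]
    [PseudoMetricSpace Y] {f : X → Y} {s : Set X} (hs : IsCompact s) (hf : ∀ x ∈ s, LipAt f x) :
    ∃ K, LipschitzOnWith K f s :=
  LocallyLipschitzOn.exists_lipschitzOnWith_of_compact hs fun x hx => by
    obtain ⟨K, u, hu, h⟩ := hf x hx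
    exact ⟨K, u, mem_nhdsWithin_of_mem_nhds hu, h⟩

/-- Precomposing a locally Lipschitz function on `S` with a locally Lipschitz map into `S`. -/
theorem LocallyLipschitzOn.lipAt_comp {X Y Z : Type*} [PseudoEMetricSpace X]
    [PseudoEMetricSpace Y] [PseudoEMetricSpace Z] {g : Y → Z} {S : Set Y} {f : X → Y} {x : X}
    (hg : LocallyLipschitzOn S g) (hf : LipAt f x) (hS : ∀ y, f y ∈ S) :
    LipAt (fun y => g (f y)) x := by
  have hc := hf.continuousAt
  obtain ⟨K, s, hs, h⟩ := hf
  obtain ⟨K', s', hs', h'⟩ := hg (hS x)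
  have : f ⁻¹' s' ∈ 𝓝 x :=
    (tendsto_nhdsWithin_iff.2 ⟨hc, Eventually.of_forall hS⟩ : Tendsto f (𝓝 x) (𝓝[S] f x)) hs'
  exact ⟨K' * K, s ∩ f ⁻¹' s', inter_mem hs this,
    h'.comp (h.mono inter_subset_left) fun y hy => hy.2⟩

/-! ### Elementary one-variable calculus -/

/-- A function cannot cross the level `m` downwards if it is nondecreasing just below `m`. -/
theorem le_of_deriv_nonneg_below {f f' : ℝ → ℝ} {a b m m' : ℝ} (hm : m' < m)
    (hf : ∀ t ∈ Icc a b, HasDerivWithinAt f (f' t) (Icc a b) t) (ha : m ≤ f a)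
    (h : ∀ t ∈ Icc a b, m' < f t → f t < m → 0 ≤ f' t) : ∀ t ∈ Icc a b, m ≤ f t := by
  intro t₁ ht₁
  by_contra! hlt
  have hcont : ContinuousOn f (Icc a b) := fun t ht => (hf t ht).continuousWithinAt
  set A : Set ℝ := {t ∈ Icc a t₁ | m ≤ f t} with hA
  have hsub : Icc a t₁ ⊆ Icc a b := Icc_subset_Icc_right ht₁.2
  have hAne : A.Nonempty := ⟨a, left_mem_Icc.2 ht₁.1, ha⟩
  have hAcl : IsClosed A := by
    have := (hcont.mono hsub).preimage_isClosed_of_isClosed isClosed_Icc (isClosed_Ici (a := m))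
    exact this
  have hAbd : BddAbove A := ⟨t₁, fun t ht => ht.1.2⟩
  obtain ⟨h0, h0m⟩ : sSup A ∈ A := hAcl.csSup_mem hAne hAbd
  set t₀ := sSup A with ht₀
  have hlt01 : t₀ < t₁ := lt_of_le_of_ne h0.2 (by rintro h; rw [h] at h0m; linarith)
  have habove : ∀ t ∈ Ioc t₀ t₁, f t < m := by
    intro t ht
    by_contra! hc
    exact absurd (le_csSup hAbd (show t ∈ A from ⟨⟨h0.1.trans ht.1.le, ht.2⟩, hc⟩)) (not_le.2 ht.1)
  have hev : ∀ᶠ t in 𝓝[Icc a b] t₀, m' < f t :=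
    (hcont t₀ (hsub h0)).eventually (Ioi_mem_nhds (hm.trans_le h0m))
  obtain ⟨ε, hε, hball⟩ := Metric.mem_nhdsWithin_iff.1 hev
  set t₂ := min t₁ (t₀ + ε / 2) with ht₂
  have h02 : t₀ < t₂ := lt_min hlt01 (by linarith)
  have h21 : t₂ ≤ t₁ := min_le_left _ _
  have hsub2 : Icc t₀ t₂ ⊆ Icc a b := Icc_subset_Icc h0.1 (h21.trans ht₁.2)
  have hmono : MonotoneOn f (Icc t₀ t₂) := by
    refine monotoneOn_of_hasDerivWithinAt_nonneg (f' := f') (convex_Icc _ _) (hcont.mono hsub2) ?_ ?_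
    · intro t ht
      exact (hf t (hsub2 (interior_subset ht))).mono (interior_subset.trans hsub2)
    · intro t ht
      have ht' := interior_subset ht
      rw [interior_Icc] at ht
      refine h t (hsub2 ht') (hball ⟨?_, hsub2 ht'⟩) (habove t ⟨ht.1, ht.2.le.trans h21⟩)
      rw [Metric.mem_ball, Real.dist_eq, abs_of_pos (sub_pos.2 ht.1)]
      have := min_le_right t₁ (t₀ + ε / 2)
      linarith [ht.2]
  have := hmono (left_mem_Icc.2 h02.le) (right_mem_Icc.2 h02.le) h02.le
  linarith [habove t₂ ⟨h02, h21⟩]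

/-- Two functions with the same derivative on an interval and the same initial value agree. -/
theorem eqOn_Icc_of_hasDerivWithinAt_eq {E : Type*} [NormedAddCommGroup E] [NormedSpace ℝ E]
    {f g f' : ℝ → E} {a b : ℝ}
    (hf : ∀ t ∈ Icc a b, HasDerivWithinAt f (f' t) (Icc a b) t)
    (hg : ∀ t ∈ Icc a b, HasDerivWithinAt g (f' t) (Icc a b) t) (h : f a = g a) :
    ∀ t ∈ Icc a b, f t = g t :=
  eq_of_has_deriv_right_eq
    (fun t ht => ((hf t (Ico_subset_Icc_self ht)).mono_of_mem_nhdsWithin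
      (Icc_mem_nhdsGE_of_mem ht)))
    (fun t ht => ((hg t (Ico_subset_Icc_self ht)).mono_of_mem_nhdsWithin
      (Icc_mem_nhdsGE_of_mem ht)))
    (fun t ht => (hf t ht).continuousWithinAt) (fun t ht => (hg t ht).continuousWithinAt) h

/-- A `C¹` function on `[0,1]` with Lipschitz derivative extends to the whole line. -/
theorem exists_extension_of_lipschitz_deriv {f f' : ℝ → ℝ}
    (hf : ∀ x ∈ Icc (0:ℝ) 1, HasDerivWithinAt f (f' x) (Icc 0 1) x)
    (hlip : ∃ L : NNReal, LipschitzOnWith L f' (Icc 0 1)) :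
    ∃ h h' : ℝ → ℝ, (∀ x, HasDerivAt h (h' x) x) ∧ (∀ x, LipAt h' x) ∧
      (∀ x ∈ Icc (0:ℝ) 1, h x = f x) ∧ (∀ x ∈ Icc (0:ℝ) 1, h' x = f' x) := by
  obtain ⟨L, hL⟩ := hlip
  set h' : ℝ → ℝ := fun x => f' (projIcc (0:ℝ) 1 zero_le_one x) with hh'
  have hl : LipschitzWith (L * 1) h' :=
    (lipschitzOnWith_iff_restrict.1 hL).comp (LipschitzWith.projIcc zero_le_one)
  have heq : ∀ x ∈ Icc (0:ℝ) 1, h' x = f' x := fun x hx => by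
    simp only [hh', projIcc_of_mem zero_le_one hx]
  have hd : ∀ x, HasDerivAt (fun x => f 0 + ∫ u in (0:ℝ)..x, h' u) (h' x) x := fun x => by
    simpa using! (hl.continuous.integral_hasStrictDerivAt 0 x).hasDerivAt.const_add (f 0)
  refine ⟨_, h', hd, fun x => LipAt.of_lipschitzWith hl x, ?_, heq⟩
  refine eqOn_Icc_of_hasDerivWithinAt_eq (f' := h') (fun x _ => (hd x).hasDerivWithinAt) ?_
    (by simp)
  intro x hx
  rw [heq x hx]
  exact hf x hx

/-- Glueing two one-sided derivatives at a junction point, within a superset `S`. -/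
theorem HasDerivWithinAt.ite_le {f g : ℝ → ℝ} {d p b : ℝ} {S : Set ℝ}
    (hf : p ≤ b → HasDerivWithinAt f d (S ∩ Iic b) p)
    (hg : b ≤ p → HasDerivWithinAt g d (S ∩ Ici b) p) (h : f b = g b) :
    HasDerivWithinAt (fun y => if y ≤ b then f y else g y) d S p := by
  have e1 : ∀ y ∈ S ∩ Iic b, (if y ≤ b then f y else g y) = f y := fun y hy => if_pos hy.2
  have e2 : ∀ y ∈ S ∩ Ici b, (if y ≤ b then f y else g y) = g y := fun y hy => by
    rcases eq_or_lt_of_le (mem_Ici.1 hy.2) with rfl | hlt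
    · rw [if_pos le_rfl, h]
    · exact if_neg (not_le.2 hlt)
  have hS : S = (S ∩ Iic b) ∪ (S ∩ Ici b) := by
    rw [← inter_union_distrib_left, Iic_union_Ici, inter_univ]
  rcases lt_trichotomy p b with hp | hp | hp
  · refine ((hf hp.le).congr e1 (if_pos hp.le)).mono_of_mem_nhdsWithin ?_
    exact inter_mem self_mem_nhdsWithin (mem_nhdsWithin_of_mem_nhds (Iic_mem_nhds hp))
  · subst hp
    rw [hS]
    exact ((hf le_rfl).congr e1 (if_pos le_rfl)).union
      ((hg le_rfl).congr e2 (by rw [if_pos le_rfl, h]))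
  · refine ((hg hp.le).congr e2 (if_neg (not_le.2 hp))).mono_of_mem_nhdsWithin ?_
    exact inter_mem self_mem_nhdsWithin (mem_nhdsWithin_of_mem_nhds (Ici_mem_nhds hp))

/-! ### Functions of two variables with continuous partial derivatives -/

/-- The chain rule along a curve for a function with continuous partial derivatives on a product
of convex sets. -/
theorem hasDerivWithinAt_along_curve {f ft fx : ℝ → ℝ → ℝ} {S T I : Set ℝ} {ξ : ℝ → ℝ}
    {ξ' σ : ℝ} (hS : Convex ℝ S)
    (hft : ContinuousOn (fun q : ℝ × ℝ => ft q.1 q.2) (S ×ˢ T))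
    (hdt : ∀ t ∈ S, ∀ x ∈ T, HasDerivWithinAt (fun s => f s x) (ft t x) S t)
    (hdx : ∀ t ∈ S, ∀ x ∈ T, HasDerivWithinAt (fun y => f t y) (fx t x) T x)
    (hξ : HasDerivWithinAt ξ ξ' I σ) (hI : I ⊆ S) (hξT : MapsTo ξ I T) (hσ : σ ∈ I) :
    HasDerivWithinAt (fun s => f s (ξ s)) (ft σ (ξ σ) + fx σ (ξ σ) * ξ') I σ := by
  have h2 : HasDerivWithinAt (fun s => f σ (ξ s)) (fx σ (ξ σ) * ξ') I σ :=
    (hdx σ (hI hσ) (ξ σ) (hξT hσ)).comp σ hξ hξT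
  suffices h1 : HasDerivWithinAt (fun s => f s (ξ s) - f σ (ξ s)) (ft σ (ξ σ)) I σ by
    refine (h1.add h2).congr (fun s _ => ?_) ?_ <;> simp
  rw [hasDerivWithinAt_iff_isLittleO, Asymptotics.isLittleO_iff]
  intro ε hε
  have hc := hft (σ, ξ σ) ⟨hI hσ, hξT hσ⟩
  obtain ⟨δ, hδ, hball⟩ := Metric.mem_nhdsWithin_iff.1 (hc (Metric.ball_mem_nhds _ hε))
  have hξc : ∀ᶠ s in 𝓝[I] σ, dist (ξ s) (ξ σ) < δ :=
    hξ.continuousWithinAt (Metric.ball_mem_nhds _ hδ)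
  have hsc : ∀ᶠ s in 𝓝[I] σ, dist s σ < δ := mem_nhdsWithin_of_mem_nhds (Metric.ball_mem_nhds _ hδ)
  filter_upwards [hξc, hsc, self_mem_nhdsWithin] with s h1 h3 hs
  have hconv : Convex ℝ (S ∩ Metric.ball σ δ) := hS.inter (convex_ball _ _)
  have key := hconv.norm_image_sub_le_of_norm_hasDerivWithin_le (C := ε)
    (f := fun r => f r (ξ s) - ft σ (ξ σ) * r) (f' := fun r => ft r (ξ s) - ft σ (ξ σ) * 1)
    (x := σ) (y := s) ?_ ?_ ⟨hI hσ, Metric.mem_ball_self hδ⟩ ⟨hI hs, h3⟩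
  · refine le_trans (le_of_eq ?_) key
    congr 1
    simp only [smul_eq_mul]
    ring
  · intro r hr
    exact ((hdt r hr.1 (ξ s) (hξT hs)).mono inter_subset_left).sub
      ((hasDerivWithinAt_id r _).const_mul _)
  · intro r hr
    have : (r, ξ s) ∈ Metric.ball (σ, ξ σ) δ ∩ S ×ˢ T :=
      ⟨by rw [Metric.mem_ball, Prod.dist_eq]; exact max_lt hr.2 h1, hr.1, hξT hs⟩
    have := hball this
    rw [mem_preimage, Metric.mem_ball, Real.dist_eq] at this
    simpa using! this.le

/-- A solution of a transport equation is constant along a characteristic curve. -/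
theorem transport_const {f ft fx : ℝ → ℝ → ℝ} {S T : Set ℝ} {ξ ξ' : ℝ → ℝ} {t₀ t₁ : ℝ}
    (hS : Convex ℝ S) (hft : ContinuousOn (fun q : ℝ × ℝ => ft q.1 q.2) (S ×ˢ T))
    (hdt : ∀ t ∈ S, ∀ x ∈ T, HasDerivWithinAt (fun s => f s x) (ft t x) S t)
    (hdx : ∀ t ∈ S, ∀ x ∈ T, HasDerivWithinAt (fun y => f t y) (fx t x) T x)
    (hξ : ∀ σ ∈ Icc t₀ t₁, HasDerivWithinAt ξ (ξ' σ) (Icc t₀ t₁) σ)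
    (hI : Icc t₀ t₁ ⊆ S) (hξT : MapsTo ξ (Icc t₀ t₁) T)
    (h0 : ∀ σ ∈ Icc t₀ t₁, ft σ (ξ σ) + fx σ (ξ σ) * ξ' σ = 0) (h01 : t₀ ≤ t₁) :
    f t₁ (ξ t₁) = f t₀ (ξ t₀) := by
  refine eqOn_Icc_of_hasDerivWithinAt_eq (f := fun s => f s (ξ s)) (g := fun _ => f t₀ (ξ t₀))
    (f' := fun _ => 0) ?_ (fun t _ => hasDerivWithinAt_const _ _ _) rfl t₁ (right_mem_Icc.2 h01)
  intro σ hσ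
  rw [← h0 σ hσ]
  exact hasDerivWithinAt_along_curve hS hft hdt hdx (hξ σ hσ) hI hξT hσ

/-! ### Characteristics of a travelling speed profile -/

/-- A positive, bounded, locally Lipschitz speed profile. -/
structure IsSpeed (Vb : ℝ) (V : ℝ → ℝ) : Prop where
  lipAt : ∀ s, LipAt V s
  pos : ∀ s, 0 < V s
  le : ∀ s, V s ≤ Vb

/-- For the speed field `v(t,x) = V(x+ct)`, the function `ζ ↦ travelTime c V ζ` straightens the
characteristics `ζ = x + ct`, `ζ' = c + V ζ`. -/
noncomputable def travelTime (c : ℝ) (V : ℝ → ℝ) (s : ℝ) : ℝ := ∫ u in (0:ℝ)..s, (c + V u)⁻¹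

/-- The label `travelTime (x+ct) - t` of the characteristic entering through `x = 0` at time `r`. -/
noncomputable def entryLabel (c : ℝ) (V : ℝ → ℝ) (r : ℝ) : ℝ := travelTime c V (c * r) - r

/-- The function of the characteristic label which equals `α r` on the characteristic entering at
time `r` through `x = 0`, and `β r` on the characteristic starting at `x = r` at time `0`. -/
noncomputable def profile (c : ℝ) (V α β : ℝ → ℝ) (p : ℝ) : ℝ :=
  if p ≤ 0 then α (Function.invFun (entryLabel c V) p) else β (Function.invFun (travelTime c V) p)

@[simp] theorem travelTime_zero (c : ℝ) (V : ℝ → ℝ) : travelTime c V 0 = 0 := by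
  simp [travelTime]

@[simp] theorem entryLabel_zero (c : ℝ) (V : ℝ → ℝ) : entryLabel c V 0 = 0 := by
  simp [entryLabel]

theorem travelTime_congr {c S : ℝ} {V W : ℝ → ℝ} (h : ∀ s ∈ Icc 0 S, V s = W s) :
    ∀ s ∈ Icc 0 S, travelTime c V s = travelTime c W s := by
  intro s hs
  refine intervalIntegral.integral_congr fun u hu => ?_
  rw [uIcc_of_le hs.1] at hu
  simp only [h u ⟨hu.1, hu.2.trans hs.2⟩]

theorem entryLabel_congr {c S r : ℝ} (hc : 0 < c) {V W : ℝ → ℝ} (h : ∀ s ∈ Icc 0 S, V s = W s)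
    (hr : 0 ≤ r) (hrS : c * r ≤ S) : entryLabel c V r = entryLabel c W r := by
  rw [entryLabel, entryLabel, travelTime_congr h _ ⟨by positivity, hrS⟩]

namespace IsSpeed

variable {c Vb : ℝ} {V : ℝ → ℝ}

theorem add_pos (hV : IsSpeed Vb V) (hc : 0 < c) (s : ℝ) : 0 < c + V s := by
  linarith [hV.pos s]

theorem continuous (hV : IsSpeed Vb V) : Continuous V :=
  continuous_iff_continuousAt.2 fun s => (hV.lipAt s).continuousAt

theorem hasStrictDerivAt_travelTime (hV : IsSpeed Vb V) (hc : 0 < c) (s : ℝ) :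
    HasStrictDerivAt (travelTime c V) (c + V s)⁻¹ s :=
  ((continuous_const.add hV.continuous).inv₀
    fun s => (hV.add_pos hc s).ne').integral_hasStrictDerivAt 0 s

theorem lipAt_travelTime (hV : IsSpeed Vb V) (hc : 0 < c) (s : ℝ) : LipAt (travelTime c V) s :=
  .of_hasStrictDerivAt (hV.hasStrictDerivAt_travelTime hc s)

theorem continuous_travelTime (hV : IsSpeed Vb V) (hc : 0 < c) : Continuous (travelTime c V) :=
  continuous_iff_continuousAt.2 fun s => (hV.lipAt_travelTime hc s).continuousAt

theorem strictMono_travelTime (hV : IsSpeed Vb V) (hc : 0 < c) : StrictMono (travelTime c V) := by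
  refine strictMono_of_deriv_pos fun s => ?_
  rw [(hV.hasStrictDerivAt_travelTime hc s).hasDerivAt.deriv]
  exact inv_pos.2 (hV.add_pos hc s)

theorem surjective_travelTime (hV : IsSpeed Vb V) (hc : 0 < c) :
    Function.Surjective (travelTime c V) := by
  have hb : 0 < c + Vb := (hV.add_pos hc 0).trans_le (by linarith [hV.le 0])
  have hmono : Monotone fun s => travelTime c V s - (c + Vb)⁻¹ * s := by
    have hd : ∀ s, HasDerivAt (fun s => travelTime c V s - (c + Vb)⁻¹ * s)
        ((c + V s)⁻¹ - (c + Vb)⁻¹ * 1) s := fun s =>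
      (hV.hasStrictDerivAt_travelTime hc s).hasDerivAt.sub ((hasDerivAt_id s).const_mul _)
    refine monotone_of_deriv_nonneg (fun s => (hd s).differentiableAt) fun s => ?_
    rw [(hd s).deriv, mul_one, sub_nonneg]
    exact inv_anti₀ (hV.add_pos hc s) (by linarith [hV.le s])
  have hpos : 0 < (c + Vb)⁻¹ := inv_pos.2 hb
  refine (hV.continuous_travelTime hc).surjective ?_ ?_
  · refine tendsto_atTop_mono' _ ?_ (tendsto_id.const_mul_atTop hpos)
    filter_upwards [eventually_ge_atTop (0:ℝ)] with s hs
    have := hmono hs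
    simp at this
    simpa using this
  · refine tendsto_atBot_mono' _ ?_ (tendsto_id.const_mul_atBot hpos)
    filter_upwards [eventually_le_atBot (0:ℝ)] with s hs
    have := hmono hs
    simp at this
    simpa using this

theorem travelTime_sub_le (hV : IsSpeed Vb V) (hc : 0 < c) {x t : ℝ} (ht : 0 ≤ t) :
    travelTime c V (x + c * t) - t ≤ travelTime c V x := by
  have hanti : Antitone fun t => travelTime c V (x + c * t) - t := by
    have hd : ∀ t, HasDerivAt (fun t => travelTime c V (x + c * t) - t)
        ((c + V (x + c * t))⁻¹ * (c * 1) - 1) t := fun t =>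
      ((hV.hasStrictDerivAt_travelTime hc _).hasDerivAt.comp t
        (((hasDerivAt_id t).const_mul c).const_add x)).sub (hasDerivAt_id t)
    refine antitone_of_deriv_nonpos (fun s => (hd s).differentiableAt) fun s => ?_
    rw [(hd s).deriv, sub_nonpos, mul_one, inv_mul_le_one₀ (hV.add_pos hc _)]
    linarith [hV.pos (x + c * s)]
  simpa using hanti ht

theorem hasStrictDerivAt_entryLabel (hV : IsSpeed Vb V) (hc : 0 < c) (r : ℝ) :
    HasStrictDerivAt (entryLabel c V) (-(V (c * r) / (c + V (c * r)))) r := by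
  have h := ((hV.hasStrictDerivAt_travelTime hc (c * r)).comp r
    ((hasStrictDerivAt_id r).const_mul c)).sub (hasStrictDerivAt_id r)
  convert! h using 1
  have := (hV.add_pos hc (c * r)).ne'
  field_simp
  ring

theorem entryLabel_deriv_ne_zero (hV : IsSpeed Vb V) (hc : 0 < c) (r : ℝ) :
    -(V (c * r) / (c + V (c * r))) ≠ 0 :=
  neg_ne_zero.2 (div_pos (hV.pos _) (hV.add_pos hc _)).ne'

theorem strictAnti_entryLabel (hV : IsSpeed Vb V) (hc : 0 < c) : StrictAnti (entryLabel c V) := by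
  refine strictAnti_of_deriv_neg fun s => ?_
  rw [(hV.hasStrictDerivAt_entryLabel hc s).hasDerivAt.deriv]
  exact neg_neg_of_pos (div_pos (hV.pos _) (hV.add_pos hc _))

theorem continuous_entryLabel (hV : IsSpeed Vb V) (hc : 0 < c) : Continuous (entryLabel c V) :=
  continuous_iff_continuousAt.2 fun s =>
    (hV.hasStrictDerivAt_entryLabel hc s).hasDerivAt.continuousAt

theorem invFun_entryLabel (hV : IsSpeed Vb V) (hc : 0 < c) (r : ℝ) :
    Function.invFun (entryLabel c V) (entryLabel c V r) = r :=
  Function.leftInverse_invFun (hV.strictAnti_entryLabel hc).injective r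

theorem invFun_travelTime (hV : IsSpeed Vb V) (hc : 0 < c) (s : ℝ) :
    Function.invFun (travelTime c V) (travelTime c V s) = s :=
  Function.leftInverse_invFun (hV.strictMono_travelTime hc).injective s

theorem hasStrictDerivAt_invFun_travelTime (hV : IsSpeed Vb V) (hc : 0 < c) (s : ℝ) :
    HasStrictDerivAt (Function.invFun (travelTime c V)) (c + V s) (travelTime c V s) := by
  simpa using (hV.hasStrictDerivAt_travelTime hc s).to_local_left_inverse
    (inv_ne_zero (hV.add_pos hc s).ne') (Eventually.of_forall (hV.invFun_travelTime hc))

theorem hasStrictDerivAt_invFun_entryLabel (hV : IsSpeed Vb V) (hc : 0 < c) (r : ℝ) :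
    HasStrictDerivAt (Function.invFun (entryLabel c V)) (-((c + V (c * r)) / V (c * r)))
      (entryLabel c V r) := by
  have h := (hV.hasStrictDerivAt_entryLabel hc r).to_local_left_inverse
    (hV.entryLabel_deriv_ne_zero hc r) (Eventually.of_forall (hV.invFun_entryLabel hc))
  rwa [inv_neg, inv_div] at h

theorem entryLabel_nonpos (hV : IsSpeed Vb V) (hc : 0 < c) {r : ℝ} (hr : 0 ≤ r) :
    entryLabel c V r ≤ 0 := by
  simpa using (hV.strictAnti_entryLabel hc).antitone hr

theorem travelTime_nonneg (hV : IsSpeed Vb V) (hc : 0 < c) {r : ℝ} (hr : 0 ≤ r) :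
    0 ≤ travelTime c V r := by
  simpa using (hV.strictMono_travelTime hc).monotone hr

/-- Every point of `ℝ₊ × [0,1]` lies on a characteristic coming from the initial segment or from
the inlet. -/
theorem exists_origin (hV : IsSpeed Vb V) (hc : 0 < c) {t x : ℝ} (ht : 0 ≤ t)
    (hx : x ∈ Icc (0:ℝ) 1) :
    (∃ r ∈ Icc (0:ℝ) 1, travelTime c V r = travelTime c V (x + c * t) - t) ∨
      ∃ r ∈ Icc 0 t, entryLabel c V r = travelTime c V (x + c * t) - t := by
  rcases le_total 0 (travelTime c V (x + c * t) - t) with h | h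
  · left
    refine intermediate_value_Icc zero_le_one (hV.continuous_travelTime hc).continuousOn ⟨?_, ?_⟩
    · simpa using h
    · exact (hV.travelTime_sub_le hc ht).trans ((hV.strictMono_travelTime hc).monotone hx.2)
  · right
    refine intermediate_value_Icc' ht (hV.continuous_entryLabel hc).continuousOn ⟨?_, ?_⟩
    · rw [entryLabel]
      have := (hV.strictMono_travelTime hc).monotone (show c * t ≤ x + c * t by linarith [hx.1])
      linarith
    · simpa using h

theorem profile_entryLabel (hV : IsSpeed Vb V) (hc : 0 < c) (α β : ℝ → ℝ) {r : ℝ} (hr : 0 ≤ r) :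
    profile c V α β (entryLabel c V r) = α r := by
  rw [profile, if_pos (hV.entryLabel_nonpos hc hr), hV.invFun_entryLabel hc]

theorem profile_travelTime (hV : IsSpeed Vb V) (hc : 0 < c) {α β : ℝ → ℝ} (h0 : α 0 = β 0) {r : ℝ}
    (hr : 0 ≤ r) : profile c V α β (travelTime c V r) = β r := by
  rcases hr.eq_or_lt with rfl | hr
  · have := hV.profile_entryLabel hc α β le_rfl
    rw [travelTime_zero]
    rwa [entryLabel_zero, h0] at this
  · have := (hV.strictMono_travelTime hc) hr
    rw [travelTime_zero] at this
    rw [profile, if_neg (not_le.2 this), hV.invFun_travelTime hc]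

theorem exists_travelTime_eq (hV : IsSpeed Vb V) (hc : 0 < c) {p : ℝ} (hp : 0 ≤ p) :
    ∃ r, 0 ≤ r ∧ travelTime c V r = p := by
  obtain ⟨r, hr⟩ := hV.surjective_travelTime hc p
  refine ⟨r, (hV.strictMono_travelTime hc).le_iff_le.1 ?_, hr⟩
  rwa [travelTime_zero, hr]

theorem junction (hV : IsSpeed Vb V) (hc : 0 < c) {α β : ℝ → ℝ} (h0 : α 0 = β 0) :
    α (Function.invFun (entryLabel c V) 0) = β (Function.invFun (travelTime c V) 0) := by
  have h1 := hV.invFun_entryLabel hc 0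
  have h2 := hV.invFun_travelTime hc 0
  rw [entryLabel_zero] at h1
  rw [travelTime_zero] at h2
  rw [h1, h2, h0]

theorem lipAt_profile (hV : IsSpeed Vb V) (hc : 0 < c) {α β : ℝ → ℝ} (h0 : α 0 = β 0)
    (hα : ∀ r, 0 ≤ r → LipAt α r) (hβ : ∀ r, 0 ≤ r → LipAt β r) {p : ℝ}
    (hp : p ≤ 0 → ∃ r, 0 ≤ r ∧ entryLabel c V r = p) : LipAt (profile c V α β) p := by
  refine LipAt.ite_le 0 (fun h => ?_) (fun h => ?_) (hV.junction hc h0)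
  · obtain ⟨r, hr, rfl⟩ := hp h
    refine LipAt.comp (g := α) ?_
      (LipAt.of_hasStrictDerivAt (hV.hasStrictDerivAt_invFun_entryLabel hc r))
    rw [hV.invFun_entryLabel hc]
    exact hα r hr
  · obtain ⟨r, hr, rfl⟩ := hV.exists_travelTime_eq hc h
    refine LipAt.comp (g := β) ?_
      (LipAt.of_hasStrictDerivAt (hV.hasStrictDerivAt_invFun_travelTime hc r))
    rw [hV.invFun_travelTime hc]
    exact hβ r hr

/-- The derivative of a profile is the profile built from the derivatives of the data along the
characteristics. -/
theorem hasDerivAt_profile (hV : IsSpeed Vb V) (hc : 0 < c) {α β α' β' : ℝ → ℝ} (h0 : α 0 = β 0)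
    (h0' : α' 0 * -((c + V (c * 0)) / V (c * 0)) = β' 0 * (c + V 0))
    (hα : ∀ r ∈ Ici (0:ℝ), HasDerivWithinAt α (α' r) (Ici 0) r)
    (hβ : ∀ r ∈ Ici (0:ℝ), HasDerivWithinAt β (β' r) (Ici 0) r) {p : ℝ}
    (hp : p ≤ 0 → ∃ r, 0 ≤ r ∧ entryLabel c V r = p)
    (hp' : ∀ᶠ q in 𝓝 p, q ≤ 0 → ∃ r, 0 ≤ r ∧ entryLabel c V r = q) :
    HasDerivAt (profile c V α β)
      (profile c V (fun r => α' r * -((c + V (c * r)) / V (c * r)))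
        (fun r => β' r * (c + V r)) p) p := by
  rw [← hasDerivWithinAt_univ]
  set S : Set ℝ := {q | q ≤ 0 → ∃ r, 0 ≤ r ∧ entryLabel c V r = q} with hS
  suffices h : HasDerivWithinAt (profile c V α β)
      (profile c V (fun r => α' r * -((c + V (c * r)) / V (c * r)))
        (fun r => β' r * (c + V r)) p) S p from
    (h.hasDerivAt hp').hasDerivWithinAt
  refine HasDerivWithinAt.ite_le (fun h => ?_) (fun h => ?_) (hV.junction hc h0)
  · obtain ⟨r, hr, rfl⟩ := hp h
    rw [hV.profile_entryLabel hc _ _ hr]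
    refine HasDerivWithinAt.comp (h₂ := α) (h := Function.invFun (entryLabel c V)) (s' := Ici 0)
      _ ?_ (hV.hasStrictDerivAt_invFun_entryLabel hc r).hasDerivAt.hasDerivWithinAt ?_
    · rw [hV.invFun_entryLabel hc]
      exact hα r hr
    · rintro q ⟨hq, hq0⟩
      obtain ⟨r', hr', rfl⟩ := hq hq0
      rwa [hV.invFun_entryLabel hc]
  · obtain ⟨r, hr, rfl⟩ := hV.exists_travelTime_eq hc h
    rw [hV.profile_travelTime hc h0' hr]
    refine HasDerivWithinAt.comp (h₂ := β) (h := Function.invFun (travelTime c V)) (s' := Ici 0)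
      _ ?_ (hV.hasStrictDerivAt_invFun_travelTime hc r).hasDerivAt.hasDerivWithinAt ?_
    · rw [hV.invFun_travelTime hc]
      exact hβ r hr
    · rintro q ⟨-, hq0⟩
      obtain ⟨r', hr', rfl⟩ := hV.exists_travelTime_eq hc hq0
      rwa [hV.invFun_travelTime hc]

end IsSpeed

/-! ### The outlet ordinary differential equation -/

/-- Global existence for a bounded, globally Lipschitz vector field. -/
theorem exists_solution_of_bounded_lipschitz {E : Type*} [NormedAddCommGroup E] [NormedSpace ℝ E]
    [CompleteSpace E] {f : ℝ → E → E} {K M : NNReal} (hK : ∀ t, LipschitzWith K (f t))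
    (hc : ∀ x, Continuous fun t => f t x) (hM : ∀ t x, ‖f t x‖ ≤ M) {a b : ℝ} (hab : a ≤ b)
    (x₀ : E) :
    ∃ y : ℝ → E, y a = x₀ ∧ ∀ t ∈ Icc a b, HasDerivWithinAt y (f t (y t)) (Icc a b) t := by
  have h : IsPicardLindelof f (⟨a, left_mem_Icc.2 hab⟩ : Icc a b) x₀
      (M * ⟨b - a, sub_nonneg.2 hab⟩) 0 M K :=
    { lipschitzOnWith := fun t _ => (hK t).lipschitzOnWith
      continuousOn := fun x _ => (hc x).continuousOn
      norm_le := fun t _ x _ => hM t x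
      mul_max_le := by
        simp only [sub_self, NNReal.coe_zero, sub_zero]
        rw [max_eq_left (sub_nonneg.2 hab)]
        exact le_rfl }
  exact h.exists_eq_forall_mem_Icc_hasDerivWithinAt₀

/-- Uniqueness for a globally Lipschitz vector field. -/
theorem eqOn_Icc_of_lipschitz_field {E : Type*} [NormedAddCommGroup E] [NormedSpace ℝ E]
    {f : ℝ → E → E} {K : NNReal} (hK : ∀ t, LipschitzWith K (f t)) {y z : ℝ → E} {a b : ℝ}
    (hy : ∀ t ∈ Icc a b, HasDerivWithinAt y (f t (y t)) (Icc a b) t)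
    (hz : ∀ t ∈ Icc a b, HasDerivWithinAt z (f t (z t)) (Icc a b) t) (h : y a = z a) :
    EqOn y z (Icc a b) :=
  ODE_solution_unique_of_mem_Icc_right (v := f) (s := fun _ => univ)
    (fun t _ => (hK t).lipschitzOnWith)
    (fun t ht => (hy t ht).continuousWithinAt)
    (fun t ht => (hy t (Ico_subset_Icc_self ht)).mono_of_mem_nhdsWithin
      (Icc_mem_nhdsGE_of_mem ht))
    (fun _ _ => mem_univ _)
    (fun t ht => (hz t ht).continuousWithinAt)
    (fun t ht => (hz t (Ico_subset_Icc_self ht)).mono_of_mem_nhdsWithin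
      (Icc_mem_nhdsGE_of_mem ht))
    (fun _ _ => mem_univ _) h

/-- Truncation of a real number to `[lo, hi]`. -/
noncomputable def clamp (lo hi x : ℝ) : ℝ := max lo (min hi x)

theorem clamp_mem {lo hi : ℝ} (h : lo ≤ hi) (x : ℝ) : clamp lo hi x ∈ Icc lo hi :=
  ⟨le_max_left _ _, max_le h (min_le_left _ _)⟩

theorem clamp_of_mem {lo hi x : ℝ} (h : x ∈ Icc lo hi) : clamp lo hi x = x := by
  rw [clamp, min_eq_right h.2, max_eq_right h.1]

theorem lipschitzWith_clamp (lo hi : ℝ) : LipschitzWith 1 (clamp lo hi) :=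
  (LipschitzWith.id.const_min hi).const_max lo

/-- The vector field of the outlet equation, coupled with the travel time and truncated to the
physical range `0 ≤ v ≤ Vb`. -/
noncomputable def outletField (c μ Vb : ℝ) (G : ℝ × ℝ → ℝ) (s : ℝ) (q : ℝ × ℝ) : ℝ × ℝ :=
  (-(μ / c) * (clamp 0 Vb q.1 - G (clamp 0 Vb q.1, q.2 - (s - 1) / c)), (c + clamp 0 Vb q.1)⁻¹)

section OutletField

variable {c μ Vb : ℝ} {G : ℝ × ℝ → ℝ} {K : NNReal}

theorem exists_lipschitzWith_outletField (hc : 0 < c) (hVb : 0 ≤ Vb)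
    (hG : ∀ p q : ℝ × ℝ, p.1 ∈ Icc 0 Vb → q.1 ∈ Icc 0 Vb → dist (G p) (G q) ≤ K * dist p q) :
    ∃ K', ∀ s, LipschitzWith K' (outletField c μ Vb G s) := by
  have h1 : LipschitzWith 1 fun q : ℝ × ℝ => clamp 0 Vb q.1 := by
    simpa using! (lipschitzWith_clamp 0 Vb).comp LipschitzWith.prod_fst
  have h2 : ∀ s, LipschitzWith K
      fun q : ℝ × ℝ => G (clamp 0 Vb q.1, q.2 - (s - 1) / c) := fun s => by
    refine LipschitzWith.of_dist_le_mul fun p q =>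
      (hG _ _ (clamp_mem hVb _) (clamp_mem hVb _)).trans ?_
    gcongr
    rw [Prod.dist_eq, Prod.dist_eq, dist_sub_right]
    exact max_le_max (by simpa using (lipschitzWith_clamp 0 Vb).dist_le_mul p.1 q.1) le_rfl
  have h3 : LipschitzWith ‖-(μ / c)‖₊ fun x : ℝ => -(μ / c) * x :=
    LipschitzWith.of_dist_le_mul fun x y => by
      rw [Real.dist_eq, ← mul_sub, abs_mul, Real.dist_eq, coe_nnnorm, norm_neg, Real.norm_eq_abs, abs_neg]
  obtain ⟨K₁, hK₁⟩ : ∃ K₁, LipschitzOnWith K₁ (fun x : ℝ => (c + x)⁻¹) (Icc 0 Vb) := by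
    refine LipAt.lipschitzOnWith_of_isCompact isCompact_Icc fun x hx => LipAt.inv ?_ ?_
    · exact (LipAt.const c x).add (LipAt.of_lipschitzWith LipschitzWith.id x)
    · have := hx.1
      positivity
  have h4 : LipschitzWith (K₁ * 1) fun q : ℝ × ℝ => (c + clamp 0 Vb q.1)⁻¹ := by
    rw [← lipschitzOnWith_univ] at h1 ⊢
    exact hK₁.comp h1 fun q _ => clamp_mem hVb _
  exact ⟨_, fun s => (h3.comp (h1.sub (h2 s))).prodMk h4⟩

theorem exists_solution_outletField (hc : 0 < c) (hμ : 0 ≤ μ) (hVb : 0 ≤ Vb)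
    (hG : ∀ p q : ℝ × ℝ, p.1 ∈ Icc 0 Vb → q.1 ∈ Icc 0 Vb → dist (G p) (G q) ≤ K * dist p q)
    (hGb : ∀ p : ℝ × ℝ, p.1 ∈ Icc 0 Vb → G p ∈ Icc 0 Vb) {b : ℝ} (hb : 1 ≤ b) (q₀ : ℝ × ℝ) :
    ∃ y : ℝ → ℝ × ℝ, y 1 = q₀ ∧
      ∀ s ∈ Icc 1 b, HasDerivWithinAt y (outletField c μ Vb G s (y s)) (Icc 1 b) s := by
  obtain ⟨K', hK'⟩ := exists_lipschitzWith_outletField (μ := μ) hc hVb hG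
  refine exists_solution_of_bounded_lipschitz (M := ⟨max (μ / c * Vb) c⁻¹, by positivity⟩) hK'
    (fun q => ?_) (fun s q => ?_) hb q₀
  · have hGc : Continuous fun x : ℝ => G (clamp 0 Vb q.1, x) := by
      refine (LipschitzWith.of_dist_le_mul (K := K) fun x y =>
        (hG _ _ (clamp_mem hVb _) (clamp_mem hVb _)).trans ?_).continuous
      simp [Prod.dist_eq]
    unfold outletField
    exact (continuous_const.mul (continuous_const.sub
      (hGc.comp (by fun_prop)))).prodMk continuous_const
  · have h1 := clamp_mem hVb q.1
    have h2 := hGb (clamp 0 Vb q.1, q.2 - (s - 1) / c) h1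
    refine norm_prod_le_iff.2 ⟨?_, ?_⟩
    · refine le_trans ?_ (le_max_left _ _)
      simp only [outletField, Real.norm_eq_abs, abs_mul, abs_neg,
        abs_of_nonneg (div_nonneg hμ hc.le)]
      gcongr
      exact abs_le.2 ⟨by linarith [h1.1, h2.2], by linarith [h1.2, h2.1]⟩
    · refine le_trans ?_ (le_max_right _ _)
      simp only [outletField, Real.norm_eq_abs]
      rw [abs_of_pos (by have := h1.1; positivity)]
      exact inv_anti₀ hc (by linarith [h1.1])

end OutletField

/-! ### Outlet profiles -/

/-- Data of the problem: locally Lipschitz coefficients satisfying the bounds of the statement, and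
initial profiles extended to the whole line. -/
structure IsData (c μ Vb : ℝ) (a g : ℝ → ℝ → ℝ) (θ φ : ℝ → ℝ) : Prop where
  c_pos : 0 < c
  mu_nonneg : 0 ≤ μ
  lip_a : LocallyLipschitzOn (Ici 0 ×ˢ Ici 0) fun q : ℝ × ℝ => a q.1 q.2
  lip_g : LocallyLipschitzOn (Ici 0 ×ˢ univ) fun q : ℝ × ℝ => g q.1 q.2
  g_pos : ∀ z, 0 < g 0 z
  g_ge : ∀ u, 0 ≤ u → ∀ z, g 0 z ≤ g u z
  g_le : ∀ u, 0 ≤ u → ∀ z, g u z ≤ Vb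
  lip_θ : ∀ x, LipAt θ x
  lip_φ : ∀ x, LipAt φ x
  φ_pos : ∀ x ∈ Icc (0:ℝ) 1, 0 < φ x
  φ_le : ∀ x ∈ Icc (0:ℝ) 1, φ x ≤ Vb
  compat : θ 0 = a 0 (φ 0)

/-- The value of `w` entering through `x = 0` at time `r`. -/
noncomputable def entryData (c : ℝ) (a : ℝ → ℝ → ℝ) (V : ℝ → ℝ) (r : ℝ) : ℝ :=
  a (max r 0) (V (c * max r 0))

/-- The value `z` is carried by the characteristic with label `p`. -/
def Carried (c : ℝ) (a : ℝ → ℝ → ℝ) (θ V : ℝ → ℝ) (p z : ℝ) : Prop :=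
  (∃ r ∈ Icc (0:ℝ) 1, travelTime c V r = p ∧ z = θ r) ∨
    ∃ r, 0 ≤ r ∧ entryLabel c V r = p ∧ z = a r (V (c * r))

/-- `V` is a speed profile with initial part `φ` which solves the outlet equation up to `S`. -/
structure IsOutletProfile (c μ Vb : ℝ) (a g : ℝ → ℝ → ℝ) (θ φ : ℝ → ℝ) (S : ℝ) (V : ℝ → ℝ) :
    Prop where
  isSpeed : IsSpeed Vb V
  eq_init : ∀ s ∈ Icc (0:ℝ) 1, V s = φ s
  ode : ∀ s ∈ Icc 1 S, ∃ z, Carried c a θ V (travelTime c V s - (s - 1) / c) z ∧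
    HasDerivWithinAt V (-(μ / c) * (V s - g (V s) z)) (Icc 1 S) s

section Labels

variable {c Vb S T p z s : ℝ} {a : ℝ → ℝ → ℝ} {θ V V₁ V₂ : ℝ → ℝ}

theorem IsSpeed.exists_entryLabel_eq (hV : IsSpeed Vb V) (hc : 0 < c) (hT : 0 ≤ T) (hp : p ≤ 0)
    (hTp : entryLabel c V T ≤ p) : ∃ r ∈ Icc 0 T, entryLabel c V r = p :=
  intermediate_value_Icc' hT (hV.continuous_entryLabel hc).continuousOn ⟨hTp, by simpa using hp⟩

theorem IsSpeed.outlet_label_le (hV : IsSpeed Vb V) (hc : 0 < c) (hs : 1 ≤ s) :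
    travelTime c V s - (s - 1) / c ≤ travelTime c V 1 := by
  have := hV.travelTime_sub_le hc (x := 1) (div_nonneg (sub_nonneg.2 hs) hc.le)
  rwa [mul_div_cancel₀ _ hc.ne', add_sub_cancel] at this

theorem IsSpeed.entryLabel_le_outlet_label (hV : IsSpeed Vb V) (hc : 0 < c) (hsS : s ≤ S + 1) :
    entryLabel c V (S / c) ≤ travelTime c V s - (s - 1) / c := by
  have h1 : entryLabel c V (S / c) ≤ entryLabel c V ((s - 1) / c) :=
    (hV.strictAnti_entryLabel hc).antitone (by gcongr; linarith)
  have h2 : travelTime c V (s - 1) ≤ travelTime c V s :=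
    (hV.strictMono_travelTime hc).monotone (by linarith)
  rw [entryLabel, entryLabel, mul_div_cancel₀ _ hc.ne', mul_div_cancel₀ _ hc.ne'] at h1
  rw [entryLabel, mul_div_cancel₀ _ hc.ne']
  linarith

theorem IsSpeed.exists_carried (hV : IsSpeed Vb V) (hc : 0 < c) (a : ℝ → ℝ → ℝ) (θ : ℝ → ℝ)
    (hs : 1 ≤ s) : ∃ z, Carried c a θ V (travelTime c V s - (s - 1) / c) z := by
  have := hV.exists_origin hc (div_nonneg (sub_nonneg.2 hs) hc.le) (right_mem_Icc.2 zero_le_one)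
  rw [mul_div_cancel₀ _ hc.ne', add_sub_cancel] at this
  rcases this with ⟨r, hr, h⟩ | ⟨r, hr, h⟩
  · exact ⟨_, .inl ⟨r, hr, h, rfl⟩⟩
  · exact ⟨_, .inr ⟨r, hr.1, h, rfl⟩⟩

theorem Carried.congr (h : Carried c a θ V₂ p z) (hV : IsSpeed Vb V₂) (hc : 0 < c) (hS : 1 ≤ S)
    (heq : ∀ s ∈ Icc 0 S, V₂ s = V₁ s) (hp : entryLabel c V₂ (S / c) ≤ p) :
    Carried c a θ V₁ p z := by
  rcases h with ⟨r, hr, h, rfl⟩ | ⟨r, hr, rfl, rfl⟩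
  · exact .inl ⟨r, hr, by rw [← travelTime_congr heq r ⟨hr.1, hr.2.trans hS⟩, h], rfl⟩
  · have hrS : c * r ≤ S := by
      rw [← le_div_iff₀' hc]
      exact (hV.strictAnti_entryLabel hc).le_iff_ge.1 hp
    exact .inr ⟨r, hr, (entryLabel_congr hc heq hr hrS).symm,
      by rw [heq _ ⟨mul_nonneg hc.le hr, hrS⟩]⟩

end Labels

namespace IsData

variable {c μ Vb S T : ℝ} {a g : ℝ → ℝ → ℝ} {θ φ V V₁ V₂ : ℝ → ℝ}

theorem Vb_pos (hD : IsData c μ Vb a g θ φ) : 0 < Vb :=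
  (hD.g_pos 0).trans_le (hD.g_le 0 le_rfl 0)

theorem lipAt_entryData (hD : IsData c μ Vb a g θ φ) (hV : IsSpeed Vb V) (r : ℝ) :
    LipAt (entryData c a V) r := by
  have h1 : LipAt (fun r : ℝ => max r 0) r :=
    (LipAt.of_lipschitzWith LipschitzWith.id r).max_const 0
  exact hD.lip_a.lipAt_comp (f := fun r => (max r 0, V (c * max r 0)))
    (h1.prodMk ((hV.lipAt _).comp ((LipAt.const c r).mul h1)))
    fun y => ⟨mem_Ici.2 (le_max_right _ _), mem_Ici.2 (hV.pos _).le⟩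

theorem entryData_zero (hD : IsData c μ Vb a g θ φ) (hVφ : ∀ s ∈ Icc (0:ℝ) 1, V s = φ s) :
    entryData c a V 0 = θ 0 := by
  rw [entryData, max_self, mul_zero, hVφ 0 (by simp), hD.compat]

theorem profile_eq (hD : IsData c μ Vb a g θ φ) (hV : IsSpeed Vb V)
    (hVφ : ∀ s ∈ Icc (0:ℝ) 1, V s = φ s) {p z : ℝ} (h : Carried c a θ V p z) :
    profile c V (entryData c a V) θ p = z := by
  rcases h with ⟨r, hr, rfl, rfl⟩ | ⟨r, hr, rfl, rfl⟩
  · exact hV.profile_travelTime hD.c_pos (hD.entryData_zero hVφ) hr.1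
  · rw [hV.profile_entryLabel hD.c_pos _ _ hr, entryData, max_eq_left hr]

theorem lipAt_profile (hD : IsData c μ Vb a g θ φ) (hV : IsSpeed Vb V)
    (hVφ : ∀ s ∈ Icc (0:ℝ) 1, V s = φ s) {p : ℝ} (hT : 0 ≤ T) (hTp : entryLabel c V T ≤ p) :
    LipAt (profile c V (entryData c a V) θ) p := by
  refine hV.lipAt_profile hD.c_pos (hD.entryData_zero hVφ) (fun r _ => hD.lipAt_entryData hV r)
    (fun r _ => hD.lip_θ r) fun hp => ?_
  obtain ⟨r, hr, h⟩ := hV.exists_entryLabel_eq hD.c_pos hT hp hTp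
  exact ⟨r, hr.1, h⟩

theorem lipAt_g (hD : IsData c μ Vb a g θ φ) {X : Type*} [PseudoEMetricSpace X] {u z : X → ℝ}
    {x : X} (hu : LipAt u x) (hz : LipAt z x) (h : ∀ y, 0 ≤ u y) :
    LipAt (fun y => g (u y) (z y)) x :=
  hD.lip_g.lipAt_comp (f := fun y => (u y, z y)) (hu.prodMk hz) fun y => ⟨h y, mem_univ _⟩

/-- A truncation of `(u, p) ↦ g (u, w(p))`, where `w(p)` is the value carried by the characteristic
labelled `p`. -/
theorem exists_truncation (hD : IsData c μ Vb a g θ φ) (hV : IsSpeed Vb V)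
    (hVφ : ∀ s ∈ Icc (0:ℝ) 1, V s = φ s) (hT : 0 ≤ T) :
    ∃ (G : ℝ × ℝ → ℝ) (K : NNReal) (m : ℝ), 0 < m ∧
      (∀ p q : ℝ × ℝ, p.1 ∈ Icc 0 Vb → q.1 ∈ Icc 0 Vb → dist (G p) (G q) ≤ K * dist p q) ∧
      (∀ p : ℝ × ℝ, p.1 ∈ Icc 0 Vb → G p ∈ Icc m Vb) ∧
      ∀ u p, p ∈ Icc (entryLabel c V T) (travelTime c V 1) →
        G (u, p) = g u (profile c V (entryData c a V) θ p) := by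
  have hc := hD.c_pos
  set H := profile c V (entryData c a V) θ
  set lo := entryLabel c V T
  set hi := travelTime c V 1
  have hlh : lo ≤ hi := (hV.entryLabel_nonpos hc hT).trans (hV.travelTime_nonneg hc zero_le_one)
  obtain ⟨K₁, hK₁⟩ : ∃ K, LipschitzOnWith K H (Icc lo hi) :=
    LipAt.lipschitzOnWith_of_isCompact isCompact_Icc fun p hp => hD.lipAt_profile hV hVφ hT hp.1
  have hHc : LipschitzWith (K₁ * 1) fun p => H (clamp lo hi p) := by
    have := lipschitzWith_clamp lo hi
    rw [← lipschitzOnWith_univ] at this ⊢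
    exact hK₁.comp this fun p _ => clamp_mem hlh p
  have hcomp : IsCompact (H '' Icc lo hi) := isCompact_Icc.image_of_continuousOn hK₁.continuousOn
  obtain ⟨K₂, hK₂⟩ : ∃ K, LipschitzOnWith K (fun q : ℝ × ℝ => g q.1 q.2)
      (Icc 0 Vb ×ˢ (H '' Icc lo hi)) :=
    LocallyLipschitzOn.exists_lipschitzOnWith_of_compact (isCompact_Icc.prod hcomp)
      (hD.lip_g.mono (prod_mono Icc_subset_Ici_self (subset_univ _)))
  have hg0 : ContinuousOn (fun z => g 0 z) (H '' Icc lo hi) :=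
    hK₂.continuousOn.comp (f := fun z => ((0:ℝ), z)) (by fun_prop)
      fun z hz => ⟨left_mem_Icc.2 hD.Vb_pos.le, hz⟩
  obtain ⟨z₀, -, hz₀⟩ := hcomp.exists_isMinOn ⟨_, mem_image_of_mem H (left_mem_Icc.2 hlh)⟩ hg0
  have hmem : ∀ p, H (clamp lo hi p) ∈ H '' Icc lo hi := fun p =>
    mem_image_of_mem H (clamp_mem hlh p)
  refine ⟨fun q => g q.1 (H (clamp lo hi q.2)), K₂ * max 1 (K₁ * 1), g 0 z₀, hD.g_pos _,
    fun p q hp hq => ?_, fun p hp => ⟨?_, hD.g_le _ hp.1 _⟩, fun u p hp => ?_⟩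
  · refine (hK₂.dist_le_mul (p.1, H (clamp lo hi p.2)) ⟨hp, hmem _⟩
      (q.1, H (clamp lo hi q.2)) ⟨hq, hmem _⟩).trans ?_
    rw [NNReal.coe_mul, mul_assoc]
    gcongr
    exact ((LipschitzWith.prod_fst (α := ℝ) (β := ℝ)).prodMk
      (hHc.comp (LipschitzWith.prod_snd (α := ℝ) (β := ℝ)))).weaken (by simp) |>.dist_le_mul p q
  · exact (hz₀ (hmem p.2)).trans (hD.g_ge _ hp.1 _)
  · simp only [clamp_of_mem hp]

end IsData

namespace IsOutletProfile

variable {c μ Vb S S₀ : ℝ} {a g : ℝ → ℝ → ℝ} {θ φ V V₁ V₂ : ℝ → ℝ} {G : ℝ × ℝ → ℝ}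

theorem mono (h : IsOutletProfile c μ Vb a g θ φ S V) (hS : S₀ ≤ S) :
    IsOutletProfile c μ Vb a g θ φ S₀ V where
  isSpeed := h.isSpeed
  eq_init := h.eq_init
  ode s hs := by
    obtain ⟨z, hz, hd⟩ := h.ode s ⟨hs.1, hs.2.trans hS⟩
    exact ⟨z, hz, hd.mono (Icc_subset_Icc_right hS)⟩

/-- An outlet profile agreeing with `V₁` up to `S₀` solves, up to `S₀ + 1`, the outlet equation in
which the carried value is computed from `V₁`. -/
theorem hasDerivWithinAt_outletField (hD : IsData c μ Vb a g θ φ)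
    (h₂ : IsOutletProfile c μ Vb a g θ φ S V₂) (hV₁ : IsSpeed Vb V₁)
    (hφ₁ : ∀ s ∈ Icc (0:ℝ) 1, V₁ s = φ s) (hS₀ : 1 ≤ S₀) (hS : S ≤ S₀ + 1)
    (heq : ∀ s ∈ Icc 0 S₀, V₂ s = V₁ s)
    (hG : ∀ u p, p ∈ Icc (entryLabel c V₁ (S₀ / c)) (travelTime c V₁ 1) →
        G (u, p) = g u (profile c V₁ (entryData c a V₁) θ p)) :
    ∀ s ∈ Icc 1 S, HasDerivWithinAt (fun s => (V₂ s, travelTime c V₂ s))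
      (outletField c μ Vb G s (V₂ s, travelTime c V₂ s)) (Icc 1 S) s := by
  intro s hs
  have hc := hD.c_pos
  have hV₂ := h₂.isSpeed
  obtain ⟨z, hz, hd⟩ := h₂.ode s hs
  have hlo := hV₂.entryLabel_le_outlet_label hc (hs.2.trans hS)
  have hhi := hV₂.outlet_label_le hc hs.1
  have hz₁ : profile c V₁ (entryData c a V₁) θ (travelTime c V₂ s - (s - 1) / c) = z :=
    hD.profile_eq hV₁ hφ₁ (hz.congr hV₂ hc hS₀ heq hlo)
  have e1 : entryLabel c V₂ (S₀ / c) = entryLabel c V₁ (S₀ / c) :=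
    entryLabel_congr hc heq (div_nonneg (by linarith) hc.le) (by rw [mul_div_cancel₀ _ hc.ne'])
  have e2 : travelTime c V₂ 1 = travelTime c V₁ 1 :=
    travelTime_congr heq 1 ⟨zero_le_one, hS₀⟩
  rw [e1] at hlo
  rw [e2] at hhi
  have hcl : clamp 0 Vb (V₂ s) = V₂ s := clamp_of_mem ⟨(hV₂.pos s).le, hV₂.le s⟩
  have : outletField c μ Vb G s (V₂ s, travelTime c V₂ s) =
      (-(μ / c) * (V₂ s - g (V₂ s) z), (c + V₂ s)⁻¹) := by
    simp only [outletField, hcl, hG _ _ ⟨hlo, hhi⟩, hz₁]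
  rw [this]
  exact hd.prodMk (hV₂.hasStrictDerivAt_travelTime hc s).hasDerivAt.hasDerivWithinAt

theorem eq_of_eq_pred (hD : IsData c μ Vb a g θ φ)
    (h₁ : IsOutletProfile c μ Vb a g θ φ S V₁) (h₂ : IsOutletProfile c μ Vb a g θ φ S V₂)
    (hS₀ : 1 ≤ S₀) (hS : S ≤ S₀ + 1) (heq : ∀ s ∈ Icc 0 S₀, V₂ s = V₁ s) :
    ∀ s ∈ Icc 0 S, V₂ s = V₁ s := by
  obtain ⟨G, K, m, -, hK, -, hG⟩ := hD.exists_truncation h₁.isSpeed h₁.eq_init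
    (T := S₀ / c) (div_nonneg (by linarith) hD.c_pos.le)
  obtain ⟨K', hK'⟩ := exists_lipschitzWith_outletField (μ := μ) hD.c_pos hD.Vb_pos.le hK
  have key := eqOn_Icc_of_lipschitz_field hK'
    (h₂.hasDerivWithinAt_outletField hD h₁.isSpeed h₁.eq_init hS₀ hS heq hG)
    (h₁.hasDerivWithinAt_outletField hD h₁.isSpeed h₁.eq_init hS₀ hS (fun _ _ => rfl) hG)
    (by simp only [heq 1 ⟨zero_le_one, hS₀⟩, travelTime_congr heq 1 ⟨zero_le_one, hS₀⟩])
  intro s hs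
  rcases le_total s 1 with h | h
  · exact heq s ⟨hs.1, h.trans hS₀⟩
  · exact congrArg Prod.fst (key ⟨h, hs.2⟩)

/-- Uniqueness of the outlet profile. -/
theorem unique (hD : IsData c μ Vb a g θ φ)
    (h₁ : IsOutletProfile c μ Vb a g θ φ S V₁) (h₂ : IsOutletProfile c μ Vb a g θ φ S V₂) :
    ∀ s ∈ Icc 0 S, V₂ s = V₁ s := by
  suffices H : ∀ (n : ℕ) (S : ℝ), S ≤ n + 1 → IsOutletProfile c μ Vb a g θ φ S V₁ →
      IsOutletProfile c μ Vb a g θ φ S V₂ → ∀ s ∈ Icc 0 S, V₂ s = V₁ s by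
    obtain ⟨n, hn⟩ := exists_nat_ge S
    exact H n S (by linarith) h₁ h₂
  intro n
  induction n with
  | zero =>
    intro S hS h₁ h₂ s hs
    have : s ∈ Icc (0:ℝ) 1 := ⟨hs.1, by simpa using hs.2.trans hS⟩
    rw [h₁.eq_init s this, h₂.eq_init s this]
  | succ n ih =>
    intro S hS h₁ h₂
    rcases le_total S (n + 1) with h | h
    · exact ih S h h₁ h₂
    · push_cast at hS
      exact eq_of_eq_pred hD h₁ h₂ (by linarith [n.cast_nonneg (α := ℝ)]) hS
        (ih _ le_rfl (h₁.mono h) (h₂.mono h))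

theorem of_le_one (hD : IsData c μ Vb a g θ φ) :
    IsOutletProfile c μ Vb a g θ φ 1 fun s => φ (clamp 0 1 s) := by
  have hs : IsSpeed Vb fun s => φ (clamp 0 1 s) :=
    { lipAt := fun s => (hD.lip_φ _).comp (.of_lipschitzWith (lipschitzWith_clamp 0 1) s)
      pos := fun s => hD.φ_pos _ (clamp_mem zero_le_one s)
      le := fun s => hD.φ_le _ (clamp_mem zero_le_one s) }
  refine ⟨hs, fun s hs => by simp only [clamp_of_mem hs], fun s hs1 => ?_⟩
  obtain ⟨z, hz⟩ := hs.exists_carried hD.c_pos a θ hs1.1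
  obtain rfl : s = 1 := le_antisymm hs1.2 hs1.1
  refine ⟨z, hz, ?_⟩
  rw [Icc_self]
  refine HasFDerivWithinAt.of_not_accPt ?_
  rw [accPt_iff_clusterPt, inf_principal]
  simp [ClusterPt]

/-- An outlet profile can be continued. -/
theorem exists_succ (hD : IsData c μ Vb a g θ φ) (h : IsOutletProfile c μ Vb a g θ φ S V)
    (hS : 1 ≤ S) : ∃ W, IsOutletProfile c μ Vb a g θ φ (S + 1) W := by
  have hc := hD.c_pos
  have hVb := hD.Vb_pos
  have hV := h.isSpeed
  have hφ1 : V 1 = φ 1 := h.eq_init 1 (by simp)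
  obtain ⟨G, K, m, hm, hK, hGb, hG⟩ := hD.exists_truncation hV h.eq_init
    (T := S / c) (div_nonneg (by linarith) hc.le)
  obtain ⟨K', hK'⟩ := exists_lipschitzWith_outletField (μ := μ) hc hVb.le hK
  obtain ⟨y, hy1, hy⟩ := exists_solution_outletField hc hD.mu_nonneg hVb.le hK
    (fun p hp => ⟨hm.le.trans (hGb p hp).1, (hGb p hp).2⟩) (b := S + 1) (by linarith)
    (V 1, travelTime c V 1)
  set Y : ℝ → ℝ := fun s => (y s).1 with hY
  have hYd : ∀ s ∈ Icc 1 (S + 1), HasDerivWithinAt Y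
      (outletField c μ Vb G s (y s)).1 (Icc 1 (S + 1)) s := fun s hs =>
    (hy s hs).fst
  have hΦd : ∀ s ∈ Icc 1 (S + 1), HasDerivWithinAt (fun s => (y s).2)
      (outletField c μ Vb G s (y s)).2 (Icc 1 (S + 1)) s := fun s hs =>
    (hy s hs).snd
  have hY1 : Y 1 = V 1 := by simp only [hY, hy1]
  have hμc : 0 ≤ μ / c := div_nonneg hD.mu_nonneg hc.le
  have hlow : ∀ s ∈ Icc 1 (S + 1), min (V 1) m ≤ Y s := by
    refine le_of_deriv_nonneg_below (m' := 0) (lt_min (hV.pos 1) hm) hYd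
      (by rw [hY1]; exact min_le_left _ _) fun s hs h0 h1 => ?_
    have hmem : Y s ∈ Icc 0 Vb :=
      ⟨h0.le, h1.le.trans ((min_le_left _ _).trans (hV.le 1))⟩
    have hcl : clamp 0 Vb (y s).1 = Y s := clamp_of_mem hmem
    have := (hGb (Y s, (y s).2 - (s - 1) / c) hmem).1
    simp only [outletField, hcl]
    have := h1.trans_le (min_le_right _ _)
    nlinarith
  have hupp : ∀ s ∈ Icc 1 (S + 1), -Vb ≤ -Y s := by
    refine le_of_deriv_nonneg_below (f := fun s => -Y s) (m' := -Vb - 1) (by linarith)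
      (fun s hs => (hYd s hs).neg) (by rw [hY1]; linarith [hV.le 1]) fun s hs h0 h1 => ?_
    have hcl : clamp 0 Vb (y s).1 = Vb := by
      rw [clamp, min_eq_left (by linarith [show (y s).1 = Y s from rfl]), max_eq_right hVb.le]
    have := (hGb (Vb, (y s).2 - (s - 1) / c) ⟨hVb.le, le_rfl⟩).2
    simp only [outletField, hcl]
    nlinarith
  have hYpos : ∀ s ∈ Icc 1 (S + 1), 0 < Y s := fun s hs =>
    (lt_min (hV.pos 1) hm).trans_le (hlow s hs)
  have hYle : ∀ s ∈ Icc 1 (S + 1), Y s ≤ Vb := fun s hs => neg_le_neg_iff.1 (hupp s hs)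
  have h1S : (1:ℝ) ≤ S + 1 := by linarith
  have hYlip : ∃ K, LipschitzOnWith K Y (Icc 1 (S + 1)) := by
    obtain ⟨M, hM⟩ : ∃ M : NNReal, (M : ℝ) = μ / c * Vb := ⟨⟨_, by positivity⟩, rfl⟩
    refine ⟨M, (convex_Icc 1 (S + 1)).lipschitzOnWith_of_nnnorm_hasDerivWithin_le hYd fun s hs => ?_⟩
    rw [← NNReal.coe_le_coe, coe_nnnorm, hM]
    have h1 := clamp_mem hVb.le (y s).1
    have h2 := hGb (clamp 0 Vb (y s).1, (y s).2 - (s - 1) / c) h1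
    simp only [outletField, Real.norm_eq_abs, abs_mul, abs_neg, abs_of_nonneg hμc]
    gcongr
    exact abs_le.2 ⟨by linarith [h1.1, h2.2], by linarith [h1.2, h2.1]⟩
  set W : ℝ → ℝ := fun s => if s ≤ 1 then V s else Y (clamp 1 (S + 1) s) with hW
  have hWV : ∀ s ≤ 1, W s = V s := fun s hs => if_pos hs
  have hWY : ∀ s ∈ Icc 1 (S + 1), W s = Y s := fun s hs => by
    rcases hs.1.eq_or_lt with rfl | h
    · rw [hWV 1 le_rfl, hY1]
    · rw [hW]
      simp only [if_neg (not_le.2 h), clamp_of_mem hs]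
  have hWs : IsSpeed Vb W :=
    { lipAt := fun s => by
        refine LipAt.ite_le 1 (fun _ => hV.lipAt s) (fun _ => ?_) ?_
        · obtain ⟨K, hK⟩ := hYlip
          have := lipschitzWith_clamp 1 (S + 1)
          refine LipAt.of_lipschitzWith (K := K * 1) ?_ s
          rw [← lipschitzOnWith_univ] at this ⊢
          exact hK.comp this fun p _ => clamp_mem h1S p
        · rw [clamp_of_mem (left_mem_Icc.2 h1S), hY1]
      pos := fun s => by
        simp only [hW]
        split_ifs
        exacts [hV.pos s, hYpos _ (clamp_mem h1S s)]
      le := fun s => by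
        simp only [hW]
        split_ifs
        exacts [hV.le s, hYle _ (clamp_mem h1S s)] }
  have hcl : ∀ s ∈ Icc 1 (S + 1), clamp 0 Vb (y s).1 = Y s := fun s hs =>
    clamp_of_mem ⟨(hYpos s hs).le, hYle s hs⟩
  have hΦ : ∀ s ∈ Icc 1 (S + 1), (y s).2 = travelTime c W s := by
    refine eqOn_Icc_of_hasDerivWithinAt_eq (f' := fun s => (c + Y s)⁻¹) (fun s hs => ?_)
      (fun s hs => ?_) ?_
    · refine (hΦd s hs).congr_deriv ?_
      simp only [outletField, hcl s hs]
    · rw [← hWY s hs]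
      exact (hWs.hasStrictDerivAt_travelTime hc s).hasDerivAt.hasDerivWithinAt
    · rw [hy1]
      exact travelTime_congr (S := 1) (fun s hs => (hWV s hs.2).symm) 1 (by simp)
  have hWV' : ∀ s ∈ Icc 0 S, W s = V s := by
    intro s hs
    rcases le_total s 1 with hs1 | hs1
    · exact hWV s hs1
    rw [hWY s ⟨hs1, by linarith [hs.2]⟩]
    have := eqOn_Icc_of_lipschitz_field hK'
      (fun s hs => (hy s ⟨hs.1, by linarith [hs.2]⟩).mono (Icc_subset_Icc_right (by linarith)))
      (h.hasDerivWithinAt_outletField hD hV h.eq_init hS (by linarith) (fun _ _ => rfl) hG) hy1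
      (show s ∈ Icc 1 S from ⟨hs1, hs.2⟩)
    exact congrArg Prod.fst this
  refine ⟨W, hWs, fun s hs => (hWV s hs.2).trans (h.eq_init s hs), fun s hs => ?_⟩
  obtain ⟨z, hz⟩ := hWs.exists_carried hc a θ hs.1
  refine ⟨z, hz, ?_⟩
  have hlo := hWs.entryLabel_le_outlet_label hc hs.2
  have hhi := hWs.outlet_label_le hc hs.1
  have hzV := hD.profile_eq hV h.eq_init (hz.congr hWs hc hS hWV' hlo)
  rw [entryLabel_congr hc hWV' (div_nonneg (by linarith) hc.le)
    (by rw [mul_div_cancel₀ _ hc.ne'])] at hlo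
  rw [travelTime_congr hWV' 1 ⟨zero_le_one, hS⟩] at hhi
  have hd : HasDerivWithinAt Y (-(μ / c) * (Y s - g (Y s) z)) (Icc 1 (S + 1)) s := by
    refine (hYd s hs).congr_deriv ?_
    simp only [outletField, hcl s hs, hΦ s hs, hG _ _ ⟨hlo, hhi⟩, hzV]
  rw [hWY s hs]
  exact hd.congr hWY (hWY s hs)

end IsOutletProfile

/-- Global existence of the outlet profile. -/
theorem IsData.exists_outletProfile {c μ Vb : ℝ} {a g : ℝ → ℝ → ℝ} {θ φ : ℝ → ℝ}
    (hD : IsData c μ Vb a g θ φ) : ∃ V, ∀ S, IsOutletProfile c μ Vb a g θ φ S V := by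
  have hn : ∀ n : ℕ, ∃ V, IsOutletProfile c μ Vb a g θ φ (n + 1) V := by
    intro n
    induction n with
    | zero => exact ⟨_, by simpa using IsOutletProfile.of_le_one hD⟩
    | succ n ih =>
      obtain ⟨V, hV⟩ := ih
      simpa using hV.exists_succ hD (by linarith [n.cast_nonneg (α := ℝ)])
  choose U hU using hn
  set V : ℝ → ℝ := fun s => U ⌈s⌉₊ (max s 0) with hVdef
  have hle : ∀ s : ℝ, s ≤ ⌈s⌉₊ := Nat.le_ceil
  have hVU : ∀ (n : ℕ) (s : ℝ), s ≤ n → V s = U n (max s 0) := fun n s hs => by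
    have hs' : ⌈s⌉₊ ≤ n := Nat.ceil_le.2 hs
    have h1 : (⌈s⌉₊ : ℝ) ≤ n := by exact_mod_cast hs'
    refine IsOutletProfile.unique hD ((hU n).mono (by linarith)) (hU ⌈s⌉₊) _ ⟨le_max_right _ _, ?_⟩
    exact max_le (by linarith [hle s]) (by positivity)
  have hVs : IsSpeed Vb V :=
    { lipAt := fun s => by
        obtain ⟨n, hn⟩ := exists_nat_gt s
        refine LipAt.congr (f := fun s => U n (max s 0)) ?_ ?_
        · exact ((hU n).isSpeed.lipAt _).comp
            ((LipAt.of_lipschitzWith LipschitzWith.id s).max_const 0)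
        · filter_upwards [Iio_mem_nhds hn] with r hr
          exact hVU n r (le_of_lt hr)
      pos := fun s => (hU _).isSpeed.pos _
      le := fun s => (hU _).isSpeed.le _ }
  have hVU' : ∀ (n : ℕ), ∀ s ∈ Icc (0:ℝ) n, V s = U n s := fun n s hs => by
    rw [hVU n s hs.2, max_eq_left hs.1]
  refine ⟨V, fun S => ⟨hVs, fun s hs => ?_, fun s hs => ?_⟩⟩
  · rw [hVU' 1 s (by simpa using hs), (hU 1).eq_init s hs]
  · obtain ⟨n, hn⟩ := exists_nat_ge S
    have h1n : (1:ℝ) ≤ n := hs.1.trans (hs.2.trans hn)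
    have hUV : ∀ s ∈ Icc (0:ℝ) n, U n s = V s := fun s hs => (hVU' n s hs).symm
    obtain ⟨z, hz, hd⟩ := ((hU n).mono (S₀ := n) (by linarith)).ode s ⟨hs.1, hs.2.trans hn⟩
    have hlo := (hU n).isSpeed.entryLabel_le_outlet_label hD.c_pos
      (S := n) (s := s) (by linarith [hs.2])
    have hsn : s ∈ Icc (0:ℝ) n := ⟨by linarith [hs.1], hs.2.trans hn⟩
    refine ⟨z, ?_, ?_⟩
    · rw [← travelTime_congr hUV s hsn]
      exact hz.congr (hU n).isSpeed hD.c_pos h1n hUV hlo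
    · rw [← hUV s hsn]
      refine (hd.mono (Icc_subset_Icc_right hn)).congr (fun r hr => ?_) (hUV s hsn).symm
      exact (hUV r ⟨by linarith [hr.1], hr.2.trans hn⟩).symm

/-! ### The solution built from an outlet profile -/

theorem lipAt_clm_apply {X E F : Type*} [PseudoEMetricSpace X] [NormedAddCommGroup E]
    [NormedSpace ℝ E] [NormedAddCommGroup F] [NormedSpace ℝ F] {L : X → E →L[ℝ] F} {u : X → E}
    {x : X} (hL : LipAt L x) (hu : LipAt u x) : LipAt (fun y => L y (u y)) x :=
  (LipAt.of_contDiffAt (f := fun p : (E →L[ℝ] F) × E => p.1 p.2) (by fun_prop)).comp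
    (hL.prodMk hu)

/-- The right-hand side of the outlet equation. -/
noncomputable def outletRate (c μ : ℝ) (a g : ℝ → ℝ → ℝ) (θ V : ℝ → ℝ) (s : ℝ) : ℝ :=
  -(μ / c) * (V s - g (V s)
    (profile c V (entryData c a V) θ (travelTime c V s - (s - 1) / c)))

/-- The derivative of the outlet profile. -/
noncomputable def speedDeriv (c μ : ℝ) (a g : ℝ → ℝ → ℝ) (θ φ' V : ℝ → ℝ) (s : ℝ) : ℝ :=
  if s ≤ 1 then φ' s else outletRate c μ a g θ V s

/-- The derivative of the entry data. -/
noncomputable def entryDeriv (c : ℝ) (a : ℝ → ℝ → ℝ) (V V' : ℝ → ℝ) (r : ℝ) : ℝ :=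
  fderivWithin ℝ (fun q : ℝ × ℝ => a q.1 q.2) (Ici 0 ×ˢ Ici 0) (max r 0, V (c * max r 0))
    (1, c * V' (c * max r 0))

/-- The derivative of `w` with respect to the characteristic label. -/
noncomputable def profileDeriv (c : ℝ) (a : ℝ → ℝ → ℝ) (θ' V V' : ℝ → ℝ) : ℝ → ℝ :=
  profile c V (fun r => entryDeriv c a V V' r * -((c + V (c * r)) / V (c * r)))
    (fun r => θ' r * (c + V r))

namespace IsData

variable {c μ Vb : ℝ} {a g : ℝ → ℝ → ℝ} {θ θ' φ φ' V V' : ℝ → ℝ}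

theorem lipAt_outletRate (hD : IsData c μ Vb a g θ φ) (hV : IsSpeed Vb V)
    (hVφ : ∀ s ∈ Icc (0:ℝ) 1, V s = φ s) {s : ℝ} (hs : 1 ≤ s) :
    LipAt (outletRate c μ a g θ V) s := by
  have hc := hD.c_pos
  have hlabel : LipAt (fun s => travelTime c V s - (s - 1) / c) s :=
    (hV.lipAt_travelTime hc s).sub (LipAt.of_contDiffAt (by fun_prop))
  have hH : LipAt (fun s => profile c V (entryData c a V) θ (travelTime c V s - (s - 1) / c)) s :=
    LipAt.comp (f := fun s => travelTime c V s - (s - 1) / c)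
      (hD.lipAt_profile hV hVφ (div_nonneg (sub_nonneg.2 hs) hc.le)
        (hV.entryLabel_le_outlet_label hc (by linarith))) hlabel
  have hg := hD.lipAt_g (hV.lipAt s) hH fun y => (hV.pos y).le
  exact (LipAt.const (-(μ / c)) s).mul ((hV.lipAt s).sub hg)

theorem outletRate_one (hD : IsData c μ Vb a g θ φ) (hV : IsSpeed Vb V)
    (hVφ : ∀ s ∈ Icc (0:ℝ) 1, V s = φ s)
    (hcomp : φ' 1 = -(μ / c) * (φ 1 - g (φ 1) (θ 1))) : outletRate c μ a g θ V 1 = φ' 1 := by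
  rw [outletRate, sub_self, zero_div, sub_zero,
    hV.profile_travelTime hD.c_pos (hD.entryData_zero hVφ) zero_le_one, hVφ 1 (by simp), hcomp]

theorem speedDeriv_of_one_le (hD : IsData c μ Vb a g θ φ) (hV : IsSpeed Vb V)
    (hVφ : ∀ s ∈ Icc (0:ℝ) 1, V s = φ s)
    (hcomp : φ' 1 = -(μ / c) * (φ 1 - g (φ 1) (θ 1))) {s : ℝ} (hs : 1 ≤ s) :
    speedDeriv c μ a g θ φ' V s = outletRate c μ a g θ V s := by
  rcases hs.eq_or_lt with rfl | hs
  · rw [speedDeriv, if_pos le_rfl, hD.outletRate_one hV hVφ hcomp]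
  · rw [speedDeriv, if_neg (not_le.2 hs)]

theorem lipAt_speedDeriv (hD : IsData c μ Vb a g θ φ) (hV : IsSpeed Vb V)
    (hVφ : ∀ s ∈ Icc (0:ℝ) 1, V s = φ s)
    (hcomp : φ' 1 = -(μ / c) * (φ 1 - g (φ 1) (θ 1))) (hφ' : ∀ x, LipAt φ' x) (s : ℝ) :
    LipAt (speedDeriv c μ a g θ φ' V) s :=
  LipAt.ite_le 1 (fun _ => hφ' s) (fun h => hD.lipAt_outletRate hV hVφ h)
    (hD.outletRate_one hV hVφ hcomp).symm

theorem hasDerivWithinAt_speed (hD : IsData c μ Vb a g θ φ)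
    (h : ∀ S, IsOutletProfile c μ Vb a g θ φ S V)
    (hφ : ∀ x, HasDerivAt φ (φ' x) x)
    (hcomp : φ' 1 = -(μ / c) * (φ 1 - g (φ 1) (θ 1))) {s : ℝ} (hs : 0 ≤ s) :
    HasDerivWithinAt V (speedDeriv c μ a g θ φ' V s) (Ici 0) s := by
  have hV := (h 0).isSpeed
  have hVφ := (h 0).eq_init
  suffices H : HasDerivWithinAt (fun y => if y ≤ 1 then V y else V y)
      (speedDeriv c μ a g θ φ' V s) (Ici 0) s by simpa using H
  refine HasDerivWithinAt.ite_le (fun hs1 => ?_) (fun hs1 => ?_) rfl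
  · rw [speedDeriv, if_pos hs1]
    exact (hφ s).hasDerivWithinAt.congr (fun y hy => hVφ y hy) (hVφ s ⟨hs, hs1⟩)
  · rw [hD.speedDeriv_of_one_le hV hVφ hcomp hs1]
    obtain ⟨z, hz, hd⟩ := (h (s + 1)).ode s ⟨hs1, by linarith⟩
    rw [outletRate, hD.profile_eq hV hVφ hz]
    refine hd.mono_of_mem_nhdsWithin ?_
    rw [inter_eq_right.2 (Ici_subset_Ici.2 zero_le_one), ← Ici_inter_Iic]
    exact inter_mem self_mem_nhdsWithin
      (mem_nhdsWithin_of_mem_nhds (Iic_mem_nhds (by linarith)))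

theorem uniqueDiffOn_quadrant : UniqueDiffOn ℝ (Ici (0:ℝ) ×ˢ Ici (0:ℝ)) :=
  (uniqueDiffOn_Ici 0).prod (uniqueDiffOn_Ici 0)

theorem hasDerivWithinAt_entryData (hc : 0 < c)
    (ha : DifferentiableOn ℝ (fun q : ℝ × ℝ => a q.1 q.2) (Ici 0 ×ˢ Ici 0))
    (hV : IsSpeed Vb V) (hV' : ∀ s, 0 ≤ s → HasDerivWithinAt V (V' s) (Ici 0) s) {r : ℝ}
    (hr : 0 ≤ r) :
    HasDerivWithinAt (entryData c a V) (entryDeriv c a V V' r) (Ici 0) r := by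
  have h1 : HasDerivWithinAt (fun r => V (c * r)) (c * V' (c * r)) (Ici 0) r := by
    have := (hV' (c * r) (by positivity)).comp r (((hasDerivWithinAt_id r (Ici 0)).const_mul c))
      fun y hy => mul_nonneg hc.le hy
    refine this.congr_deriv ?_
    ring
  have h2 : HasDerivWithinAt (fun r => (r, V (c * r))) (1, c * V' (c * r)) (Ici 0) r :=
    (hasDerivWithinAt_id r _).prodMk h1
  have h3 := (ha (r, V (c * r)) (mk_mem_prod (mem_Ici.2 hr)
    (mem_Ici.2 (hV.pos _).le))).hasFDerivWithinAt.comp_hasDerivWithinAt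
    (f := fun r => (r, V (c * r))) (s := Ici 0) r h2
    fun y hy => ⟨hy, mem_Ici.2 (hV.pos (c * y)).le⟩
  rw [entryDeriv, max_eq_left hr]
  refine h3.congr (fun y hy => ?_) ?_
  · rw [entryData, max_eq_left hy]; rfl
  · rw [entryData, max_eq_left hr]; rfl

theorem lipAt_entryDeriv (hc : 0 < c)
    (ha : ContDiffOn ℝ 2 (fun q : ℝ × ℝ => a q.1 q.2) (Ici 0 ×ˢ Ici 0))
    (hV : IsSpeed Vb V) (hV' : ∀ s, 0 ≤ s → LipAt V' s) (r : ℝ) :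
    LipAt (entryDeriv c a V V') r := by
  have h1 : LipAt (fun r : ℝ => max r 0) r :=
    (LipAt.of_lipschitzWith LipschitzWith.id r).max_const 0
  have h2 : LipAt (fun r : ℝ => c * max r 0) r := (LipAt.const c r).mul h1
  have h3 : LocallyLipschitzOn (Ici 0 ×ˢ Ici 0)
      (fderivWithin ℝ (fun q : ℝ × ℝ => a q.1 q.2) (Ici 0 ×ˢ Ici 0)) :=
    (ha.fderivWithin uniqueDiffOn_quadrant (m := 1) (by norm_num)).locallyLipschitzOn
      ((convex_Ici 0).prod (convex_Ici 0))
  refine lipAt_clm_apply (h3.lipAt_comp (f := fun r => (max r 0, V (c * max r 0)))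
    (h1.prodMk ((hV.lipAt _).comp h2))
    fun y => ⟨mem_Ici.2 (le_max_right _ _), mem_Ici.2 (hV.pos _).le⟩) ?_
  have h4 : LipAt (fun r => V' (c * max r 0)) r :=
    LipAt.comp (f := fun r : ℝ => c * max r 0) (hV' _ (mul_nonneg hc.le (le_max_right _ _))) h2
  exact (LipAt.const _ _).prodMk ((LipAt.const _ _).mul h4)

theorem entryDeriv_zero
    (ha : DifferentiableOn ℝ (fun q : ℝ × ℝ => a q.1 q.2) (Ici 0 ×ˢ Ici 0)) (hV0 : 0 ≤ V 0) :
    entryDeriv c a V V' 0 = derivWithin (fun s => a s (V 0)) (Ici 0) 0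
        + c * derivWithin (fun u => a 0 u) (Ici 0) (V 0) * V' 0 := by
  have hA := (ha (0, V 0) ⟨self_mem_Ici, hV0⟩).hasFDerivWithinAt
  have h1 := (hA.comp_hasDerivWithinAt (f := fun s : ℝ => (s, V 0)) (s := Ici 0) (0:ℝ)
    ((hasDerivWithinAt_id _ _).prodMk (hasDerivWithinAt_const _ _ _))
    fun y hy => ⟨hy, hV0⟩).derivWithin (uniqueDiffOn_Ici 0 _ self_mem_Ici)
  have h2 := (hA.comp_hasDerivWithinAt (f := fun u : ℝ => ((0:ℝ), u)) (s := Ici 0) (V 0)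
    ((hasDerivWithinAt_const _ _ _).prodMk (hasDerivWithinAt_id _ _))
    fun y hy => ⟨self_mem_Ici, hy⟩).derivWithin (uniqueDiffOn_Ici 0 _ hV0)
  simp only [Function.comp_def] at h1 h2
  rw [h1, h2, entryDeriv, max_self, mul_zero, mul_right_comm, ← smul_eq_mul (c * V' 0),
    ← map_smul, ← map_add]
  simp

end IsData

/-- The label of the characteristic through `(t, x)`. -/
noncomputable def charLabel (c : ℝ) (V : ℝ → ℝ) (t x : ℝ) : ℝ := travelTime c V (x + c * t) - t

section CharLabel

variable {c Vb : ℝ} {V : ℝ → ℝ}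

theorem charLabel_zero_left (x : ℝ) : charLabel c V 0 x = travelTime c V x := by
  simp [charLabel]

theorem charLabel_zero_right (t : ℝ) : charLabel c V t 0 = entryLabel c V t := by
  simp [charLabel, entryLabel]

theorem IsSpeed.entryLabel_le_charLabel (hV : IsSpeed Vb V) (hc : 0 < c) {t x : ℝ} (hx : 0 ≤ x) :
    entryLabel c V t ≤ charLabel c V t x :=
  sub_le_sub_right ((hV.strictMono_travelTime hc).monotone (by linarith)) t

theorem lipAt_add_mul (c : ℝ) (q : ℝ × ℝ) : LipAt (fun q : ℝ × ℝ => q.2 + c * q.1) q :=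
  LipAt.of_contDiffAt (by fun_prop)

theorem IsSpeed.lipAt_charLabel (hV : IsSpeed Vb V) (hc : 0 < c) (q : ℝ × ℝ) :
    LipAt (fun q : ℝ × ℝ => charLabel c V q.1 q.2) q :=
  (LipAt.comp (f := fun q : ℝ × ℝ => q.2 + c * q.1) (hV.lipAt_travelTime hc _)
    (lipAt_add_mul c q)).sub (LipAt.of_contDiffAt (by fun_prop))

theorem IsSpeed.hasDerivAt_charLabel_left (hV : IsSpeed Vb V) (hc : 0 < c) (t x : ℝ) :
    HasDerivAt (fun s => charLabel c V s x) (-V (x + c * t) * (c + V (x + c * t))⁻¹) t := by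
  have h := ((hV.hasStrictDerivAt_travelTime hc _).hasDerivAt.comp t
    (((hasDerivAt_id t).const_mul c).const_add x)).sub (hasDerivAt_id t)
  refine h.congr_deriv ?_
  have := (hV.add_pos hc (x + c * t)).ne'
  simp only [id]
  field_simp
  ring

theorem IsSpeed.hasDerivAt_charLabel_right (hV : IsSpeed Vb V) (hc : 0 < c) (t x : ℝ) :
    HasDerivAt (fun y => charLabel c V t y) (c + V (x + c * t))⁻¹ x := by
  have h := ((hV.hasStrictDerivAt_travelTime hc _).hasDerivAt.comp x
    ((hasDerivAt_id x).add_const (c * t))).sub_const t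
  refine h.congr_deriv ?_
  simp

end CharLabel

namespace IsData

variable {c μ Vb : ℝ} {a g : ℝ → ℝ → ℝ} {θ θ' φ φ' V V' : ℝ → ℝ}

theorem entryDeriv_compat (hV : IsSpeed Vb V)
    (h0 : entryDeriv c a V V' 0 = -V 0 * θ' 0) :
    entryDeriv c a V V' 0 * -((c + V (c * 0)) / V (c * 0)) = θ' 0 * (c + V 0) := by
  have := (hV.pos 0).ne'
  rw [h0, mul_zero]
  field_simp

theorem hasDerivAt_profile (hD : IsData c μ Vb a g θ φ)
    (ha : ContDiffOn ℝ 2 (fun q : ℝ × ℝ => a q.1 q.2) (Ici 0 ×ˢ Ici 0))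
    (hV : IsSpeed Vb V) (hVφ : ∀ s ∈ Icc (0:ℝ) 1, V s = φ s)
    (hV' : ∀ s, 0 ≤ s → HasDerivWithinAt V (V' s) (Ici 0) s) (hθ : ∀ x, HasDerivAt θ (θ' x) x)
    (h0 : entryDeriv c a V V' 0 = -V 0 * θ' 0) {T p : ℝ} (hT : 0 ≤ T)
    (hTp : entryLabel c V T ≤ p) :
    HasDerivAt (profile c V (entryData c a V) θ) (profileDeriv c a θ' V V' p) p := by
  have hc := hD.c_pos
  have hex : ∀ T, 0 ≤ T → ∀ q, entryLabel c V T ≤ q → q ≤ 0 →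
      ∃ r, 0 ≤ r ∧ entryLabel c V r = q := fun T hT q hTq hq => by
    obtain ⟨r, hr, h⟩ := hV.exists_entryLabel_eq hc hT hq hTq
    exact ⟨r, hr.1, h⟩
  refine hV.hasDerivAt_profile hc (hD.entryData_zero hVφ) (entryDeriv_compat hV h0)
    (fun r hr => hasDerivWithinAt_entryData hc (ha.differentiableOn (by norm_num)) hV hV' hr)
    (fun r _ => (hθ r).hasDerivWithinAt) (hex T hT p hTp) ?_
  have hlt : entryLabel c V (T + 1) < p := (hV.strictAnti_entryLabel hc (lt_add_one T)).trans_le hTp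
  filter_upwards [Ioi_mem_nhds hlt] with q hq
  exact hex (T + 1) (by linarith) q (le_of_lt hq)

theorem lipAt_profileDeriv (hD : IsData c μ Vb a g θ φ)
    (ha : ContDiffOn ℝ 2 (fun q : ℝ × ℝ => a q.1 q.2) (Ici 0 ×ˢ Ici 0))
    (hV : IsSpeed Vb V) (hV' : ∀ s, 0 ≤ s → LipAt V' s) (hθ' : ∀ x, LipAt θ' x)
    (h0 : entryDeriv c a V V' 0 = -V 0 * θ' 0) {T p : ℝ} (hT : 0 ≤ T)
    (hTp : entryLabel c V T ≤ p) : LipAt (profileDeriv c a θ' V V') p := by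
  have hc := hD.c_pos
  refine hV.lipAt_profile hc (entryDeriv_compat hV h0) (fun r _ => ?_) (fun r _ => ?_)
    fun hp => ?_
  · have h1 : LipAt (fun r => V (c * r)) r :=
      LipAt.comp (f := fun r => c * r) (hV.lipAt _) (LipAt.of_contDiffAt (by fun_prop))
    exact (lipAt_entryDeriv hc ha hV hV' r).mul
      ((((LipAt.const c r).add h1).div h1 (hV.pos _).ne').neg)
  · exact (hθ' r).mul ((LipAt.const c r).add (hV.lipAt r))
  · obtain ⟨r, hr, h⟩ := hV.exists_entryLabel_eq hc hT hp hTp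
    exact ⟨r, hr.1, h⟩

/-- The classical solution generated by a global outlet profile. -/
theorem exists_derivatives (hD : IsData c μ Vb a g θ φ)
    (ha : ContDiffOn ℝ 2 (fun q : ℝ × ℝ => a q.1 q.2) (Ici 0 ×ˢ Ici 0))
    (h : ∀ S, IsOutletProfile c μ Vb a g θ φ S V)
    (hφ : ∀ x, HasDerivAt φ (φ' x) x) (hθ : ∀ x, HasDerivAt θ (θ' x) x)
    (hφ' : ∀ x, LipAt φ' x) (hθ' : ∀ x, LipAt θ' x)
    (hcomp2 : derivWithin (fun s => a s (φ 0)) (Ici 0) 0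
        + c * derivWithin (fun u => a 0 u) (Ici 0) (φ 0) * φ' 0 = -(φ 0) * θ' 0)
    (hcomp3 : φ' 1 = -(μ / c) * (φ 1 - g (φ 1) (θ 1))) :
    ∃ wt wx vt vx : ℝ → ℝ → ℝ,
      IsSol2 c μ a g (fun t x => profile c V (entryData c a V) θ (charLabel c V t x))
        (fun t x => V (x + c * t)) wt wx vt vx ∧
      ∀ q ∈ Ici (0:ℝ) ×ˢ Icc (0:ℝ) 1,
        LipAt (fun q : ℝ × ℝ => wt q.1 q.2) q ∧ LipAt (fun q : ℝ × ℝ => wx q.1 q.2) q ∧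
        LipAt (fun q : ℝ × ℝ => vt q.1 q.2) q ∧ LipAt (fun q : ℝ × ℝ => vx q.1 q.2) q := by
  have hc := hD.c_pos
  have hV := (h 0).isSpeed
  have hVφ := (h 0).eq_init
  set V' := speedDeriv c μ a g θ φ' V with hV'def
  set H := profile c V (entryData c a V) θ with hH
  set H' := profileDeriv c a θ' V V' with hH'
  have hV' : ∀ s, 0 ≤ s → HasDerivWithinAt V (V' s) (Ici 0) s := fun s hs =>
    hD.hasDerivWithinAt_speed h hφ hcomp3 hs
  have hV'l : ∀ s, LipAt V' s := fun s => hD.lipAt_speedDeriv hV hVφ hcomp3 hφ' s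
  have hV0 : V 0 = φ 0 := hVφ 0 (by simp)
  have h0 : entryDeriv c a V V' 0 = -V 0 * θ' 0 := by
    rw [entryDeriv_zero (ha.differentiableOn (by norm_num)) (hV.pos 0).le, hV0, ← hcomp2, hV'def,
      speedDeriv, if_pos zero_le_one]
  have hHd : ∀ t ∈ Ici (0:ℝ), ∀ x ∈ Icc (0:ℝ) 1,
      HasDerivAt H (H' (charLabel c V t x)) (charLabel c V t x) := fun t ht x hx =>
    hD.hasDerivAt_profile ha hV hVφ hV' hθ h0 ht (hV.entryLabel_le_charLabel hc hx.1)
  have lv : ∀ q : ℝ × ℝ, LipAt (fun q : ℝ × ℝ => V (q.2 + c * q.1)) q := fun q =>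
    LipAt.comp (f := fun q : ℝ × ℝ => q.2 + c * q.1) (hV.lipAt _) (lipAt_add_mul c q)
  have lvx : ∀ q : ℝ × ℝ, LipAt (fun q : ℝ × ℝ => V' (q.2 + c * q.1)) q := fun q =>
    LipAt.comp (f := fun q : ℝ × ℝ => q.2 + c * q.1) (hV'l _) (lipAt_add_mul c q)
  have lvt : ∀ q : ℝ × ℝ, LipAt (fun q : ℝ × ℝ => c * V' (q.2 + c * q.1)) q := fun q =>
    (LipAt.const c q).mul (lvx q)
  have lw : ∀ q ∈ Ici (0:ℝ) ×ˢ Icc (0:ℝ) 1,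
      LipAt (fun q : ℝ × ℝ => H (charLabel c V q.1 q.2)) q := fun q hq =>
    LipAt.comp (f := fun q : ℝ × ℝ => charLabel c V q.1 q.2)
      (hD.lipAt_profile hV hVφ hq.1 (hV.entryLabel_le_charLabel hc hq.2.1))
      (hV.lipAt_charLabel hc q)
  have lwx : ∀ q ∈ Ici (0:ℝ) ×ˢ Icc (0:ℝ) 1, LipAt (fun q : ℝ × ℝ =>
      H' (charLabel c V q.1 q.2) * (c + V (q.2 + c * q.1))⁻¹) q := fun q hq =>
    (LipAt.comp (f := fun q : ℝ × ℝ => charLabel c V q.1 q.2)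
      (hD.lipAt_profileDeriv ha hV (fun s _ => hV'l s) hθ' h0 hq.1
        (hV.entryLabel_le_charLabel hc hq.2.1)) (hV.lipAt_charLabel hc q)).mul
      (((LipAt.const c q).add (lv q)).inv (hV.add_pos hc _).ne')
  have lwt : ∀ q ∈ Ici (0:ℝ) ×ˢ Icc (0:ℝ) 1, LipAt (fun q : ℝ × ℝ =>
      -V (q.2 + c * q.1) * (H' (charLabel c V q.1 q.2) * (c + V (q.2 + c * q.1))⁻¹)) q :=
    fun q hq => (lv q).neg.mul (lwx q hq)
  refine ⟨fun t x => -V (x + c * t) * (H' (charLabel c V t x) * (c + V (x + c * t))⁻¹),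
    fun t x => H' (charLabel c V t x) * (c + V (x + c * t))⁻¹,
    fun t x => c * V' (x + c * t), fun t x => V' (x + c * t),
    ⟨fun q hq => (lw q hq).continuousAt.continuousWithinAt,
      fun q _ => (lv q).continuousAt.continuousWithinAt,
      fun q hq => (lwt q hq).continuousAt.continuousWithinAt,
      fun q hq => (lwx q hq).continuousAt.continuousWithinAt,
      fun q _ => (lvt q).continuousAt.continuousWithinAt,
      fun q _ => (lvx q).continuousAt.continuousWithinAt,
      fun t ht x hx => ⟨?_, ?_, ?_, ?_⟩, fun t ht x hx => ⟨?_, ?_⟩, fun t ht => ⟨?_, ?_⟩⟩,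
    fun q hq => ⟨lwt q hq, lwx q hq, lvt q, lvx q⟩⟩
  · refine ((HasDerivAt.comp (h := fun s => charLabel c V s x) (h₂ := H) t (hHd t ht x hx)
      (hV.hasDerivAt_charLabel_left hc t x)).congr_deriv ?_).hasDerivWithinAt
    ring
  · exact (HasDerivAt.comp (h := fun y => charLabel c V t y) (h₂ := H) x (hHd t ht x hx)
      (hV.hasDerivAt_charLabel_right hc t x)).hasDerivWithinAt
  · have h1 : HasDerivWithinAt (fun s => x + c * s) (c * 1) (Ici 0) t :=
      ((hasDerivWithinAt_id t _).const_mul c).const_add x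
    refine ((hV' (x + c * t) (add_nonneg hx.1 (mul_nonneg hc.le ht))).comp t h1 fun s hs =>
      add_nonneg hx.1 (mul_nonneg hc.le hs)).congr_deriv ?_
    ring
  · have h1 : HasDerivWithinAt (fun y => y + c * t) 1 (Icc 0 1) x :=
      (hasDerivWithinAt_id x _).add_const (c * t)
    refine ((hV' (x + c * t) (add_nonneg hx.1 (mul_nonneg hc.le ht))).comp x h1 fun y hy =>
      add_nonneg hy.1 (mul_nonneg hc.le ht)).congr_deriv ?_
    ring
  · ring
  · ring
  · simp only
    rw [charLabel_zero_right, hH, hV.profile_entryLabel hc _ _ ht, entryData, max_eq_left ht,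
      zero_add]
  · have h1 : 1 ≤ 1 + c * t := le_add_of_nonneg_right (mul_nonneg hc.le ht)
    simp only
    rw [hV'def, hD.speedDeriv_of_one_le hV hVφ hcomp3 h1, outletRate, charLabel, add_sub_cancel_left,
      mul_div_cancel_left₀ _ hc.ne', ← hH]
    field_simp

end IsData

section Bounds

variable {c μ Vb p t x z : ℝ} {a g : ℝ → ℝ → ℝ} {θ φ V : ℝ → ℝ}

theorem abs_le_Bt (ha : ContinuousOn (fun q : ℝ × ℝ => a q.1 q.2) (Ici 0 ×ˢ Ici 0)) {r u : ℝ}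
    (hr : r ∈ Icc 0 t) (hu : u ∈ Icc 0 Vb) : |a r u| ≤ Bt a Vb t := by
  have himage : {y : ℝ | ∃ s ∈ Icc (0:ℝ) t, ∃ u ∈ Icc (0:ℝ) Vb, y = |a s u|} =
      (fun q : ℝ × ℝ => |a q.1 q.2|) '' (Icc 0 t ×ˢ Icc 0 Vb) := by
    ext y
    constructor
    · rintro ⟨s, hs, u, hu, rfl⟩
      exact ⟨(s, u), ⟨hs, hu⟩, rfl⟩
    · rintro ⟨⟨s, u⟩, ⟨hs, hu⟩, rfl⟩
      exact ⟨s, hs, u, hu, rfl⟩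
  rw [Bt, himage]
  exact le_csSup ((isCompact_Icc.prod isCompact_Icc).image_of_continuousOn
    (ha.mono (prod_mono Icc_subset_Ici_self Icc_subset_Ici_self)).abs).bddAbove
    ⟨(r, u), ⟨hr, hu⟩, rfl⟩

theorem Carried.abs_le (hD : IsData c μ Vb a g θ φ) (hV : IsSpeed Vb V)
    (h : Carried c a θ V p z) (hp : entryLabel c V t ≤ p) :
    |z| ≤ max (Bt a Vb t) (sSup ((fun z => |θ z|) '' Icc (0:ℝ) 1)) := by
  rcases h with ⟨r, hr, -, rfl⟩ | ⟨r, hr, rfl, rfl⟩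
  · refine le_max_of_le_right (le_csSup (isCompact_Icc.image_of_continuousOn ?_).bddAbove
      ⟨r, hr, rfl⟩)
    exact fun x _ => (hD.lip_θ x).continuousAt.abs.continuousWithinAt
  · exact le_max_of_le_left (abs_le_Bt hD.lip_a.continuousOn
      ⟨hr, (hV.strictAnti_entryLabel hD.c_pos).le_iff_ge.1 hp⟩ ⟨(hV.pos _).le, hV.le _⟩)

theorem IsData.abs_profile_le (hD : IsData c μ Vb a g θ φ) (hV : IsSpeed Vb V)
    (hVφ : ∀ s ∈ Icc (0:ℝ) 1, V s = φ s) (ht : 0 ≤ t) (hx : x ∈ Icc (0:ℝ) 1) :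
    |profile c V (entryData c a V) θ (charLabel c V t x)| ≤
      max (Bt a Vb t) (sSup ((fun z => |θ z|) '' Icc (0:ℝ) 1)) := by
  obtain ⟨z, hz⟩ : ∃ z, Carried c a θ V (charLabel c V t x) z := by
    rcases hV.exists_origin hD.c_pos ht hx with ⟨r, hr, h⟩ | ⟨r, hr, h⟩
    · exact ⟨_, .inl ⟨r, hr, h, rfl⟩⟩
    · exact ⟨_, .inr ⟨r, hr.1, h, rfl⟩⟩
  rw [hD.profile_eq hV hVφ hz]
  exact hz.abs_le hD hV (hV.entryLabel_le_charLabel hD.c_pos hx.1)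

theorem IsOutletProfile.min_le (hD : IsData c μ Vb a g θ φ)
    (h : ∀ S, IsOutletProfile c μ Vb a g θ φ S V) (ht : 0 ≤ t) (hx : x ∈ Icc (0:ℝ) 1) :
    min (sInf (φ '' Icc (0:ℝ) 1)) (sInf {y : ℝ | ∃ z : ℝ,
      |z| ≤ max (Bt a Vb t) (sSup ((fun z => |θ z|) '' Icc (0:ℝ) 1)) ∧ y = g 0 z}) ≤
      V (x + c * t) := by
  have hc := hD.c_pos
  have hV := (h 0).isSpeed
  have hφ : ∀ s ∈ Icc (0:ℝ) 1, sInf (φ '' Icc (0:ℝ) 1) ≤ V s := fun s hs => by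
    rw [(h 0).eq_init s hs]
    exact csInf_le (isCompact_Icc.image_of_continuousOn fun x _ =>
      (hD.lip_φ x).continuousAt.continuousWithinAt).bddBelow ⟨s, hs, rfl⟩
  have hct := mul_nonneg hc.le ht
  rcases le_total (x + c * t) 1 with h1 | h1
  · exact min_le_of_left_le (hφ _ ⟨add_nonneg hx.1 hct, h1⟩)
  · choose! Z hZ hZd using (h (x + c * t)).ode
    refine le_of_deriv_nonneg_below (sub_one_lt _) hZd
      (min_le_of_left_le (hφ 1 (right_mem_Icc.2 zero_le_one))) (fun s hs _ hlt => ?_) _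
      (right_mem_Icc.2 h1)
    have hlabel := hV.entryLabel_le_outlet_label hc (s := s) (S := c * t)
      (by linarith [hs.2, hx.2])
    rw [mul_div_cancel_left₀ _ hc.ne'] at hlabel
    have hg : sInf {y : ℝ | ∃ z : ℝ,
        |z| ≤ max (Bt a Vb t) (sSup ((fun z => |θ z|) '' Icc (0:ℝ) 1)) ∧ y = g 0 z} ≤
        g 0 (Z s) :=
      csInf_le ⟨0, by rintro _ ⟨z, -, rfl⟩; exact (hD.g_pos z).le⟩
        ⟨_, (hZ s hs).abs_le hD hV hlabel, rfl⟩
    have hle : V s ≤ g (V s) (Z s) :=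
      (hlt.le.trans (min_le_right _ _)).trans (hg.trans (hD.g_ge _ (hV.pos s).le _))
    rw [neg_mul_comm, neg_sub]
    exact mul_nonneg (div_nonneg hD.mu_nonneg hc.le) (sub_nonneg.2 hle)

end Bounds

/-- The speed profile of a solution, recovered from its initial and outlet values. -/
noncomputable def speedTrace (c : ℝ) (φ : ℝ → ℝ) (v : ℝ → ℝ → ℝ) (s : ℝ) : ℝ :=
  if s ≤ 1 then φ (max s 0) else v (max ((s - 1) / c) 0) 1

theorem speedTrace_of_mem {c : ℝ} {φ : ℝ → ℝ} {v : ℝ → ℝ → ℝ} {s : ℝ} (hs : s ∈ Icc (0:ℝ) 1) :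
    speedTrace c φ v s = φ s := by
  rw [speedTrace, if_pos hs.2, max_eq_left hs.1]

/-- The characteristic with label `p`, as a function of time. -/
theorem IsSpeed.hasDerivAt_characteristic {c Vb : ℝ} {V : ℝ → ℝ} (hV : IsSpeed Vb V) (hc : 0 < c)
    (p σ : ℝ) : HasDerivAt (fun σ => Function.invFun (travelTime c V) (σ + p) - c * σ)
      (V (Function.invFun (travelTime c V) (σ + p))) σ := by
  obtain ⟨s, hs⟩ := hV.surjective_travelTime hc (σ + p)
  have h := hV.hasStrictDerivAt_invFun_travelTime hc s
  rw [hs] at h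
  have h1 : HasDerivAt (fun σ => Function.invFun (travelTime c V) (σ + p)) (c + V s) σ := by
    simpa using h.hasDerivAt.comp_add_const σ p
  refine (h1.sub ((hasDerivAt_id σ).const_mul c)).congr_deriv ?_
  rw [← hs, hV.invFun_travelTime hc]
  ring

namespace IsData

variable {c μ Vb t t₀ x x₀ : ℝ} {a g : ℝ → ℝ → ℝ} {θ φ V : ℝ → ℝ} {w v wt wx vt vx : ℝ → ℝ → ℝ}

theorem outlet_pos (hD : IsData c μ Vb a g θ φ) (h : IsSol2 c μ a g w v wt wx vt vx)
    (hφ : v 0 1 = φ 1) (ht : 0 ≤ t) : 0 < v t 1 := by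
  obtain ⟨hw, -, -, -, -, -, hd, -, hb⟩ := h
  have h1 : (1:ℝ) ∈ Icc (0:ℝ) 1 := right_mem_Icc.2 zero_le_one
  have hcont : ContinuousOn (fun σ => g 0 (w σ 1)) (Icc 0 t) :=
    hD.lip_g.continuousOn.comp (f := fun σ => ((0:ℝ), w σ 1))
      (continuousOn_const.prodMk (hw.comp (f := fun σ => (σ, (1:ℝ))) (by fun_prop)
        fun σ hσ => ⟨hσ.1, h1⟩)) fun σ _ => ⟨mem_Ici.2 le_rfl, mem_univ _⟩
  obtain ⟨σ₀, -, hσ₀⟩ := isCompact_Icc.exists_isMinOn ⟨0, left_mem_Icc.2 ht⟩ hcont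
  have hm : 0 < min (φ 1) (g 0 (w σ₀ 1)) := lt_min (hD.φ_pos 1 h1) (hD.g_pos _)
  refine hm.trans_le (le_of_deriv_nonneg_below (f := fun σ => v σ 1) (f' := fun σ => vt σ 1) hm
    (fun σ hσ => (hd σ hσ.1 1 h1).2.2.1.mono Icc_subset_Ici_self)
    (hφ ▸ min_le_left _ _) (fun σ hσ hpos hlt => ?_) t (right_mem_Icc.2 ht))
  have hle : v σ 1 ≤ g (v σ 1) (w σ 1) := (hlt.le.trans (min_le_right _ _)).trans
    ((hσ₀ hσ).trans (hD.g_ge _ hpos.le _))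
  rw [(hb σ hσ.1).2, neg_mul_comm, neg_sub]
  exact mul_nonneg hD.mu_nonneg (sub_nonneg.2 hle)

theorem outlet_le (hD : IsData c μ Vb a g θ φ) (h : IsSol2 c μ a g w v wt wx vt vx)
    (hφ : v 0 1 = φ 1) (ht : 0 ≤ t) : v t 1 ≤ Vb := by
  have hpos := fun σ (hσ : 0 ≤ σ) => hD.outlet_pos h hφ hσ
  obtain ⟨-, -, -, -, -, -, hd, -, hb⟩ := h
  have h1 : (1:ℝ) ∈ Icc (0:ℝ) 1 := right_mem_Icc.2 zero_le_one
  refine neg_le_neg_iff.1 (le_of_deriv_nonneg_below (f := fun σ => -v σ 1)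
    (f' := fun σ => -vt σ 1) (sub_one_lt _)
    (fun σ hσ => ((hd σ hσ.1 1 h1).2.2.1.mono Icc_subset_Ici_self).neg)
    (neg_le_neg (hφ ▸ hD.φ_le 1 h1)) (fun σ hσ _ hlt => ?_) t (right_mem_Icc.2 ht))
  have hle : g (v σ 1) (w σ 1) ≤ v σ 1 :=
    (hD.g_le _ (hpos σ hσ.1).le _).trans (neg_lt_neg_iff.1 hlt).le
  rw [(hb σ hσ.1).2, ← neg_mul, neg_neg]
  exact mul_nonneg hD.mu_nonneg (sub_nonneg.2 hle)

theorem exists_lipschitzOnWith_outlet (hD : IsData c μ Vb a g θ φ)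
    (h : IsSol2 c μ a g w v wt wx vt vx) (hφ : v 0 1 = φ 1) :
    ∃ K, LipschitzOnWith K (fun σ => v σ 1) (Ici 0) := by
  have hpos := fun σ (hσ : 0 ≤ σ) => hD.outlet_pos h hφ hσ
  have hle := fun σ (hσ : 0 ≤ σ) => hD.outlet_le h hφ hσ
  obtain ⟨-, -, -, -, -, -, hd, -, hb⟩ := h
  refine ⟨(μ * Vb).toNNReal, (convex_Ici (0:ℝ)).lipschitzOnWith_of_nnnorm_hasDerivWithin_le
    (fun σ hσ => (hd σ hσ 1 (right_mem_Icc.2 zero_le_one)).2.2.1) fun σ hσ => ?_⟩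
  rw [← NNReal.coe_le_coe, coe_nnnorm, Real.coe_toNNReal _ (mul_nonneg hD.mu_nonneg hD.Vb_pos.le),
    (hb σ hσ).2, norm_mul, norm_neg, Real.norm_eq_abs, Real.norm_eq_abs,
    abs_of_nonneg hD.mu_nonneg]
  have h0 := hpos σ hσ
  have h1 := hle σ hσ
  have h2 := (hD.g_pos (w σ 1)).trans_le (hD.g_ge _ h0.le _)
  have h3 := hD.g_le _ h0.le (w σ 1)
  exact mul_le_mul_of_nonneg_left (abs_le.2 ⟨by linarith, by linarith⟩) hD.mu_nonneg

theorem isSpeed_speedTrace (hD : IsData c μ Vb a g θ φ) (h : IsSol2 c μ a g w v wt wx vt vx)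
    (hφ : v 0 1 = φ 1) : IsSpeed Vb (speedTrace c φ v) where
  lipAt s := by
    obtain ⟨K, hK⟩ := hD.exists_lipschitzOnWith_outlet h hφ
    refine LipAt.ite_le 1 (fun _ => ?_) (fun _ => ?_) (by simp [hφ])
    · exact LipAt.comp (f := fun s => max s 0) (hD.lip_φ _)
        ((LipAt.of_lipschitzWith LipschitzWith.id s).max_const 0)
    · refine LocallyLipschitzOn.lipAt_comp (g := fun σ => v σ 1) (S := Ici 0)
        (f := fun s => max ((s - 1) / c) 0) (fun x _ => ⟨K, _, self_mem_nhdsWithin, hK⟩)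
        ?_ fun y => mem_Ici.2 (le_max_right _ _)
      exact LipAt.max_const (f := fun s => (s - 1) / c) (LipAt.of_contDiffAt (by fun_prop)) 0
  pos s := by
    rw [speedTrace]
    split_ifs with hs
    · exact hD.φ_pos _ ⟨le_max_right _ _, max_le hs zero_le_one⟩
    · exact hD.outlet_pos h hφ (le_max_right _ _)
  le s := by
    rw [speedTrace]
    split_ifs with hs
    · exact hD.φ_le _ ⟨le_max_right _ _, max_le hs zero_le_one⟩
    · exact hD.outlet_le h hφ (le_max_right _ _)

theorem eq_speedTrace (hc : 0 < c) (h : IsSol2 c μ a g w v wt wx vt vx)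
    (hφ : ∀ x ∈ Icc (0:ℝ) 1, v 0 x = φ x) (ht : 0 ≤ t) (hx : x ∈ Icc (0:ℝ) 1) :
    v t x = speedTrace c φ v (x + c * t) := by
  obtain ⟨-, -, -, -, hvt, -, hd, he, -⟩ := h
  have hct := mul_nonneg hc.le ht
  have key : ∀ t₀, 0 ≤ t₀ → t₀ ≤ t → x + c * t - c * t₀ ≤ 1 →
      v t x = v t₀ (x + c * t - c * t₀) := fun t₀ h0 ht₀ h1 => by
    have := transport_const (f := v) (ft := vt) (fx := vx) (S := Ici 0) (T := Icc 0 1)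
      (ξ := fun σ => x + c * t - c * σ) (ξ' := fun _ => -(c * 1)) (t₀ := t₀) (t₁ := t)
      (convex_Ici 0) hvt (fun t ht x hx => (hd t ht x hx).2.2.1)
      (fun t ht x hx => (hd t ht x hx).2.2.2)
      (fun σ _ => ((hasDerivWithinAt_id σ _).const_mul c).const_sub _)
      (fun σ hσ => h0.trans hσ.1) ?_ ?_ ht₀
    · simpa using this
    · intro σ hσ
      have h2 := mul_le_mul_of_nonneg_left hσ.1 hc.le
      have h3 := mul_le_mul_of_nonneg_left hσ.2 hc.le
      exact ⟨by linarith [hx.1], by linarith⟩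
    · intro σ hσ
      have h2 := mul_le_mul_of_nonneg_left hσ.1 hc.le
      have h3 := mul_le_mul_of_nonneg_left hσ.2 hc.le
      have := (he σ (h0.trans hσ.1) (x + c * t - c * σ) ⟨by linarith [hx.1], by linarith⟩).2
      linarith
  rcases le_or_gt (x + c * t) 1 with h1 | h1
  · rw [speedTrace_of_mem ⟨add_nonneg hx.1 hct, h1⟩, ← hφ _ ⟨add_nonneg hx.1 hct, h1⟩]
    simpa using key 0 le_rfl ht (by simpa using h1)
  · have h0 : 0 ≤ (x + c * t - 1) / c := div_nonneg (by linarith) hc.le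
    have h2 : (x + c * t - 1) / c ≤ t := by
      rw [div_le_iff₀ hc]
      linarith [hx.2]
    have e : x + c * t - c * ((x + c * t - 1) / c) = 1 := by
      rw [mul_div_cancel₀ _ hc.ne', sub_sub_cancel]
    rw [speedTrace, if_neg (not_le.2 h1), max_eq_left h0, key _ h0 h2 e.le, e]

theorem eq_of_charLabel_eq (hc : 0 < c) (h : IsSol2 c μ a g w v wt wx vt vx) (hV : IsSpeed Vb V)
    (hvV : ∀ t ∈ Ici (0:ℝ), ∀ x ∈ Icc (0:ℝ) 1, v t x = V (x + c * t)) (ht₀ : 0 ≤ t₀)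
    (ht : t₀ ≤ t) (hx : x ∈ Icc (0:ℝ) 1) (hx₀ : x₀ ∈ Icc (0:ℝ) 1)
    (hl : charLabel c V t₀ x₀ = charLabel c V t x) : w t x = w t₀ x₀ := by
  obtain ⟨-, -, hwt, -, -, -, hd, he, -⟩ := h
  set p := charLabel c V t x with hp
  set ξ : ℝ → ℝ := fun σ => Function.invFun (travelTime c V) (σ + p) - c * σ with hξ
  have hξd : ∀ σ, HasDerivAt ξ (V (Function.invFun (travelTime c V) (σ + p))) σ :=
    hV.hasDerivAt_characteristic hc p
  have hmono : Monotone ξ := monotone_of_deriv_nonneg (fun σ => (hξd σ).differentiableAt)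
    fun σ => by rw [(hξd σ).deriv]; exact (hV.pos _).le
  have e1 : ξ t = x := by
    rw [hξ, hp]
    simp only [charLabel, add_sub_cancel, hV.invFun_travelTime hc, add_sub_cancel_right]
  have e0 : ξ t₀ = x₀ := by
    rw [hξ, ← hl]
    simp only [charLabel, add_sub_cancel, hV.invFun_travelTime hc, add_sub_cancel_right]
  have hmaps : MapsTo ξ (Icc t₀ t) (Icc 0 1) := fun σ hσ =>
    ⟨hx₀.1.trans (e0 ▸ hmono hσ.1), (hmono hσ.2).trans (e1.le.trans hx.2)⟩
  have := transport_const (f := w) (ft := wt) (fx := wx) (S := Ici 0) (T := Icc 0 1)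
    (convex_Ici 0) hwt (fun t ht x hx => (hd t ht x hx).1)
    (fun t ht x hx => (hd t ht x hx).2.1) (fun σ _ => (hξd σ).hasDerivWithinAt)
    (fun σ hσ => ht₀.trans hσ.1) hmaps (fun σ hσ => ?_) ht
  · rwa [e1, e0] at this
  · have h1 := (he σ (ht₀.trans hσ.1) _ (hmaps hσ)).1
    rw [hvV σ (ht₀.trans hσ.1) _ (hmaps hσ), hξ, sub_add_cancel] at h1
    rw [mul_comm]
    exact h1

theorem carried_of_isSol2 (hc : 0 < c) (h : IsSol2 c μ a g w v wt wx vt vx) (hV : IsSpeed Vb V)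
    (hvV : ∀ t ∈ Ici (0:ℝ), ∀ x ∈ Icc (0:ℝ) 1, v t x = V (x + c * t))
    (hθ : ∀ x ∈ Icc (0:ℝ) 1, w 0 x = θ x) (ht : 0 ≤ t) (hx : x ∈ Icc (0:ℝ) 1) :
    Carried c a θ V (charLabel c V t x) (w t x) := by
  have h0 : (0:ℝ) ∈ Icc (0:ℝ) 1 := left_mem_Icc.2 zero_le_one
  rcases hV.exists_origin hc ht hx with ⟨r, hr, hl⟩ | ⟨r, hr, hl⟩
  · refine .inl ⟨r, hr, hl, ?_⟩
    rw [← hθ r hr]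
    exact eq_of_charLabel_eq hc h hV hvV le_rfl ht hx hr (by rwa [charLabel_zero_left])
  · refine .inr ⟨r, hr.1, hl, ?_⟩
    rw [eq_of_charLabel_eq hc h hV hvV hr.1 hr.2 hx h0 (by rwa [charLabel_zero_right]),
      (h.2.2.2.2.2.2.2.2 r hr.1).1, hvV r hr.1 0 h0, zero_add]

theorem isOutletProfile_speedTrace (hD : IsData c μ Vb a g θ φ)
    (h : IsSol2 c μ a g w v wt wx vt vx) (hθ : ∀ x ∈ Icc (0:ℝ) 1, w 0 x = θ x)
    (hφ : ∀ x ∈ Icc (0:ℝ) 1, v 0 x = φ x) (S : ℝ) :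
    IsOutletProfile c μ Vb a g θ φ S (speedTrace c φ v) := by
  have hc := hD.c_pos
  have h1 : (1:ℝ) ∈ Icc (0:ℝ) 1 := right_mem_Icc.2 zero_le_one
  have hV := hD.isSpeed_speedTrace h (hφ 1 h1)
  refine ⟨hV, fun s hs => speedTrace_of_mem hs, fun s hs => ?_⟩
  have htr : ∀ s ∈ Icc 1 S, 0 ≤ (s - 1) / c := fun s hs =>
    div_nonneg (sub_nonneg.2 hs.1) hc.le
  have harg : ∀ s : ℝ, 1 + c * ((s - 1) / c) = s := fun s => by
    rw [mul_div_cancel₀ _ hc.ne', add_sub_cancel]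
  have hV1 : ∀ s ∈ Icc 1 S, speedTrace c φ v s = v ((s - 1) / c) 1 := fun s hs => by
    rw [eq_speedTrace hc h hφ (htr s hs) h1, harg]
  refine ⟨w ((s - 1) / c) 1, ?_, ?_⟩
  · have := carried_of_isSol2 hc h hV (fun t ht x hx => eq_speedTrace hc h hφ ht hx) hθ
      (htr s hs) h1
    rwa [charLabel, harg] at this
  · obtain ⟨-, -, -, -, -, -, hd, -, hb⟩ := h
    have hlin : HasDerivWithinAt (fun s => (s - 1) / c) (1 / c) (Icc 1 S) s :=
      ((hasDerivWithinAt_id s _).sub_const 1).div_const c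
    refine (((hd _ (htr s hs) 1 h1).2.2.1.comp (h₂ := fun σ => v σ 1) s hlin htr).congr hV1
      (hV1 s hs)).congr_deriv ?_
    rw [(hb _ (htr s hs)).2, ← hV1 s hs]
    ring

/-- Every classical solution is generated by the global outlet profile. -/
theorem eq_of_isSol2 (hD : IsData c μ Vb a g θ φ) (hV : ∀ S, IsOutletProfile c μ Vb a g θ φ S V)
    (h : IsSol2 c μ a g w v wt wx vt vx) (hθ : ∀ x ∈ Icc (0:ℝ) 1, w 0 x = θ x)
    (hφ : ∀ x ∈ Icc (0:ℝ) 1, v 0 x = φ x) (ht : 0 ≤ t) (hx : x ∈ Icc (0:ℝ) 1) :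
    w t x = profile c V (entryData c a V) θ (charLabel c V t x) ∧ v t x = V (x + c * t) := by
  have hc := hD.c_pos
  have hvV : ∀ t ∈ Ici (0:ℝ), ∀ x ∈ Icc (0:ℝ) 1, v t x = V (x + c * t) := fun t ht x hx => by
    rw [eq_speedTrace hc h hφ ht hx]
    exact (hV _).unique hD (hD.isOutletProfile_speedTrace h hθ hφ (x + c * t)) _
      (right_mem_Icc.2 (add_nonneg hx.1 (mul_nonneg hc.le ht)))
  refine ⟨?_, hvV t ht x hx⟩
  rw [hD.profile_eq (hV 0).isSpeed (hV 0).eq_init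
    (carried_of_isSol2 hc h (hV 0).isSpeed hvV hθ ht hx)]

end IsData

theorem exists_lipschitzOnWith_quadruple {f₁ f₂ f₃ f₄ : ℝ × ℝ → ℝ} {S : Set (ℝ × ℝ)}
    (hS : IsCompact S)
    (h : ∀ q ∈ S, LipAt f₁ q ∧ LipAt f₂ q ∧ LipAt f₃ q ∧ LipAt f₄ q) :
    ∃ L : NNReal, LipschitzOnWith L f₁ S ∧ LipschitzOnWith L f₂ S ∧ LipschitzOnWith L f₃ S ∧
      LipschitzOnWith L f₄ S := by
  obtain ⟨K₁, h₁⟩ := LipAt.lipschitzOnWith_of_isCompact hS fun q hq => (h q hq).1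
  obtain ⟨K₂, h₂⟩ := LipAt.lipschitzOnWith_of_isCompact hS fun q hq => (h q hq).2.1
  obtain ⟨K₃, h₃⟩ := LipAt.lipschitzOnWith_of_isCompact hS fun q hq => (h q hq).2.2.1
  obtain ⟨K₄, h₄⟩ := LipAt.lipschitzOnWith_of_isCompact hS fun q hq => (h q hq).2.2.2
  exact ⟨max (max K₁ K₂) (max K₃ K₄), h₁.weaken (by simp), h₂.weaken (by simp),
    h₃.weaken (by simp), h₄.weaken (by simp)⟩

end

/-- Theorem 2.1: global existence, uniqueness and uniform bounds for the non-standard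
hyperbolic system `∂w/∂t + v ∂w/∂x = 0`, `∂v/∂t - c ∂v/∂x = 0` with inlet condition
`w(t,0) = a(t, v(t,0))` and dynamic outlet condition
`∂v/∂t(t,1) = -μ (v(t,1) - g(v(t,1), w(t,1)))`. -/
theorem stmt2 (c μ vmax : ℝ) (hc : 0 < c) (hμ : 0 ≤ μ) (hvmax : 0 < vmax)
    (a : ℝ → ℝ → ℝ)
    (ha : ContDiffOn ℝ 2 (fun q : ℝ × ℝ => a q.1 q.2) (Ici 0 ×ˢ Ici 0))
    (g : ℝ → ℝ → ℝ)
    (hg : ContDiffOn ℝ 1 (fun q : ℝ × ℝ => g q.1 q.2) (Ici 0 ×ˢ univ))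
    (hgb : ∀ u ∈ Ici (0:ℝ), ∀ z : ℝ, 0 < g 0 z ∧ g 0 z ≤ g u z ∧ g u z ≤ vmax)
    (θ θ' φ φ' : ℝ → ℝ)
    (hθ : ∀ x ∈ Icc (0:ℝ) 1, HasDerivWithinAt θ (θ' x) (Icc 0 1) x)
    (hφ : ∀ x ∈ Icc (0:ℝ) 1, HasDerivWithinAt φ (φ' x) (Icc 0 1) x)
    (hθlip : ∃ L : NNReal, LipschitzOnWith L θ' (Icc 0 1))
    (hφlip : ∃ L : NNReal, LipschitzOnWith L φ' (Icc 0 1))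
    (hφpos : ∀ x ∈ Icc (0:ℝ) 1, 0 < φ x)
    (hcomp1 : θ 0 = a 0 (φ 0))
    (hcomp2 : derivWithin (fun s => a s (φ 0)) (Ici 0) 0
        + c * derivWithin (fun u => a 0 u) (Ici 0) (φ 0) * φ' 0 = -(φ 0) * θ' 0)
    (hcomp3 : φ' 1 = -(μ * c⁻¹) * (φ 1 - g (φ 1) (θ 1))) :
    ∃ w v wt wx vt vx : ℝ → ℝ → ℝ,
      IsSol2 c μ a g w v wt wx vt vx ∧
      (∀ x ∈ Icc (0:ℝ) 1, w 0 x = θ x ∧ v 0 x = φ x) ∧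
      (∀ S : Set (ℝ × ℝ), S ⊆ Ici 0 ×ˢ Icc 0 1 → IsCompact S →
        ∃ L : NNReal,
          LipschitzOnWith L (fun q : ℝ × ℝ => wt q.1 q.2) S ∧
          LipschitzOnWith L (fun q : ℝ × ℝ => wx q.1 q.2) S ∧
          LipschitzOnWith L (fun q : ℝ × ℝ => vt q.1 q.2) S ∧
          LipschitzOnWith L (fun q : ℝ × ℝ => vx q.1 q.2) S) ∧
      (∀ t ∈ Ici (0:ℝ), ∀ x ∈ Icc (0:ℝ) 1,
        |w t x| ≤
          max (Bt a (max (sSup (φ '' Icc (0:ℝ) 1)) vmax) t)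
            (sSup ((fun z => |θ z|) '' Icc (0:ℝ) 1)) ∧
        min (sInf (φ '' Icc (0:ℝ) 1))
          (sInf {y : ℝ | ∃ z : ℝ,
            |z| ≤ max (Bt a (max (sSup (φ '' Icc (0:ℝ) 1)) vmax) t)
              (sSup ((fun z => |θ z|) '' Icc (0:ℝ) 1)) ∧ y = g 0 z})
          ≤ v t x ∧
        v t x ≤ max (sSup (φ '' Icc (0:ℝ) 1)) vmax) ∧
      (∀ w₂ v₂ wt₂ wx₂ vt₂ vx₂ : ℝ → ℝ → ℝ,
        IsSol2 c μ a g w₂ v₂ wt₂ wx₂ vt₂ vx₂ →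
        (∀ x ∈ Icc (0:ℝ) 1, w₂ 0 x = θ x ∧ v₂ 0 x = φ x) →
        ∀ t ∈ Ici (0:ℝ), ∀ x ∈ Icc (0:ℝ) 1, w₂ t x = w t x ∧ v₂ t x = v t x) := by
  obtain ⟨Θ, Θ', hΘ, hΘ', eΘ, eΘ'⟩ := exists_extension_of_lipschitz_deriv hθ hθlip
  obtain ⟨Φ, Φ', hΦ, hΦ', eΦ, eΦ'⟩ := exists_extension_of_lipschitz_deriv hφ hφlip
  have h0 : (0:ℝ) ∈ Icc (0:ℝ) 1 := left_mem_Icc.2 zero_le_one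
  have h1 : (1:ℝ) ∈ Icc (0:ℝ) 1 := right_mem_Icc.2 zero_le_one
  have lipAt_of_deriv : ∀ f f' : ℝ → ℝ, (∀ x, HasDerivAt f (f' x) x) → (∀ x, LipAt f' x) →
      ∀ x, LipAt f x := fun f f' hf hf' x =>
    .of_hasStrictDerivAt (hasStrictDerivAt_of_hasDerivAt_of_continuousAt
      (Filter.Eventually.of_forall hf) (hf' x).continuousAt)
  have hφim : φ '' Icc (0:ℝ) 1 = Φ '' Icc (0:ℝ) 1 := image_congr fun x hx => (eΦ x hx).symm
  have hθim : (fun z => |θ z|) '' Icc (0:ℝ) 1 = (fun z => |Θ z|) '' Icc (0:ℝ) 1 :=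
    image_congr fun x hx => by rw [eΘ x hx]
  rw [hφim, hθim]
  have hD : IsData c μ (max (sSup (Φ '' Icc (0:ℝ) 1)) vmax) a g Θ Φ :=
    { c_pos := hc
      mu_nonneg := hμ
      lip_a := (ha.of_le (by norm_num)).locallyLipschitzOn ((convex_Ici 0).prod (convex_Ici 0))
      lip_g := hg.locallyLipschitzOn ((convex_Ici 0).prod convex_univ)
      g_pos := fun z => (hgb 0 (mem_Ici.2 le_rfl) z).1
      g_ge := fun u hu z => (hgb u hu z).2.1
      g_le := fun u hu z => le_max_of_le_right (hgb u hu z).2.2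
      lip_θ := lipAt_of_deriv Θ Θ' hΘ hΘ'
      lip_φ := lipAt_of_deriv Φ Φ' hΦ hΦ'
      φ_pos := fun x hx => by
        rw [eΦ x hx]
        exact hφpos x hx
      φ_le := fun x hx => le_max_of_le_left
        (le_csSup (isCompact_Icc.image_of_continuousOn fun y _ =>
          (hΦ y).continuousAt.continuousWithinAt).bddAbove ⟨x, hx, rfl⟩)
      compat := by rw [eΘ 0 h0, eΦ 0 h0, hcomp1] }
  obtain ⟨V, hV⟩ := hD.exists_outletProfile
  have hS := (hV 0).isSpeed
  obtain ⟨wt, wx, vt, vx, hsol, hlip⟩ := hD.exists_derivatives ha hV hΦ hΘ hΦ' hΘ'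
    (by rw [eΦ 0 h0, eΦ' 0 h0, eΘ' 0 h0, hcomp2])
    (by rw [eΦ 1 h1, eΦ' 1 h1, eΘ 1 h1, hcomp3, div_eq_mul_inv])
  refine ⟨_, _, wt, wx, vt, vx, hsol, fun x hx => ⟨?_, ?_⟩,
    fun S hSsub hScomp => exists_lipschitzOnWith_quadruple hScomp fun q hq => hlip q (hSsub hq),
    fun t ht x hx => ⟨hD.abs_profile_le hS (hV 0).eq_init ht hx,
      IsOutletProfile.min_le hD hV ht hx, hS.le _⟩,
    fun w₂ v₂ wt₂ wx₂ vt₂ vx₂ h₂ hini t ht x hx =>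
      hD.eq_of_isSol2 hV h₂ (fun y hy => (hini y hy).1.trans (eΘ y hy).symm)
        (fun y hy => (hini y hy).2.trans (eΦ y hy).symm) ht hx⟩
  · rw [charLabel_zero_left, hS.profile_travelTime hc (hD.entryData_zero (hV 0).eq_init) hx.1,
      eΘ x hx]
  · simp only [mul_zero, add_zero]
    rw [(hV 0).eq_init x hx, eΦ x hx]
end

section
/- Consider the initial-boundary value problem ∂w/∂t(t,x) + v(t,x)·∂w/∂x(t,x) = 0 for t ≥ 0, x ∈ [0,1], with w(0,x) = φ(x) for x ∈ [0,1] and w(t,0) = a(t) for t ≥ 0, where φ ∈ W^{2,∞}([0,1]), a ∈ W^{2,∞}([0,T]) for every T > 0 with a(0) = φ(0) and ȧ(0) + v(0,0)·φ′(0) = 0, and v ∈ C¹(ℝ₊ × [0,1]) is a non-negative function with Lipschitz derivatives on [0,T] × [0,1] for every T > 0 and with v(t,0) > 0 for all t ≥ 0. Then this initial-boundary value problem has a unique solution w ∈ C¹(ℝ₊ × [0,1]), which has Lipschitz derivatives on [0,T] × [0,1] for every T > 0 and satisfies sup_{0≤x≤1}|w(t,x)| ≤ max(max_{0≤s≤t}|a(s)|,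 ‖φ‖_∞) for all t ≥ 0. -/
open Set

/-- `w` (with continuous partial derivatives `wt`, `wx`) is a classical `C¹` solution of
the initial-boundary value problem `∂w/∂t + v ∂w/∂x = 0` on `ℝ₊ × [0,1]`,
`w(0,·) = φ`, `w(·,0) = a`. -/
def IsSol3 (v : ℝ → ℝ → ℝ) (φ a : ℝ → ℝ) (w wt wx : ℝ → ℝ → ℝ) : Prop :=
  ContinuousOn (fun q : ℝ × ℝ => w q.1 q.2) (Ici 0 ×ˢ Icc 0 1) ∧
  ContinuousOn (fun q : ℝ × ℝ => wt q.1 q.2) (Ici 0 ×ˢ Icc 0 1) ∧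
  ContinuousOn (fun q : ℝ × ℝ => wx q.1 q.2) (Ici 0 ×ˢ Icc 0 1) ∧
  (∀ t ∈ Ici (0:ℝ), ∀ x ∈ Icc (0:ℝ) 1,
    HasDerivWithinAt (fun s => w s x) (wt t x) (Ici 0) t ∧
    HasDerivWithinAt (fun y => w t y) (wx t x) (Icc 0 1) x) ∧
  (∀ t ∈ Ici (0:ℝ), ∀ x ∈ Icc (0:ℝ) 1, wt t x + v t x * wx t x = 0) ∧
  (∀ x ∈ Icc (0:ℝ) 1, w 0 x = φ x) ∧
  (∀ t ∈ Ici (0:ℝ), w t 0 = a t)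

open MeasureTheory Filter Topology NNReal

theorem hasDerivAt_mul_of_eq_zero {f E : ℝ → ℝ} {f' t : ℝ} (hf : HasDerivAt f f' t)
    (h0 : f t = 0) (hE : ContinuousAt E t) : HasDerivAt (fun s => f s * E s) (f' * E t) t := by
  rw [hasDerivAt_iff_tendsto_slope] at hf ⊢
  refine (hf.mul (hE.tendsto.mono_left nhdsWithin_le_nhds)).congr fun s => ?_
  simp only [slope_def_field, h0]
  ring

theorem exists_lipschitzOnWith_of_abs_sub_le {f : ℝ → ℝ → ℝ} {I J : Set ℝ} (C : ℝ)
    (hf : ∀ t ∈ I, ∀ t' ∈ I, ∀ x ∈ J, ∀ x' ∈ J,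
      |f t x - f t' x'| ≤ C * (|t - t'| + |x - x'|)) :
    ∃ L : ℝ≥0, LipschitzOnWith L (fun q : ℝ × ℝ => f q.1 q.2) (I ×ˢ J) := by
  refine ⟨2 * C.toNNReal, LipschitzOnWith.of_dist_le_mul ?_⟩
  rintro ⟨t, x⟩ ⟨ht, hx⟩ ⟨t', x'⟩ ⟨ht', hx'⟩
  have h1 : |t - t'| ≤ dist (t, x) (t', x') := le_max_left (dist t t') (dist x x')
  have h2 : |x - x'| ≤ dist (t, x) (t', x') := le_max_right (dist t t') (dist x x')
  calc |f t x - f t' x'| ≤ C * (|t - t'| + |x - x'|) := hf t ht t' ht' x hx x' hx'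
    _ ≤ C.toNNReal * (2 * dist (t, x) (t', x')) :=
        mul_le_mul (Real.le_coe_toNNReal C) (by linarith) (by positivity) (by positivity)
    _ = _ := by push_cast; ring

theorem abs_exp_sub_exp_le {M a b : ℝ} (ha : a ≤ M) (hb : b ≤ M) :
    |Real.exp a - Real.exp b| ≤ Real.exp M * |a - b| :=
  (convex_Iic M).norm_image_sub_le_of_norm_hasDerivWithin_le (f := Real.exp) (f' := Real.exp)
    (fun x _ => (Real.hasDerivAt_exp x).hasDerivWithinAt)
    (fun x hx => by simpa using hx) hb ha

theorem abs_integral_le_of_abs_le {f : ℝ → ℝ} {a b C : ℝ} (hf : ∀ x ∈ uIoc a b, |f x| ≤ C) :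
    |∫ x in a..b, f x| ≤ C * |b - a| :=
  intervalIntegral.norm_integral_le_of_norm_le_const (f := f) hf

/-- A time-dependent field on the line, with `x`-derivative `Vx`, which is bounded and `C^{1,1}`
in `x`, uniformly for `t` in bounded intervals. -/
structure IsTameField (V Vx : ℝ → ℝ → ℝ) : Prop where
  cont : Continuous (fun q : ℝ × ℝ => V q.1 q.2)
  contx : Continuous (fun q : ℝ × ℝ => Vx q.1 q.2)
  deriv : ∀ t x, HasDerivAt (V t) (Vx t x) x
  bound : ∀ T : ℝ, ∃ K : ℝ≥0, ∀ t ∈ Icc (-T) T,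
    (∀ x, |V t x| ≤ K) ∧ (∀ x, |Vx t x| ≤ K) ∧ LipschitzWith K (Vx t)

namespace IsTameField

variable {V Vx : ℝ → ℝ → ℝ}

theorem lipschitz (h : IsTameField V Vx) (T : ℝ) :
    ∃ K : ℝ≥0, ∀ t ∈ Icc (-T) T, LipschitzWith K (V t) := by
  obtain ⟨K, hK⟩ := h.bound T
  refine ⟨K, fun t ht => ?_⟩
  refine lipschitzWith_of_nnnorm_deriv_le (fun x => (h.deriv t x).differentiableAt) fun x => ?_
  rw [(h.deriv t x).deriv]
  exact (hK t ht).2.1 x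

theorem exists_solution_Icc (h : IsTameField V Vx) {T t₀ : ℝ} (ht₀ : t₀ ∈ Icc (-T) T) (x₀ : ℝ) :
    ∃ γ : ℝ → ℝ, γ t₀ = x₀ ∧
      ∀ t ∈ Icc (-T) T, HasDerivWithinAt γ (V t (γ t)) (Icc (-T) T) t := by
  obtain ⟨K, hK⟩ := h.bound T
  obtain ⟨K', hK'⟩ := h.lipschitz T
  have hT : 0 ≤ T := by linarith [ht₀.1, ht₀.2]
  have hPL : IsPicardLindelof V (⟨t₀, ht₀⟩ : Icc (-T) T) x₀ (K * (2 * ⟨T, hT⟩)) 0 K K' :=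
    { lipschitzOnWith := fun t ht => (hK' t ht).lipschitzOnWith
      continuousOn := fun x _ => (h.cont.comp (by fun_prop : Continuous fun t : ℝ => (t, x))).continuousOn
      norm_le := fun t ht x _ => (hK t ht).1 x
      mul_max_le := by
        push_cast
        rw [sub_zero]
        refine mul_le_mul_of_nonneg_left (max_le ?_ ?_) K.2
        · show T - t₀ ≤ 2 * T
          linarith [ht₀.1]
        · show t₀ - -T ≤ 2 * T
          linarith [ht₀.2] }
  exact hPL.exists_eq_forall_mem_Icc_hasDerivWithinAt₀

theorem exists_solution (h : IsTameField V Vx) (t₀ x₀ : ℝ) :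
    ∃ γ : ℝ → ℝ, γ t₀ = x₀ ∧ ∀ t, HasDerivAt γ (V t (γ t)) t := by
  have key : ∀ T : ℝ, |t₀| < T → ∃ γ : ℝ → ℝ, γ t₀ = x₀ ∧
      ∀ t ∈ Ioo (-T) T, HasDerivAt γ (V t (γ t)) t := fun T hT => by
    obtain ⟨γ, h0, h1⟩ := h.exists_solution_Icc (T := T) (abs_le.1 hT.le) x₀
    exact ⟨γ, h0, fun t ht => (h1 t (Ioo_subset_Icc_self ht)).hasDerivAt (Icc_mem_nhds ht.1 ht.2)⟩
  choose! G hG0 hG1 using key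
  have agree : ∀ S T : ℝ, |t₀| < S → S ≤ T → ∀ t ∈ Ioo (-S) S, G S t = G T t := by
    intro S T hS hST t ht
    obtain ⟨K, hK⟩ := h.lipschitz S
    refine ODE_solution_unique_of_mem_Ioo (v := V) (s := fun _ => univ) (K := K) (t₀ := t₀)
      (fun t ht => (hK t (Ioo_subset_Icc_self ht)).lipschitzOnWith) (abs_lt.1 hS)
      (fun t ht => ⟨hG1 S hS t ht, trivial⟩)
      (fun t ht => ⟨hG1 T (hS.trans_le hST) t ⟨by linarith [ht.1], by linarith [ht.2]⟩, trivial⟩)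
      ((hG0 S hS).trans (hG0 T (hS.trans_le hST)).symm) ht
  refine ⟨fun t => G (|t| + |t₀| + 1) t, hG0 _ (by linarith [abs_nonneg t₀]), fun t => ?_⟩
  have e : ∀ s : ℝ, |s| < |t| + 1 → G (|s| + |t₀| + 1) s = G (|t| + |t₀| + 2) s := fun s hs =>
    agree _ _ (by linarith [abs_nonneg s]) (by linarith) s
      (abs_lt.1 (by linarith [abs_nonneg t₀]))
  have hd := hG1 (|t| + |t₀| + 2) (by linarith [abs_nonneg t]) t
    (abs_lt.1 (by linarith [abs_nonneg t₀]))
  rw [← e t (by linarith)] at hd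
  refine hd.congr_of_eventuallyEq ?_
  filter_upwards [(isOpen_lt continuous_abs continuous_const).mem_nhds
    (show |t| < |t| + 1 by linarith)] with s hs using e s hs

/-- The mean of `Vx r` over the segment from `x` to `y`. -/
noncomputable def meanSlope (Vx : ℝ → ℝ → ℝ) (r x y : ℝ) : ℝ :=
  ∫ θ in (0:ℝ)..1, Vx r (x + θ * (y - x))

theorem continuous_meanSlope (h : IsTameField V Vx) :
    Continuous fun p : ℝ × ℝ × ℝ => meanSlope Vx p.1 p.2.1 p.2.2 := by
  unfold meanSlope
  refine intervalIntegral.continuous_parametric_intervalIntegral_of_continuous' ?_ 0 1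
  exact h.contx.comp (by fun_prop :
    Continuous fun z : (ℝ × ℝ × ℝ) × ℝ => (z.1.1, z.1.2.1 + z.2 * (z.1.2.2 - z.1.2.1)))

theorem meanSlope_self (r x : ℝ) : meanSlope Vx r x x = Vx r x := by
  simp [meanSlope]

theorem abs_meanSlope_le {K : ℝ≥0} {r : ℝ} (hK : ∀ x, |Vx r x| ≤ K) (x y : ℝ) :
    |meanSlope Vx r x y| ≤ K := by
  have := intervalIntegral.norm_integral_le_of_norm_le_const (a := 0) (b := 1) (C := K)
    (f := fun θ => Vx r (x + θ * (y - x))) fun θ _ => hK _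
  simpa [meanSlope] using this

theorem sub_eq_meanSlope_mul (h : IsTameField V Vx) (r x y : ℝ) :
    V r y - V r x = meanSlope Vx r x y * (y - x) := by
  have hd : ∀ θ : ℝ, HasDerivAt (fun θ => V r (x + θ * (y - x)))
      (Vx r (x + θ * (y - x)) * (y - x)) θ := fun θ => by
    have h1 : HasDerivAt (fun θ : ℝ => x + θ * (y - x)) (y - x) θ := by
      simpa using ((hasDerivAt_id θ).mul_const (y - x)).const_add x
    exact (h.deriv r _).comp θ h1
  have := intervalIntegral.integral_eq_sub_of_hasDerivAt (a := 0) (b := 1) (fun θ _ => hd θ)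
    ((Continuous.mul (h.contx.comp (by fun_prop :
      Continuous fun θ : ℝ => (r, x + θ * (y - x)))) continuous_const).intervalIntegrable _ _)
  rw [intervalIntegral.integral_mul_const] at this
  rw [meanSlope, this]
  simp

/-- The exact formula for the difference of two solutions of a scalar ODE. -/
theorem solution_sub (h : IsTameField V Vx) {γ δ : ℝ → ℝ}
    (hγ : ∀ t, HasDerivAt γ (V t (γ t)) t) (hδ : ∀ t, HasDerivAt δ (V t (δ t)) t) (t s : ℝ) :
    δ s - γ s = (δ t - γ t) * Real.exp (∫ r in t..s, meanSlope Vx r (γ r) (δ r)) := by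
  have cγ : Continuous γ := continuous_iff_continuousAt.2 fun t => (hγ t).continuousAt
  have cδ : Continuous δ := continuous_iff_continuousAt.2 fun t => (hδ t).continuousAt
  have cq : Continuous fun r => meanSlope Vx r (γ r) (δ r) :=
    h.continuous_meanSlope.comp (by fun_prop : Continuous fun r => (r, γ r, δ r))
  have hd : ∀ s, HasDerivAt (fun s => (δ s - γ s) *
      Real.exp (-∫ r in t..s, meanSlope Vx r (γ r) (δ r))) 0 s := fun s => by
    have h1 := (cq.integral_hasStrictDerivAt t s).hasDerivAt
    refine HasDerivAt.congr_deriv (((hδ s).sub (hγ s)).mul h1.neg.exp) ?_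
    rw [h.sub_eq_meanSlope_mul, Pi.sub_apply, Pi.neg_apply]
    ring
  have := is_const_of_deriv_eq_zero (fun s => (hd s).differentiableAt) (fun s => (hd s).deriv) s t
  simp only [intervalIntegral.integral_same, neg_zero, Real.exp_zero, mul_one] at this
  rw [← this, mul_assoc, ← Real.exp_add]
  simp

section Flow

variable {X : ℝ → ℝ → ℝ → ℝ}

theorem flow_abs_sub_le (h : IsTameField V Vx) (hX0 : ∀ t x, X t x t = x)
    (hX : ∀ t x s, HasDerivAt (X t x) (V s (X t x s)) s) (T : ℝ) :
    ∃ L : ℝ, 0 ≤ L ∧ ∀ t ∈ Icc (-T) T, ∀ t' ∈ Icc (-T) T, ∀ s ∈ Icc (-T) T, ∀ s' ∈ Icc (-T) T,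
      ∀ x x', |X t x s - X t' x' s'| ≤ L * (|t - t'| + |x - x'| + |s - s'|) := by
  obtain ⟨K, hK⟩ := h.bound T
  have time : ∀ t x, ∀ s ∈ Icc (-T) T, ∀ s' ∈ Icc (-T) T, |X t x s - X t x s'| ≤ K * |s - s'| :=
    fun t x s hs s' hs' => (convex_Icc (-T) T).norm_image_sub_le_of_norm_hasDerivWithin_le
      (fun r _ => (hX t x r).hasDerivWithinAt) (fun r hr => (hK r hr).1 _) hs' hs
  refine ⟨Real.exp (K * (2 * T)) * (1 + K) + K, by positivity,
    fun t ht t' ht' s hs s' hs' x x' => ?_⟩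
  have e := h.solution_sub (hX t' x') (hX t x) t s
  rw [hX0] at e
  have hE : Real.exp (∫ r in t..s, meanSlope Vx r (X t' x' r) (X t x r)) ≤
      Real.exp (K * (2 * T)) := by
    refine Real.exp_le_exp.2 ((le_abs_self _).trans ?_)
    refine (abs_integral_le_of_abs_le (C := K) fun r hr => ?_).trans ?_
    · exact abs_meanSlope_le (hK r (uIcc_subset_Icc ht hs (uIoc_subset_uIcc hr))).2.1 _ _
    · refine mul_le_mul_of_nonneg_left ?_ K.2
      exact abs_le.2 ⟨by linarith [hs.1, ht.2], by linarith [hs.2, ht.1]⟩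
  have h1 : |x - X t' x' t| ≤ |x - x'| + K * |t - t'| := by
    have := time t' x' t' ht' t ht
    rw [hX0, abs_sub_comm t'] at this
    calc |x - X t' x' t| = |(x - x') + (x' - X t' x' t)| := by ring_nf
      _ ≤ _ := (abs_add_le _ _).trans (by linarith)
  have h2 : |X t x s - X t' x' s| ≤ (|x - x'| + K * |t - t'|) * Real.exp (K * (2 * T)) := by
    rw [e, abs_mul, abs_of_pos (Real.exp_pos _)]
    exact mul_le_mul h1 hE (Real.exp_pos _).le (by positivity)
  have h3 := time t' x' s hs s' hs'
  have h4 : |X t x s - X t' x' s'| ≤ |X t x s - X t' x' s| + |X t' x' s - X t' x' s'| :=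
    abs_sub_le _ _ _
  have p0 := Real.exp_pos (K * (2 * T))
  have q1 : 0 ≤ Real.exp (K * (2 * T)) * |t - t'| := by positivity
  have q2 : 0 ≤ Real.exp (K * (2 * T)) * (K * |x - x'|) := by positivity
  have q3 : 0 ≤ Real.exp (K * (2 * T)) * (1 + K) * |s - s'| := by positivity
  have q4 : 0 ≤ K * |t - t'| := by positivity
  have q5 : 0 ≤ K * |x - x'| := by positivity
  nlinarith

theorem flow_continuous (h : IsTameField V Vx) (hX0 : ∀ t x, X t x t = x)
    (hX : ∀ t x s, HasDerivAt (X t x) (V s (X t x s)) s) :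
    Continuous fun p : ℝ × ℝ × ℝ => X p.1 p.2.1 p.2.2 := by
  refine continuous_iff_continuousAt.2 ?_
  rintro ⟨t, x, s⟩
  set T := max |t| |s| + 1 with hT
  have ht : |t| < T := by linarith [le_max_left |t| |s|]
  have hs : |s| < T := by linarith [le_max_right |t| |s|]
  obtain ⟨L, -, hL⟩ := h.flow_abs_sub_le hX0 hX T
  refine tendsto_iff_dist_tendsto_zero.2 ?_
  refine squeeze_zero' (g := fun p : ℝ × ℝ × ℝ =>
    L * (|p.1 - t| + |p.2.1 - x| + |p.2.2 - s|)) (Eventually.of_forall fun _ => dist_nonneg) ?_ ?_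
  · filter_upwards [(isOpen_lt (continuous_abs.comp continuous_fst) continuous_const).mem_nhds
        (show |((t, x, s) : ℝ × ℝ × ℝ).1| < T from ht),
      (isOpen_lt (continuous_abs.comp (continuous_snd.comp continuous_snd))
        continuous_const).mem_nhds (show |((t, x, s) : ℝ × ℝ × ℝ).2.2| < T from hs)] with p hp1 hp2
    exact hL _ (abs_le.1 hp1.le) _ (abs_le.1 ht.le) _ (abs_le.1 hp2.le) _ (abs_le.1 hs.le) _ _
  · have : Continuous fun p : ℝ × ℝ × ℝ => L * (|p.1 - t| + |p.2.1 - x| + |p.2.2 - s|) := by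
      fun_prop
    simpa using this.tendsto (t, x, s)

theorem flow_exp_lipschitz (h : IsTameField V Vx) (hX0 : ∀ t x, X t x t = x)
    (hX : ∀ t x s, HasDerivAt (X t x) (V s (X t x s)) s) (T : ℝ) :
    ∃ L : ℝ≥0, LipschitzOnWith L
      (fun q : ℝ × ℝ => Real.exp (∫ r in q.1..0, Vx r (X q.1 q.2 r))) (Icc (-T) T ×ˢ univ) := by
  obtain ⟨K, hK⟩ := h.bound T
  obtain ⟨L, hL0, hL⟩ := h.flow_abs_sub_le hX0 hX T
  have hc : ∀ t x, Continuous fun r => Vx r (X t x r) := fun t x =>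
    h.contx.comp (continuous_id.prodMk
      (continuous_iff_continuousAt.2 fun s => (hX t x s).continuousAt))
  refine exists_lipschitzOnWith_of_abs_sub_le (f := fun t x =>
    Real.exp (∫ r in t..0, Vx r (X t x r))) (Real.exp (K * T) * (K + K * L * T))
    fun t ht t' ht' x _ x' _ => ?_
  have hT : 0 ≤ T := by linarith [ht.1, ht.2]
  have h0 : (0 : ℝ) ∈ Icc (-T) T := ⟨by linarith, hT⟩
  have hle : ∀ t ∈ Icc (-T) T, ∀ x, ∫ r in t..0, Vx r (X t x r) ≤ K * T := fun t ht x => by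
    refine (le_abs_self _).trans
      ((abs_integral_le_of_abs_le (C := K) fun r hr => ?_).trans ?_)
    · exact (hK r (uIcc_subset_Icc ht h0 (uIoc_subset_uIcc hr))).2.1 _
    · rw [zero_sub, abs_neg]
      exact mul_le_mul_of_nonneg_left (abs_le.2 ht) K.2
  refine (abs_exp_sub_exp_le (hle t ht x) (hle t' ht' x')).trans ?_
  rw [mul_assoc]
  refine mul_le_mul_of_nonneg_left ?_ (Real.exp_pos _).le
  have e : (∫ r in t..0, Vx r (X t x r)) - ∫ r in t'..0, Vx r (X t' x' r) =
      (∫ r in t..t', Vx r (X t x r)) + ∫ r in t'..0, (Vx r (X t x r) - Vx r (X t' x' r)) := by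
    rw [intervalIntegral.integral_sub ((hc t x).intervalIntegrable _ _)
      ((hc t' x').intervalIntegrable _ _), ← intervalIntegral.integral_add_adjacent_intervals
      ((hc t x).intervalIntegrable t t') ((hc t x).intervalIntegrable t' 0)]
    ring
  have b1 : |∫ r in t..t', Vx r (X t x r)| ≤ K * |t - t'| := by
    rw [abs_sub_comm]
    exact abs_integral_le_of_abs_le fun r hr =>
      (hK r (uIcc_subset_Icc ht ht' (uIoc_subset_uIcc hr))).2.1 _
  have b2 : |∫ r in t'..0, (Vx r (X t x r) - Vx r (X t' x' r))| ≤
      K * (L * (|t - t'| + |x - x'|)) * T := by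
    refine (abs_integral_le_of_abs_le
      (C := K * (L * (|t - t'| + |x - x'|))) fun r hr => ?_).trans ?_
    · have hr' := uIcc_subset_Icc ht' h0 (uIoc_subset_uIcc hr)
      refine ((hK r hr').2.2.dist_le_mul _ _).trans (mul_le_mul_of_nonneg_left ?_ K.2)
      simpa [Real.dist_eq] using hL t ht t' ht' r hr' r hr' x x'
    · rw [zero_sub, abs_neg]
      exact mul_le_mul_of_nonneg_left (abs_le.2 ht') (by positivity)
  rw [e]
  refine (abs_add_le _ _).trans ((add_le_add b1 b2).trans ?_)
  have : 0 ≤ K * |x - x'| := by positivity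
  nlinarith

end Flow

/-- The foot map `Y t x` of the characteristics: the position at time `0` of the solution through
`(t, x)`. It solves the transport equation with initial datum the identity. -/
theorem exists_foot (h : IsTameField V Vx) : ∃ Y Yx : ℝ → ℝ → ℝ,
    (∀ x, Y 0 x = x) ∧ (∀ t x, 0 < Yx t x) ∧
    (∀ t x, HasDerivAt (fun y => Y t y) (Yx t x) x) ∧
    (∀ t x, HasDerivAt (fun s => Y s x) (-V t x * Yx t x) t) ∧
    (∀ T, ∃ L : ℝ≥0, LipschitzOnWith L (fun q : ℝ × ℝ => Y q.1 q.2) (Icc (-T) T ×ˢ univ)) ∧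
    (∀ T, ∃ L : ℝ≥0, LipschitzOnWith L (fun q : ℝ × ℝ => Yx q.1 q.2) (Icc (-T) T ×ˢ univ)) := by
  choose X hX0 hX using h.exists_solution
  have cX := h.flow_continuous hX0 hX
  have cE : Continuous fun p : (ℝ × ℝ) × (ℝ × ℝ) => Real.exp (∫ r in p.2.1..0,
      meanSlope Vx r (X p.1.1 p.1.2 r) (X p.2.1 p.2.2 r)) := by
    refine Real.continuous_exp.comp ?_
    simp only [intervalIntegral.integral_symm 0]
    refine (intervalIntegral.continuous_parametric_intervalIntegral_of_continuous ?_
      (by fun_prop)).neg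
    refine h.continuous_meanSlope.comp (continuous_snd.prodMk (Continuous.prodMk ?_ ?_))
    · exact cX.comp (by fun_prop :
        Continuous fun z : ((ℝ × ℝ) × (ℝ × ℝ)) × ℝ => (z.1.1.1, z.1.1.2, z.2))
    · exact cX.comp (by fun_prop :
        Continuous fun z : ((ℝ × ℝ) × (ℝ × ℝ)) × ℝ => (z.1.2.1, z.1.2.2, z.2))
  refine ⟨fun t x => X t x 0, fun t x => Real.exp (∫ r in t..0, Vx r (X t x r)), fun x => hX0 0 x,
    fun t x => Real.exp_pos _, fun t x => ?_, fun t x => ?_, fun T => ?_,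
    h.flow_exp_lipschitz hX0 hX⟩
  · have hE := (cE.comp (by fun_prop : Continuous fun y : ℝ => ((t, x), (t, y)))).continuousAt
      (x := x)
    have := (hasDerivAt_mul_of_eq_zero ((hasDerivAt_id x).sub_const x) (by simp) hE).const_add
      (X t x 0)
    simp only [Function.comp_def, meanSlope_self, one_mul, id_eq] at this
    refine this.congr_of_eventuallyEq (Eventually.of_forall fun y => ?_)
    show X t y 0 = X t x 0 + _
    have e := h.solution_sub (hX t x) (hX t y) t 0
    rw [hX0, hX0] at e
    linarith
  · have hE := (cE.comp (by fun_prop : Continuous fun s : ℝ => ((t, x), (s, x)))).continuousAt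
      (x := t)
    have := (hasDerivAt_mul_of_eq_zero ((hX t x t).const_sub x) (by simp [hX0]) hE).const_add
      (X t x 0)
    simp only [Function.comp_def, meanSlope_self, hX0] at this
    refine this.congr_of_eventuallyEq (Eventually.of_forall fun s => ?_)
    show X s x 0 = X t x 0 + _
    have e := h.solution_sub (hX t x) (hX s x) s 0
    rw [hX0] at e
    linarith
  · obtain ⟨L, -, hL⟩ := h.flow_abs_sub_le hX0 hX T
    refine exists_lipschitzOnWith_of_abs_sub_le (f := fun t x => X t x 0) L
      fun t ht t' ht' x _ x' _ => ?_
    have h0 : (0 : ℝ) ∈ Icc (-T) T := ⟨by linarith [ht.1, ht.2], by linarith [ht.1, ht.2]⟩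
    simpa using hL t ht t' ht' 0 h0 0 h0 x x'

end IsTameField

section Extension

/-- The projection of the line onto `[0,1]`. -/
noncomputable def clampUnit (x : ℝ) : ℝ := max 0 (min 1 x)

theorem clampUnit_mem (x : ℝ) : clampUnit x ∈ Icc (0 : ℝ) 1 :=
  ⟨le_max_left _ _, max_le zero_le_one (min_le_left _ _)⟩

theorem clampUnit_of_mem {x : ℝ} (hx : x ∈ Icc (0 : ℝ) 1) : clampUnit x = x := by
  rw [clampUnit, min_eq_right hx.2, max_eq_right hx.1]

theorem lipschitzWith_clampUnit : LipschitzWith 1 clampUnit :=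
  (LipschitzWith.id.const_min 1).const_max 0

theorem continuous_clampUnit : Continuous clampUnit := lipschitzWith_clampUnit.continuous

/-- A cutoff equal to `1` on `[0,1]` and supported in `[-1,2]`. -/
noncomputable def cutoffUnit (x : ℝ) : ℝ := max 0 (1 - |x - clampUnit x|)

theorem cutoffUnit_of_mem {x : ℝ} (hx : x ∈ Icc (0 : ℝ) 1) : cutoffUnit x = 1 := by
  simp [cutoffUnit, clampUnit_of_mem hx]

theorem cutoffUnit_nonneg (x : ℝ) : 0 ≤ cutoffUnit x := le_max_left _ _

theorem cutoffUnit_le_one (x : ℝ) : cutoffUnit x ≤ 1 :=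
  max_le zero_le_one (by linarith [abs_nonneg (x - clampUnit x)])

theorem abs_cutoffUnit_sub_le (x y : ℝ) : |cutoffUnit x - cutoffUnit y| ≤ 2 * |x - y| := by
  have h1 : |clampUnit x - clampUnit y| ≤ |x - y| := by
    simpa [Real.dist_eq] using lipschitzWith_clampUnit.dist_le_mul x y
  have h2 : |cutoffUnit x - cutoffUnit y| ≤
      |(1 - |x - clampUnit x|) - (1 - |y - clampUnit y|)| := by
    have := abs_max_sub_max_le_max 0 (1 - |x - clampUnit x|) 0 (1 - |y - clampUnit y|)
    simpa [cutoffUnit] using this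
  have h3 : |(1 - |x - clampUnit x|) - (1 - |y - clampUnit y|)| ≤
      |(y - clampUnit y) - (x - clampUnit x)| := by
    refine le_trans (le_of_eq ?_) (abs_abs_sub_abs_le _ _)
    ring_nf
  have h4 : |(y - clampUnit y) - (x - clampUnit x)| ≤
      |clampUnit x - clampUnit y| + |x - y| := by
    refine le_trans (le_of_eq ?_) (abs_sub (clampUnit x - clampUnit y) (x - y))
    ring_nf
  linarith

theorem continuous_cutoffUnit : Continuous cutoffUnit :=
  continuous_const.max (continuous_const.sub (continuous_id.sub continuous_clampUnit).abs)

theorem integrable_cutoffUnit : Integrable cutoffUnit := by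
  refine continuous_cutoffUnit.integrable_of_hasCompactSupport
    (HasCompactSupport.intro (isCompact_Icc (a := -1) (b := 2)) fun x hx => ?_)
  rw [cutoffUnit, max_eq_left]
  have h := clampUnit_mem x
  by_cases h1 : -1 ≤ x
  · have h2 : 2 < x := not_le.1 fun h2 => hx ⟨h1, h2⟩
    linarith [le_abs_self (x - clampUnit x), h.2]
  · linarith [neg_le_abs (x - clampUnit x), h.1]

theorem add_integral_eq_of_hasDerivWithinAt {f f' G : ℝ → ℝ} {s : Set ℝ} {x : ℝ} (hx : 0 ≤ x)
    (hs : Icc 0 x ⊆ s) (hf : ∀ y ∈ s, HasDerivWithinAt f (f' y) s y) (hG : Continuous G)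
    (hGf : ∀ y ∈ s, G y = f' y) : f 0 + ∫ y in (0 : ℝ)..x, G y = f x := by
  rw [intervalIntegral.integral_eq_sub_of_hasDerivAt_of_le hx
    (fun y hy => ((hf y (hs hy)).continuousWithinAt).mono hs) (fun y hy => ?_)
    (hG.intervalIntegrable _ _)]
  · ring
  · have hy' := hs (Ioo_subset_Icc_self hy)
    rw [hGf y hy']
    exact (hf y hy').hasDerivAt (mem_of_superset (Icc_mem_nhds hy.1 hy.2) hs)

theorem hasDerivAt_const_add_integral {G : ℝ → ℝ} (hG : Continuous G) (c x : ℝ) :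
    HasDerivAt (fun x => c + ∫ y in (0 : ℝ)..x, G y) (G x) x :=
  (hG.integral_hasStrictDerivAt 0 x).hasDerivAt.const_add c

theorem exists_tame_extension {v vx : ℝ → ℝ → ℝ}
    (hvcont : ContinuousOn (fun q : ℝ × ℝ => v q.1 q.2) (Ici 0 ×ˢ Icc 0 1))
    (hvxcont : ContinuousOn (fun q : ℝ × ℝ => vx q.1 q.2) (Ici 0 ×ˢ Icc 0 1))
    (hvd : ∀ t ∈ Ici (0 : ℝ), ∀ x ∈ Icc (0 : ℝ) 1,
      HasDerivWithinAt (fun y => v t y) (vx t x) (Icc 0 1) x)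
    (hvlip : ∀ T > (0 : ℝ), ∃ L : ℝ≥0,
      LipschitzOnWith L (fun q : ℝ × ℝ => vx q.1 q.2) (Icc 0 T ×ˢ Icc 0 1)) :
    ∃ V Vx, IsTameField V Vx ∧ (∀ t ∈ Ici (0 : ℝ), ∀ x ∈ Icc (0 : ℝ) 1, V t x = v t x) ∧
      ∀ t, V t 0 = v (max t 0) 0 := by
  set G : ℝ → ℝ → ℝ := fun t y => vx (max t 0) (clampUnit y) * cutoffUnit y with hG
  have cG : Continuous fun q : ℝ × ℝ => G q.1 q.2 :=
    (hvxcont.comp_continuous ((continuous_fst.max continuous_const).prodMk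
      (continuous_clampUnit.comp continuous_snd))
      fun q => ⟨le_max_right q.1 0, clampUnit_mem q.2⟩).mul
      (continuous_cutoffUnit.comp continuous_snd)
  have cGt : ∀ t, Continuous (G t) := fun t => cG.comp (by fun_prop : Continuous fun y => (t, y))
  have cv0 : Continuous fun t => v (max t 0) 0 :=
    hvcont.comp_continuous ((continuous_id.max continuous_const).prodMk continuous_const)
      fun t => ⟨le_max_right t 0, by simp⟩
  refine ⟨fun t x => v (max t 0) 0 + ∫ y in (0 : ℝ)..x, G t y, G, ⟨?_, cG, ?_, ?_⟩, ?_, ?_⟩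
  · refine (cv0.comp continuous_fst).add
      (intervalIntegral.continuous_parametric_intervalIntegral_of_continuous ?_ continuous_snd)
    exact cG.comp (by fun_prop : Continuous fun z : (ℝ × ℝ) × ℝ => (z.1.1, z.2))
  · exact fun t x => hasDerivAt_const_add_integral (cGt t) _ x
  · intro T
    obtain ⟨L, hL⟩ := hvlip (|T| + 1) (by positivity)
    have hsub : Icc 0 (|T| + 1) ×ˢ Icc (0 : ℝ) 1 ⊆ Ici (0 : ℝ) ×ˢ Icc (0 : ℝ) 1 :=
      prod_mono_left Icc_subset_Ici_self
    obtain ⟨M, hM⟩ := (isCompact_Icc.prod isCompact_Icc).exists_bound_of_continuousOn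
      (hvxcont.mono hsub)
    obtain ⟨N, hN⟩ := (isCompact_Icc.prod isCompact_Icc).exists_bound_of_continuousOn
      (hvcont.mono hsub)
    have hm : ∀ t ∈ Icc (-T) T, max t 0 ∈ Icc 0 (|T| + 1) := fun t ht =>
      ⟨le_max_right _ _, max_le (by linarith [ht.2, le_abs_self T]) (by positivity)⟩
    have hM0 : 0 ≤ M := (norm_nonneg _).trans
      (hM (0, 0) ⟨⟨le_rfl, by positivity⟩, ⟨le_rfl, zero_le_one⟩⟩)
    have hN0 : 0 ≤ N := (norm_nonneg _).trans
      (hN (0, 0) ⟨⟨le_rfl, by positivity⟩, ⟨le_rfl, zero_le_one⟩⟩)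
    have hI0 : 0 ≤ ∫ y, cutoffUnit y := integral_nonneg cutoffUnit_nonneg
    have hvx : ∀ t ∈ Icc (-T) T, ∀ x, |vx (max t 0) (clampUnit x)| ≤ M := fun t ht x =>
      hM (max t 0, clampUnit x) ⟨hm t ht, clampUnit_mem x⟩
    have hGM : ∀ t ∈ Icc (-T) T, ∀ x, |G t x| ≤ M * cutoffUnit x := fun t ht x => by
      rw [hG, abs_mul, abs_of_nonneg (cutoffUnit_nonneg x)]
      exact mul_le_mul_of_nonneg_right (hvx t ht x) (cutoffUnit_nonneg x)
    have hP : 0 ≤ M * ∫ y, cutoffUnit y := mul_nonneg hM0 hI0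
    refine ⟨⟨N + M * (∫ y, cutoffUnit y) + M + (L + 2 * M), by positivity⟩,
      fun t ht => ⟨fun x => ?_, fun x => ?_, LipschitzWith.of_dist_le_mul fun x y => ?_⟩⟩
    · have h1 : |v (max t 0) 0| ≤ N := hN (max t 0, 0) ⟨hm t ht, by simp⟩
      have h2 : |∫ y in (0 : ℝ)..x, G t y| ≤ M * ∫ y, cutoffUnit y := by
        calc |∫ y in (0 : ℝ)..x, G t y| ≤ ∫ y in uIoc 0 x, |G t y| :=
              intervalIntegral.norm_integral_le_integral_norm_uIoc (f := G t)
          _ ≤ ∫ y in uIoc 0 x, M * cutoffUnit y :=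
              integral_mono ((cGt t).abs.integrableOn_uIoc)
                (integrable_cutoffUnit.const_mul M).integrableOn (hGM t ht)
          _ ≤ ∫ y, M * cutoffUnit y :=
              setIntegral_le_integral (integrable_cutoffUnit.const_mul M)
                (Eventually.of_forall fun y => mul_nonneg hM0 (cutoffUnit_nonneg y))
          _ = _ := integral_const_mul _ _
      refine (abs_add_le _ _).trans ?_
      show _ ≤ N + M * (∫ y, cutoffUnit y) + M + (L + 2 * M)
      linarith [L.2]
    · refine (hGM t ht x).trans ?_
      show _ ≤ N + M * (∫ y, cutoffUnit y) + M + (L + 2 * M)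
      nlinarith [L.2, cutoffUnit_le_one x]
    · show |G t x - G t y| ≤ (N + M * (∫ y, cutoffUnit y) + M + (L + 2 * M)) * |x - y|
      have h1 : |vx (max t 0) (clampUnit x) - vx (max t 0) (clampUnit y)| ≤ L * |x - y| := by
        refine (hL.dist_le_mul (max t 0, clampUnit x) ⟨hm t ht, clampUnit_mem x⟩
          (max t 0, clampUnit y) ⟨hm t ht, clampUnit_mem y⟩).trans
          (mul_le_mul_of_nonneg_left ?_ L.2)
        simpa [Prod.dist_eq, Real.dist_eq] using lipschitzWith_clampUnit.dist_le_mul x y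
      have h2 : |G t x - G t y| ≤ L * |x - y| * 1 + M * (2 * |x - y|) := by
        calc |G t x - G t y| = |(vx (max t 0) (clampUnit x) - vx (max t 0) (clampUnit y)) *
              cutoffUnit x + vx (max t 0) (clampUnit y) * (cutoffUnit x - cutoffUnit y)| := by
                rw [hG]; ring_nf
          _ ≤ _ := by
            refine (abs_add_le _ _).trans (add_le_add ?_ ?_)
            · rw [abs_mul, abs_of_nonneg (cutoffUnit_nonneg x)]
              exact mul_le_mul h1 (cutoffUnit_le_one x) (cutoffUnit_nonneg x) (by positivity)
            · rw [abs_mul]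
              exact mul_le_mul (hvx t ht y) (abs_cutoffUnit_sub_le x y) (abs_nonneg _) hM0
      have h3 : 0 ≤ (N + M * (∫ y, cutoffUnit y) + M) * |x - y| := by positivity
      linarith
  · intro t ht x hx
    have ht' : max t 0 = t := max_eq_left ht
    simp only [ht']
    refine add_integral_eq_of_hasDerivWithinAt hx.1 (Icc_subset_Icc_right hx.2)
      (hvd t ht) (cGt t) fun y hy => ?_
    simp [hG, ht', clampUnit_of_mem hy, cutoffUnit_of_mem hy]
  · intro t
    simp

end Extension

section MaximumPrinciple

theorem nonneg_of_hasDerivWithinAt_of_le {f : ℝ → ℝ} {f' α c : ℝ} {s : Set ℝ}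
    (hf : HasDerivWithinAt f f' s c) (hα : α < c) (hs : Icc α c ⊆ s)
    (hle : ∀ x ∈ Icc α c, f x ≤ f c) : 0 ≤ f' := by
  have h1 : HasDerivWithinAt f f' (Ioo α c) c := hf.mono (Ioo_subset_Icc_self.trans hs)
  rw [hasDerivWithinAt_iff_tendsto_slope' (fun h => lt_irrefl _ h.2)] at h1
  have : (𝓝[Ioo α c] c).NeBot := by
    rw [nhdsWithin_Ioo_eq_nhdsLT hα]
    infer_instance
  refine ge_of_tendsto h1 ?_
  filter_upwards [self_mem_nhdsWithin] with x hx
  rw [slope_def_field]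
  exact div_nonneg_of_nonpos (by linarith [hle x (Ioo_subset_Icc_self hx)]) (by linarith [hx.2])

/-- The maximum principle for the transport equation with nonnegative velocity. -/
theorem transport_le_of_boundary_le {v d dt dx : ℝ → ℝ → ℝ} {T C : ℝ}
    (hv : ∀ t ∈ Ici (0 : ℝ), ∀ x ∈ Icc (0 : ℝ) 1, 0 ≤ v t x)
    (hc : ContinuousOn (fun q : ℝ × ℝ => d q.1 q.2) (Ici 0 ×ˢ Icc 0 1))
    (hd : ∀ t ∈ Ici (0 : ℝ), ∀ x ∈ Icc (0 : ℝ) 1,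
      HasDerivWithinAt (fun s => d s x) (dt t x) (Ici 0) t ∧
      HasDerivWithinAt (fun y => d t y) (dx t x) (Icc 0 1) x)
    (hpde : ∀ t ∈ Ici (0 : ℝ), ∀ x ∈ Icc (0 : ℝ) 1, dt t x + v t x * dx t x = 0)
    (h0 : ∀ x ∈ Icc (0 : ℝ) 1, d 0 x ≤ C) (h1 : ∀ t ∈ Icc 0 T, d t 0 ≤ C) :
    ∀ t ∈ Icc 0 T, ∀ x ∈ Icc (0 : ℝ) 1, d t x ≤ C := by
  intro t ht x hx
  have key : ∀ ε > 0, d t x - ε * t ≤ C := by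
    intro ε hε
    have hcz : ContinuousOn (fun q : ℝ × ℝ => d q.1 q.2 - ε * q.1) (Icc 0 T ×ˢ Icc 0 1) :=
      (hc.mono (prod_mono_left Icc_subset_Ici_self)).sub (by fun_prop)
    obtain ⟨⟨r, y⟩, ⟨hr, hy⟩, hmax⟩ :=
      (isCompact_Icc.prod isCompact_Icc).exists_isMaxOn ⟨(t, x), ht, hx⟩ hcz
    change r ∈ Icc 0 T at hr
    change y ∈ Icc (0 : ℝ) 1 at hy
    have hmax' : ∀ r' ∈ Icc 0 T, ∀ y' ∈ Icc (0 : ℝ) 1, d r' y' - ε * r' ≤ d r y - ε * r :=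
      fun r' hr' y' hy' => hmax (show (r', y') ∈ Icc 0 T ×ˢ Icc (0 : ℝ) 1 from ⟨hr', hy'⟩)
    refine (hmax' t ht x hx).trans ?_
    have hr0 : 0 ≤ ε * r := mul_nonneg hε.le hr.1
    rcases hr.1.eq_or_lt with e | hrpos
    · have := h0 y hy
      rw [← e] at hr0 ⊢
      linarith
    rcases hy.1.eq_or_lt with e | hypos
    · have := h1 r hr
      rw [← e]
      linarith
    exfalso
    obtain ⟨ht', hx'⟩ := hd r hr.1 y hy
    have p1 : 0 ≤ dt r y - ε := by
      have hz : HasDerivWithinAt (fun s => d s y - ε * s) (dt r y - ε) (Ici 0) r :=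
        (ht'.sub ((hasDerivWithinAt_id r (Ici 0)).const_mul ε)).congr_deriv (by rw [mul_one])
      exact nonneg_of_hasDerivWithinAt_of_le hz hrpos Icc_subset_Ici_self
        fun s hs => hmax' s ⟨hs.1, hs.2.trans hr.2⟩ y hy
    have p2 : 0 ≤ dx r y :=
      nonneg_of_hasDerivWithinAt_of_le hx' hypos (Icc_subset_Icc_right hy.2)
        fun z hz => by linarith [hmax' r hr z ⟨hz.1, hz.2.trans hy.2⟩]
    have := mul_nonneg (hv r hr.1 y hy) p2
    linarith [hpde r hr.1 y hy]
  refine le_of_forall_pos_le_add fun ε hε => ?_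
  have ht1 : 0 < t + 1 := by linarith [ht.1]
  have := key (ε / (t + 1)) (by positivity)
  have h2 : ε / (t + 1) * t ≤ ε := by
    rw [div_mul_eq_mul_div, div_le_iff₀ ht1]
    nlinarith
  linarith

end MaximumPrinciple

section Lipschitz

variable {α : Type*} [PseudoMetricSpace α] {S : Set α} {f g : α → ℝ}

theorem exists_lipschitzOnWith_mul (hS : IsCompact S) (hf : ∃ L : ℝ≥0, LipschitzOnWith L f S)
    (hg : ∃ L : ℝ≥0, LipschitzOnWith L g S) :
    ∃ L : ℝ≥0, LipschitzOnWith L (fun x => f x * g x) S := by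
  obtain ⟨L, hL⟩ := hf
  obtain ⟨M, hM⟩ := hg
  obtain ⟨B, hB⟩ := hS.exists_bound_of_continuousOn hL.continuousOn
  obtain ⟨C, hC⟩ := hS.exists_bound_of_continuousOn hM.continuousOn
  refine ⟨L * C.toNNReal + B.toNNReal * M, LipschitzOnWith.of_dist_le_mul fun x hx y hy => ?_⟩
  have h1 : |f x - f y| ≤ L * dist x y := hL.dist_le_mul x hx y hy
  have h2 : |g x - g y| ≤ M * dist x y := hM.dist_le_mul x hx y hy
  have h3 : |g x| ≤ C.toNNReal := (hC x hx).trans (Real.le_coe_toNNReal C)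
  have h4 : |f y| ≤ B.toNNReal := (hB y hy).trans (Real.le_coe_toNNReal B)
  calc |f x * g x - f y * g y| = |(f x - f y) * g x + f y * (g x - g y)| := by ring_nf
    _ ≤ |f x - f y| * |g x| + |f y| * |g x - g y| := by
        refine (abs_add_le _ _).trans_eq ?_
        rw [abs_mul, abs_mul]
    _ ≤ L * dist x y * C.toNNReal + B.toNNReal * (M * dist x y) := by gcongr
    _ = _ := by push_cast; ring

theorem exists_lipschitzOnWith_inv (hS : IsCompact S) (hf : ∃ L : ℝ≥0, LipschitzOnWith L f S)
    (h0 : ∀ x ∈ S, f x ≠ 0) : ∃ L : ℝ≥0, LipschitzOnWith L (fun x => (f x)⁻¹) S := by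
  obtain ⟨L, hL⟩ := hf
  obtain ⟨B, hB⟩ := hS.exists_bound_of_continuousOn (hL.continuousOn.inv₀ h0)
  refine ⟨B.toNNReal * B.toNNReal * L, LipschitzOnWith.of_dist_le_mul fun x hx y hy => ?_⟩
  have h1 : |f y - f x| ≤ L * dist x y := by
    rw [abs_sub_comm]
    exact hL.dist_le_mul x hx y hy
  have h3 : |(f x)⁻¹| ≤ B.toNNReal := (hB x hx).trans (Real.le_coe_toNNReal B)
  have h4 : |(f y)⁻¹| ≤ B.toNNReal := (hB y hy).trans (Real.le_coe_toNNReal B)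
  calc |(f x)⁻¹ - (f y)⁻¹| = |(f x)⁻¹| * |(f y)⁻¹| * |f y - f x| := by
        rw [← abs_mul, ← abs_mul]
        congr 1
        field_simp [h0 x hx, h0 y hy]
    _ ≤ B.toNNReal * B.toNNReal * (L * dist x y) := by gcongr
    _ = _ := by push_cast; ring

theorem exists_lipschitzOnWith_comp {β : Type*} [PseudoMetricSpace β] {T : Set β} {k : β → α}
    (hf : ∃ L : ℝ≥0, LipschitzOnWith L f S) (hk : ∃ L : ℝ≥0, LipschitzOnWith L k T)
    (h : MapsTo k T S) : ∃ L : ℝ≥0, LipschitzOnWith L (fun x => f (k x)) T := by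
  obtain ⟨L, hL⟩ := hf
  obtain ⟨M, hM⟩ := hk
  exact ⟨L * M, hL.comp hM h⟩

theorem exists_lipschitzOnWith_mono {T : Set α} (hf : ∃ L : ℝ≥0, LipschitzOnWith L f T)
    (h : S ⊆ T) : ∃ L : ℝ≥0, LipschitzOnWith L f S :=
  hf.imp fun _ hL => hL.mono h

theorem exists_lipschitzOnWith_congr (hf : ∃ L : ℝ≥0, LipschitzOnWith L f S)
    (h : ∀ x ∈ S, g x = f x) : ∃ L : ℝ≥0, LipschitzOnWith L g S := by
  refine hf.imp fun L hL x hx y hy => ?_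
  rw [h x hx, h y hy]
  exact hL hx hy

theorem exists_lipschitzOnWith_Icc_glue {f : ℝ → ℝ} {a b c : ℝ}
    (h1 : ∃ L : ℝ≥0, LipschitzOnWith L f (Icc a b))
    (h2 : ∃ L : ℝ≥0, LipschitzOnWith L f (Icc b c)) :
    ∃ L : ℝ≥0, LipschitzOnWith L f (Icc a c) := by
  obtain ⟨L, hL⟩ := h1
  obtain ⟨M, hM⟩ := h2
  have key : ∀ x ∈ Icc a c, ∀ y ∈ Icc a c, x ≤ y → |f x - f y| ≤ (L + M : ℝ≥0) * |x - y| := by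
    intro x hx y hy hxy
    have e : |x - y| = y - x := by rw [abs_sub_comm, abs_of_nonneg (sub_nonneg.2 hxy)]
    rw [e]
    push_cast
    have hL0 := L.2
    have hM0 := M.2
    rcases le_total y b with hyb | hby
    · have := hL.dist_le_mul x ⟨hx.1, hxy.trans hyb⟩ y ⟨hy.1, hyb⟩
      rw [Real.dist_eq, Real.dist_eq, e] at this
      nlinarith [mul_nonneg hM0 (sub_nonneg.2 hxy)]
    rcases le_total b x with hbx | hxb
    · have := hM.dist_le_mul x ⟨hbx, hx.2⟩ y ⟨hby, hy.2⟩
      rw [Real.dist_eq, Real.dist_eq, e] at this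
      nlinarith [mul_nonneg hL0 (sub_nonneg.2 hxy)]
    · have t1 := hL.dist_le_mul x ⟨hx.1, hxb⟩ b ⟨hx.1.trans hxb, le_rfl⟩
      have t2 := hM.dist_le_mul b ⟨le_rfl, hby.trans hy.2⟩ y ⟨hby, hy.2⟩
      rw [Real.dist_eq, Real.dist_eq, abs_sub_comm x b, abs_of_nonneg (sub_nonneg.2 hxb)] at t1
      rw [Real.dist_eq, Real.dist_eq, abs_sub_comm b y, abs_of_nonneg (sub_nonneg.2 hby)] at t2
      have := abs_sub_le (f x) (f b) (f y)
      nlinarith [mul_nonneg hL0 (sub_nonneg.2 hby), mul_nonneg hM0 (sub_nonneg.2 hxb)]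
  refine ⟨L + M, LipschitzOnWith.of_dist_le_mul fun x hx y hy => ?_⟩
  rcases le_total x y with h | h
  · exact key x hx y hy h
  · rw [dist_comm, dist_comm x]
    exact key y hy x hx h

theorem continuousOn_Ici_prod {f : ℝ × ℝ → ℝ} {J : Set ℝ}
    (h : ∀ T > (0 : ℝ), ∃ L : ℝ≥0, LipschitzOnWith L f (Icc 0 T ×ˢ J)) :
    ContinuousOn f (Ici 0 ×ˢ J) := by
  rintro ⟨t, x⟩ ⟨ht, hx⟩
  change 0 ≤ t at ht
  obtain ⟨L, hL⟩ := h (t + 1) (by linarith)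
  refine (hL.continuousOn (t, x) ⟨⟨ht, by simp⟩, hx⟩).mono_of_mem_nhdsWithin ?_
  filter_upwards [self_mem_nhdsWithin, mem_nhdsWithin_of_mem_nhds
    ((isOpen_lt continuous_fst continuous_const).mem_nhds
      (show ((t, x) : ℝ × ℝ).1 < t + 1 by simp))] with q h1 h2
  exact ⟨⟨h1.1, le_of_lt h2⟩, h1.2⟩

theorem continuous_of_lipschitzOnWith_strip {f : ℝ × ℝ → ℝ}
    (h : ∀ T, ∃ L : ℝ≥0, LipschitzOnWith L f (Icc (-T) T ×ˢ univ)) : Continuous f := by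
  refine continuous_iff_continuousAt.2 ?_
  rintro ⟨t, x⟩
  obtain ⟨L, hL⟩ := h (|t| + 1)
  have ht := abs_lt.1 (lt_add_one |t|)
  exact hL.continuousOn.continuousAt (prod_mem_nhds (Icc_mem_nhds ht.1 ht.2) univ_mem)

theorem exists_lipschitzOnWith_of_partials {v vt vx : ℝ → ℝ → ℝ}
    (hvtcont : ContinuousOn (fun q : ℝ × ℝ => vt q.1 q.2) (Ici 0 ×ˢ Icc 0 1))
    (hvxcont : ContinuousOn (fun q : ℝ × ℝ => vx q.1 q.2) (Ici 0 ×ˢ Icc 0 1))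
    (hvd : ∀ t ∈ Ici (0 : ℝ), ∀ x ∈ Icc (0 : ℝ) 1,
      HasDerivWithinAt (fun s => v s x) (vt t x) (Ici 0) t ∧
      HasDerivWithinAt (fun y => v t y) (vx t x) (Icc 0 1) x) (T : ℝ) :
    ∃ L : ℝ≥0, LipschitzOnWith L (fun q : ℝ × ℝ => v q.1 q.2) (Icc 0 T ×ˢ Icc 0 1) := by
  have hsub : Icc 0 T ×ˢ Icc (0 : ℝ) 1 ⊆ Ici (0 : ℝ) ×ˢ Icc (0 : ℝ) 1 :=
    prod_mono_left Icc_subset_Ici_self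
  obtain ⟨M, hM⟩ := (isCompact_Icc.prod isCompact_Icc).exists_bound_of_continuousOn
    (hvtcont.mono hsub)
  obtain ⟨N, hN⟩ := (isCompact_Icc.prod isCompact_Icc).exists_bound_of_continuousOn
    (hvxcont.mono hsub)
  refine exists_lipschitzOnWith_of_abs_sub_le (max M N) fun t ht t' ht' x hx x' hx' => ?_
  have h1 : |v t x - v t' x| ≤ M * |t - t'| :=
    (convex_Icc 0 T).norm_image_sub_le_of_norm_hasDerivWithin_le
      (fun r hr => ((hvd r hr.1 x hx).1.mono Icc_subset_Ici_self))
      (fun r hr => hM (r, x) ⟨hr, hx⟩) ht' ht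
  have h2 : |v t' x - v t' x'| ≤ N * |x - x'| :=
    (convex_Icc (0 : ℝ) 1).norm_image_sub_le_of_norm_hasDerivWithin_le
      (fun y hy => (hvd t' ht'.1 y hy).2)
      (fun y hy => hN (t', y) ⟨ht', hy⟩) hx' hx
  have h3 := abs_sub_le (v t x) (v t' x) (v t' x')
  have h4 := mul_le_mul_of_nonneg_right (le_max_left M N) (abs_nonneg (t - t'))
  have h5 := mul_le_mul_of_nonneg_right (le_max_right M N) (abs_nonneg (x - x'))
  linarith

end Lipschitz

namespace IsSol3

variable {v : ℝ → ℝ → ℝ} {φ a φ₂ a₂ : ℝ → ℝ} {w wt wx w₂ wt₂ wx₂ : ℝ → ℝ → ℝ}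

theorem sub (h : IsSol3 v φ a w wt wx) (h₂ : IsSol3 v φ₂ a₂ w₂ wt₂ wx₂) :
    IsSol3 v (fun x => φ x - φ₂ x) (fun t => a t - a₂ t) (fun t x => w t x - w₂ t x)
      (fun t x => wt t x - wt₂ t x) (fun t x => wx t x - wx₂ t x) := by
  obtain ⟨c, ct, cx, d, p, i, j⟩ := h
  obtain ⟨c₂, ct₂, cx₂, d₂, p₂, i₂, j₂⟩ := h₂
  refine ⟨c.sub c₂, ct.sub ct₂, cx.sub cx₂, fun t ht x hx =>
    ⟨(d t ht x hx).1.sub (d₂ t ht x hx).1, (d t ht x hx).2.sub (d₂ t ht x hx).2⟩,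
    fun t ht x hx => ?_, fun x hx => ?_, fun t ht => ?_⟩
  · linear_combination p t ht x hx - p₂ t ht x hx
  · show w 0 x - w₂ 0 x = _
    rw [i x hx, i₂ x hx]
  · show w t 0 - w₂ t 0 = _
    rw [j t ht, j₂ t ht]

theorem neg (h : IsSol3 v φ a w wt wx) :
    IsSol3 v (fun x => -φ x) (fun t => -a t) (fun t x => -w t x)
      (fun t x => -wt t x) (fun t x => -wx t x) := by
  obtain ⟨c, ct, cx, d, p, i, j⟩ := h
  refine ⟨c.neg, ct.neg, cx.neg, fun t ht x hx => ⟨(d t ht x hx).1.neg, (d t ht x hx).2.neg⟩,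
    fun t ht x hx => ?_, fun x hx => ?_, fun t ht => ?_⟩
  · linear_combination -p t ht x hx
  · show -w 0 x = _
    rw [i x hx]
  · show -w t 0 = _
    rw [j t ht]

theorem le_of_data_le (hv : ∀ t ∈ Ici (0 : ℝ), ∀ x ∈ Icc (0 : ℝ) 1, 0 ≤ v t x)
    (h : IsSol3 v φ a w wt wx) {t C : ℝ} (ht : t ∈ Ici (0 : ℝ))
    (hφ : ∀ x ∈ Icc (0 : ℝ) 1, φ x ≤ C) (ha : ∀ s ∈ Icc 0 t, a s ≤ C) :
    ∀ x ∈ Icc (0 : ℝ) 1, w t x ≤ C := by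
  obtain ⟨c, -, -, d, p, i, j⟩ := h
  exact transport_le_of_boundary_le hv c d p (fun x hx => (i x hx).trans_le (hφ x hx))
    (fun s hs => (j s hs.1).trans_le (ha s hs)) t ⟨ht, le_rfl⟩

theorem unique (hv : ∀ t ∈ Ici (0 : ℝ), ∀ x ∈ Icc (0 : ℝ) 1, 0 ≤ v t x)
    (h : IsSol3 v φ a w wt wx) (h₂ : IsSol3 v φ a w₂ wt₂ wx₂) :
    ∀ t ∈ Ici (0 : ℝ), ∀ x ∈ Icc (0 : ℝ) 1, w₂ t x = w t x := by
  intro t ht x hx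
  have h1 := (h.sub h₂).le_of_data_le hv ht (C := 0) (by simp) (by simp) x hx
  have h2 := (h₂.sub h).le_of_data_le hv ht (C := 0) (by simp) (by simp) x hx
  linarith

theorem abs_le_max (hv : ∀ t ∈ Ici (0 : ℝ), ∀ x ∈ Icc (0 : ℝ) 1, 0 ≤ v t x)
    (h : IsSol3 v φ a w wt wx) (cφ : ContinuousOn φ (Icc 0 1)) (ca : ContinuousOn a (Ici 0)) :
    ∀ t ∈ Ici (0 : ℝ), ∀ x ∈ Icc (0 : ℝ) 1,
      |w t x| ≤ max (sSup {y : ℝ | ∃ s ∈ Icc (0 : ℝ) t, y = |a s|})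
        (sSup {y : ℝ | ∃ z ∈ Icc (0 : ℝ) 1, y = |φ z|}) := by
  intro t ht x hx
  have bdd : ∀ {f : ℝ → ℝ} {r : ℝ}, ContinuousOn f (Icc 0 r) → ∀ s ∈ Icc 0 r,
      |f s| ≤ sSup {y : ℝ | ∃ s ∈ Icc (0 : ℝ) r, y = |f s|} := by
    intro f r hf s hs
    obtain ⟨M, hM⟩ := isCompact_Icc.exists_bound_of_continuousOn hf
    refine le_csSup ⟨M, ?_⟩ ⟨s, hs, rfl⟩
    rintro _ ⟨s, hs, rfl⟩
    exact hM s hs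
  have hφ := fun z hz => (bdd cφ z hz).trans
    (le_max_right (sSup {y : ℝ | ∃ s ∈ Icc (0 : ℝ) t, y = |a s|}) _)
  have ha := fun s hs => (bdd (ca.mono fun r (hr : r ∈ Icc 0 t) => hr.1) s hs).trans
    (le_max_left _ (sSup {y : ℝ | ∃ z ∈ Icc (0 : ℝ) 1, y = |φ z|}))
  refine abs_le'.2 ⟨?_, ?_⟩
  · exact h.le_of_data_le hv ht (fun z hz => (le_abs_self _).trans (hφ z hz))
      (fun s hs => (le_abs_self _).trans (ha s hs)) x hx
  · exact h.neg.le_of_data_le hv ht (fun z hz => (neg_le_abs _).trans (hφ z hz))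
      (fun s hs => (neg_le_abs _).trans (ha s hs)) x hx

end IsSol3

section Profile

theorem hasDerivAt_ite_lt {f g : ℝ → ℝ} {d c : ℝ} (hf : HasDerivAt f d c) (hg : HasDerivAt g d c)
    (h : f c = g c) : HasDerivAt (fun y => if y < c then f y else g y) d c := by
  have h1 : HasDerivWithinAt (fun y => if y < c then f y else g y) d (Iic c) c := by
    refine hf.hasDerivWithinAt.congr (fun y hy => ?_) (by simp [h])
    rcases (show y ≤ c from hy).lt_or_eq with hlt | rfl
    · simp [hlt]
    · simp [h]
  have h2 : HasDerivWithinAt (fun y => if y < c then f y else g y) d (Ici c) c :=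
    hg.hasDerivWithinAt.congr (fun y hy => if_neg (not_lt.2 hy)) (by simp)
  simpa [Iic_union_Ici] using h1.union h2

/-- A `C^{1,1}` profile which equals `φ` on `[0,1]` and takes the value `a t` at `b t`, where `b`
is a decreasing reparametrisation with `b 0 = 0`. -/
theorem exists_profile {b b' φ φ' a a' : ℝ → ℝ} (hb : ∀ t, HasDerivAt b (b' t) t)
    (hb' : ∀ t, b' t < 0) (cb' : Continuous b') (hb0 : b 0 = 0)
    (hblip : ∀ T > (0 : ℝ), ∃ L : ℝ≥0, LipschitzOnWith L b' (Icc 0 T))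
    (hφ : ∀ x ∈ Icc (0 : ℝ) 1, HasDerivWithinAt φ (φ' x) (Icc 0 1) x)
    (hφlip : ∃ L : ℝ≥0, LipschitzOnWith L φ' (Icc 0 1))
    (ha : ∀ t ∈ Ici (0 : ℝ), HasDerivWithinAt a (a' t) (Ici 0) t)
    (halip : ∀ T > (0 : ℝ), ∃ L : ℝ≥0, LipschitzOnWith L a' (Icc 0 T))
    (hcomp0 : a 0 = φ 0) (hcomp1 : a' 0 = φ' 0 * b' 0) :
    ∃ Φ Φ' : ℝ → ℝ, (∀ t, 0 ≤ t → HasDerivAt Φ (Φ' (b t)) (b t)) ∧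
      (∀ y, 0 ≤ y → HasDerivAt Φ (Φ' y) y) ∧ (∀ t, 0 ≤ t → Φ (b t) = a t) ∧
      (∀ y ∈ Icc (0 : ℝ) 1, Φ y = φ y) ∧
      ∀ T > (0 : ℝ), ∃ L : ℝ≥0, LipschitzOnWith L Φ' (Icc (b T) 1) := by
  have hanti : StrictAnti b := strictAnti_of_deriv_neg fun t => by
    rw [(hb t).deriv]
    exact hb' t
  have cb : Continuous b := continuous_iff_continuousAt.2 fun t => (hb t).continuousAt
  set τ := Function.invFun b with hτdef
  have hτ : ∀ t, τ (b t) = t := Function.leftInverse_invFun hanti.injective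
  have hτ0 : τ 0 = 0 := by simpa [hb0] using hτ 0
  have dτ : ∀ t, HasDerivAt τ (b' t)⁻¹ (b t) := fun t =>
    ((hasStrictDerivAt_of_hasDerivAt_of_continuousAt (Eventually.of_forall hb)
      cb'.continuousAt).to_local_left_inverse (hb' t).ne (Eventually.of_forall hτ)).hasDerivAt
  have ca' : Continuous fun s => a' (max s 0) := by
    have : ContinuousOn a' (Ici 0) := by
      intro t ht
      have ht0 : (0 : ℝ) ≤ t := ht
      obtain ⟨L, hL⟩ := halip (t + 1) (by linarith)
      refine (hL.continuousOn t ⟨ht0, by linarith⟩).mono_of_mem_nhdsWithin ?_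
      filter_upwards [self_mem_nhdsWithin, mem_nhdsWithin_of_mem_nhds
        (Iio_mem_nhds (lt_add_one t))] with s h1 h2
      exact ⟨h1, le_of_lt h2⟩
    exact this.comp_continuous (by fun_prop) fun s => le_max_right s 0
  have cφ' : Continuous fun y => φ' (clampUnit y) := by
    obtain ⟨L, hL⟩ := hφlip
    exact hL.continuousOn.comp_continuous continuous_clampUnit clampUnit_mem
  set A : ℝ → ℝ := fun t => a 0 + ∫ s in (0 : ℝ)..t, a' (max s 0) with hA
  set P : ℝ → ℝ := fun y => φ 0 + ∫ s in (0 : ℝ)..y, φ' (clampUnit s) with hP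
  have dA : ∀ t, HasDerivAt A (a' (max t 0)) t := hasDerivAt_const_add_integral ca' _
  have dP : ∀ y, HasDerivAt P (φ' (clampUnit y)) y := hasDerivAt_const_add_integral cφ' _
  have eA : ∀ t, 0 ≤ t → A t = a t := fun t ht =>
    add_integral_eq_of_hasDerivWithinAt ht Icc_subset_Ici_self ha ca'
      fun y hy => by rw [max_eq_left (show (0 : ℝ) ≤ y from hy)]
  have eP : ∀ y ∈ Icc (0 : ℝ) 1, P y = φ y := fun y hy =>
    add_integral_eq_of_hasDerivWithinAt hy.1 (Icc_subset_Icc_right hy.2) hφ cφ'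
      fun z hz => by rw [clampUnit_of_mem hz]
  have dAτ : ∀ t, 0 ≤ t → HasDerivAt (fun y => A (τ y)) (a' t * (b' t)⁻¹) (b t) := fun t ht => by
    have h1 : HasDerivAt A (a' t) (τ (b t)) := by
      have := dA t
      rw [max_eq_left ht] at this
      rwa [hτ t]
    exact h1.comp (b t) (dτ t)
  set Φ : ℝ → ℝ := fun y => if y < 0 then A (τ y) else P y with hΦ
  set Φ' : ℝ → ℝ := fun y =>
    if y < 0 then a' (τ y) * (b' (τ y))⁻¹ else φ' (clampUnit y) with hΦ'
  have h00 : a' 0 * (b' 0)⁻¹ = φ' 0 := by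
    rw [hcomp1, mul_assoc, mul_inv_cancel₀ (hb' 0).ne, mul_one]
  have c0 : clampUnit 0 = 0 := clampUnit_of_mem (by simp)
  have eΦ' : ∀ t, 0 ≤ t → Φ' (b t) = a' t * (b' t)⁻¹ := fun t ht => by
    rcases ht.eq_or_lt with rfl | hpos
    · simp [hΦ', hb0, c0, h00]
    · have : b t < 0 := hb0 ▸ hanti hpos
      simp [hΦ', this, hτ]
  have eΦ'1 : ∀ y, 0 ≤ y → Φ' y = φ' (clampUnit y) := fun y hy => if_neg (not_lt.2 hy)
  have dΦ0 : HasDerivAt Φ (Φ' 0) 0 := by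
    have h1 := dAτ 0 le_rfl
    have h2 := dP 0
    rw [hb0, h00] at h1
    rw [c0] at h2
    have e : Φ' 0 = φ' 0 := by rw [eΦ'1 0 le_rfl, c0]
    rw [e]
    refine hasDerivAt_ite_lt h1 h2 ?_
    rw [hτ0, eA 0 le_rfl, eP 0 (by simp), hcomp0]
  refine ⟨Φ, Φ', fun t ht => ?_, fun y hy => ?_, fun t ht => ?_, fun y hy => ?_, fun T hT => ?_⟩
  · rcases ht.eq_or_lt with rfl | hpos
    · rwa [hb0]
    · have hneg : b t < 0 := hb0 ▸ hanti hpos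
      rw [eΦ' t ht]
      refine (dAτ t ht).congr_of_eventuallyEq ?_
      filter_upwards [Iio_mem_nhds hneg] with y hy using if_pos hy
  · rcases hy.eq_or_lt with rfl | hpos
    · exact dΦ0
    · rw [eΦ'1 y hy]
      refine (dP y).congr_of_eventuallyEq ?_
      filter_upwards [Ioi_mem_nhds hpos] with z hz using if_neg (not_lt.2 (le_of_lt hz))
  · rcases ht.eq_or_lt with rfl | hpos
    · simp only [hΦ, hb0, lt_irrefl, if_false]
      rw [eP 0 (by simp), hcomp0]
    · have hneg : b t < 0 := hb0 ▸ hanti hpos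
      simp only [hΦ, hneg, if_true]
      rw [hτ, eA t ht]
  · simp only [hΦ, not_lt.2 hy.1, if_false]
    exact eP y hy
  · have hsurj : ∀ y ∈ Icc (b T) 0, ∃ s ∈ Icc 0 T, b s = y := fun y hy =>
      intermediate_value_Icc' hT.le cb.continuousOn (by rwa [hb0])
    have hinv := exists_lipschitzOnWith_inv isCompact_Icc (hblip T hT) fun t _ => (hb' t).ne
    have hq := exists_lipschitzOnWith_mul isCompact_Icc (halip T hT) hinv
    have hτmaps : MapsTo τ (Icc (b T) 0) (Icc 0 T) := fun y hy => by
      obtain ⟨s, hs, rfl⟩ := hsurj y hy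
      rwa [hτ]
    have hτlip : ∃ L : ℝ≥0, LipschitzOnWith L τ (Icc (b T) 0) := by
      obtain ⟨L, hL⟩ := hinv
      obtain ⟨B, hB⟩ := isCompact_Icc.exists_bound_of_continuousOn hL.continuousOn
      refine ⟨B.toNNReal, LipschitzOnWith.of_dist_le_mul fun x hx y hy => ?_⟩
      refine (convex_Icc (b T) 0).norm_image_sub_le_of_norm_hasDerivWithin_le
        (f' := fun y => (b' (τ y))⁻¹) (fun z hz => ?_) (fun z hz => ?_) hy hx
      · obtain ⟨s, hs, rfl⟩ := hsurj z hz
        rw [hτ]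
        exact (dτ s).hasDerivWithinAt
      · exact (hB _ (hτmaps hz)).trans (Real.le_coe_toNNReal B)
    refine exists_lipschitzOnWith_Icc_glue (b := 0) ?_ ?_
    · refine exists_lipschitzOnWith_congr (exists_lipschitzOnWith_comp hq hτlip hτmaps)
        fun y hy => ?_
      obtain ⟨s, hs, rfl⟩ := hsurj y hy
      rw [eΦ' s hs.1, hτ]
    · refine exists_lipschitzOnWith_congr hφlip fun y hy => ?_
      rw [eΦ'1 y hy.1, clampUnit_of_mem hy]

end Profile

/-- Well-posedness (Proposition 5.2) of the transport PDE `∂w/∂t + v ∂w/∂x = 0` on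
`[0,1]` with non-negative transport velocity `v` (positive at the inlet `x = 0`),
`W^{2,∞}` data `φ`, `a` satisfying the compatibility conditions: there exists a unique
classical solution, it has Lipschitz derivatives on `[0,T] × [0,1]` for every `T > 0`
and obeys the sup-norm bound. -/
theorem stmt3 (v vt vx : ℝ → ℝ → ℝ) (φ φ' a a' : ℝ → ℝ)
    (hvcont : ContinuousOn (fun q : ℝ × ℝ => v q.1 q.2) (Ici 0 ×ˢ Icc 0 1))
    (hvtcont : ContinuousOn (fun q : ℝ × ℝ => vt q.1 q.2) (Ici 0 ×ˢ Icc 0 1))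
    (hvxcont : ContinuousOn (fun q : ℝ × ℝ => vx q.1 q.2) (Ici 0 ×ˢ Icc 0 1))
    (hvd : ∀ t ∈ Ici (0:ℝ), ∀ x ∈ Icc (0:ℝ) 1,
      HasDerivWithinAt (fun s => v s x) (vt t x) (Ici 0) t ∧
      HasDerivWithinAt (fun y => v t y) (vx t x) (Icc 0 1) x)
    (hvlip : ∀ T > (0:ℝ), ∃ L : NNReal,
      LipschitzOnWith L (fun q : ℝ × ℝ => vt q.1 q.2) (Icc 0 T ×ˢ Icc 0 1) ∧
      LipschitzOnWith L (fun q : ℝ × ℝ => vx q.1 q.2) (Icc 0 T ×ˢ Icc 0 1))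
    (hvnn : ∀ t ∈ Ici (0:ℝ), ∀ x ∈ Icc (0:ℝ) 1, 0 ≤ v t x)
    (hvin : ∀ t ∈ Ici (0:ℝ), 0 < v t 0)
    (hφ : ∀ x ∈ Icc (0:ℝ) 1, HasDerivWithinAt φ (φ' x) (Icc 0 1) x)
    (hφlip : ∃ L : NNReal, LipschitzOnWith L φ' (Icc 0 1))
    (ha : ∀ t ∈ Ici (0:ℝ), HasDerivWithinAt a (a' t) (Ici 0) t)
    (halip : ∀ T > (0:ℝ), ∃ L : NNReal, LipschitzOnWith L a' (Icc 0 T))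
    (hcomp0 : a 0 = φ 0)
    (hcomp1 : a' 0 + v 0 0 * φ' 0 = 0) :
    ∃ w wt wx : ℝ → ℝ → ℝ,
      IsSol3 v φ a w wt wx ∧
      (∀ T > (0:ℝ), ∃ L : NNReal,
        LipschitzOnWith L (fun q : ℝ × ℝ => wt q.1 q.2) (Icc 0 T ×ˢ Icc 0 1) ∧
        LipschitzOnWith L (fun q : ℝ × ℝ => wx q.1 q.2) (Icc 0 T ×ˢ Icc 0 1)) ∧
      (∀ t ∈ Ici (0:ℝ), ∀ x ∈ Icc (0:ℝ) 1,
        |w t x| ≤ max (sSup {y : ℝ | ∃ s ∈ Icc (0:ℝ) t, y = |a s|})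
          (sSup {y : ℝ | ∃ z ∈ Icc (0:ℝ) 1, y = |φ z|})) ∧
      (∀ w₂ wt₂ wx₂ : ℝ → ℝ → ℝ, IsSol3 v φ a w₂ wt₂ wx₂ →
        ∀ t ∈ Ici (0:ℝ), ∀ x ∈ Icc (0:ℝ) 1, w₂ t x = w t x) := by
  obtain ⟨V, Vx, hV, hVv, hV0⟩ := exists_tame_extension hvcont hvxcont
    (fun t ht x hx => (hvd t ht x hx).2) fun T hT => (hvlip T hT).imp fun _ h => h.2
  obtain ⟨Y, Yx, hY0, hYx, dYx, dYt, lipY, lipYx⟩ := hV.exists_foot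
  have cY := continuous_of_lipschitzOnWith_strip lipY
  have cYx := continuous_of_lipschitzOnWith_strip lipYx
  have hsub : ∀ T : ℝ, Icc 0 T ×ˢ Icc (0 : ℝ) 1 ⊆ Icc (-T) T ×ˢ univ := fun T q hq =>
    ⟨⟨by linarith [hq.1.1, hq.1.2], hq.1.2⟩, trivial⟩
  have lipV : ∀ T, ∃ L : ℝ≥0,
      LipschitzOnWith L (fun q : ℝ × ℝ => V q.1 q.2) (Icc 0 T ×ˢ Icc 0 1) := fun T =>
    exists_lipschitzOnWith_congr (exists_lipschitzOnWith_of_partials hvtcont hvxcont hvd T)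
      fun q hq => hVv q.1 hq.1.1 q.2 hq.2
  have lipYt : ∀ T, ∃ L : ℝ≥0,
      LipschitzOnWith L (fun q : ℝ × ℝ => -V q.1 q.2 * Yx q.1 q.2) (Icc 0 T ×ˢ Icc 0 1) := fun T =>
    exists_lipschitzOnWith_mul (isCompact_Icc.prod isCompact_Icc) ((lipV T).imp fun _ h => h.neg)
      (exists_lipschitzOnWith_mono (lipYx T) (hsub T))
  have hYx0 : Yx 0 0 = 1 := by
    have h1 := dYx 0 0
    simp only [hY0] at h1
    exact h1.unique (hasDerivAt_id 0)
  have hV0pos : ∀ t, 0 < V t 0 := fun t => by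
    rw [hV0]
    exact hvin _ (le_max_right t 0)
  have hline : ∀ T, ∃ L : ℝ≥0, LipschitzOnWith L (fun t : ℝ => (t, (0 : ℝ))) (Icc 0 T) := fun T =>
    ⟨1, (LipschitzWith.prodMk_right (0 : ℝ)).lipschitzOnWith⟩
  obtain ⟨Φ, Φ', dΦb, dΦ, hΦb, hΦφ, lipΦ'⟩ := exists_profile (b := fun t => Y t 0)
    (b' := fun t => -V t 0 * Yx t 0) (fun t => dYt t 0)
    (fun t => mul_neg_of_neg_of_pos (neg_lt_zero.2 (hV0pos t)) (hYx t 0))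
    (((hV.cont.comp (by fun_prop : Continuous fun t : ℝ => (t, (0 : ℝ)))).neg).mul
      (cYx.comp (by fun_prop : Continuous fun t : ℝ => (t, (0 : ℝ)))))
    (hY0 0)
    (fun T _ => exists_lipschitzOnWith_comp (lipYt T) (hline T) fun t ht => ⟨ht, by simp⟩)
    hφ hφlip ha halip hcomp0
    (by rw [hYx0, hVv 0 (by simp) 0 (by simp)]; linarith)
  have monoY : ∀ t, StrictMono (Y t) := fun t => strictMono_of_deriv_pos fun x => by
    rw [(dYx t x).deriv]
    exact hYx t x
  have antiY : ∀ x ∈ Icc (0 : ℝ) 1, AntitoneOn (fun t => Y t x) (Ici 0) := fun x hx =>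
    antitoneOn_of_deriv_nonpos (convex_Ici 0)
      (continuous_iff_continuousAt.2 fun t => (dYt t x).continuousAt).continuousOn
      (fun t _ => (dYt t x).differentiableAt.differentiableWithinAt) fun t ht => by
        rw [interior_Ici] at ht
        have ht0 : t ∈ Ici (0 : ℝ) := le_of_lt (show (0 : ℝ) < t from ht)
        rw [(dYt t x).deriv, hVv t ht0 x hx]
        exact mul_nonpos_of_nonpos_of_nonneg
          (neg_nonpos.2 (hvnn t ht0 x hx)) (hYx t x).le
  have hY1 : ∀ t ∈ Ici (0 : ℝ), ∀ x ∈ Icc (0 : ℝ) 1, Y t x ≤ 1 := fun t ht x hx =>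
    calc Y t x ≤ Y t 1 := (monoY t).monotone hx.2
      _ ≤ Y 0 1 := antiY 1 (by simp) (by simp) ht ht
      _ = 1 := hY0 1
  have dΦY : ∀ t ∈ Ici (0 : ℝ), ∀ x ∈ Icc (0 : ℝ) 1,
      HasDerivAt Φ (Φ' (Y t x)) (Y t x) := fun t ht x hx => by
    rcases le_total 0 (Y t x) with h | h
    · exact dΦ _ h
    · obtain ⟨s, hs, e⟩ := intermediate_value_Icc' (show (0 : ℝ) ≤ t from ht)
        (f := fun t => Y t 0) (continuous_iff_continuousAt.2 fun t =>
          (dYt t 0).continuousAt).continuousOn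
        (show Y t x ∈ Icc (Y t 0) (Y 0 0) from
          ⟨(monoY t).monotone hx.1, by rwa [hY0]⟩)
      rw [← e]
      exact dΦb s hs.1
  have lipΦ'Y : ∀ T > (0 : ℝ), ∃ L : ℝ≥0,
      LipschitzOnWith L (fun q : ℝ × ℝ => Φ' (Y q.1 q.2)) (Icc 0 T ×ˢ Icc 0 1) := fun T hT =>
    exists_lipschitzOnWith_comp (lipΦ' T hT) (exists_lipschitzOnWith_mono (lipY T) (hsub T))
      fun q hq => ⟨(antiY 0 (by simp) hq.1.1 hT.le hq.1.2).trans ((monoY q.1).monotone hq.2.1),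
        hY1 q.1 hq.1.1 q.2 hq.2⟩
  have lipwt : ∀ T > (0 : ℝ), ∃ L : ℝ≥0, LipschitzOnWith L
      (fun q : ℝ × ℝ => Φ' (Y q.1 q.2) * (-V q.1 q.2 * Yx q.1 q.2)) (Icc 0 T ×ˢ Icc 0 1) :=
    fun T hT => exists_lipschitzOnWith_mul (isCompact_Icc.prod isCompact_Icc) (lipΦ'Y T hT)
      (lipYt T)
  have lipwx : ∀ T > (0 : ℝ), ∃ L : ℝ≥0, LipschitzOnWith L
      (fun q : ℝ × ℝ => Φ' (Y q.1 q.2) * Yx q.1 q.2) (Icc 0 T ×ˢ Icc 0 1) :=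
    fun T hT => exists_lipschitzOnWith_mul (isCompact_Icc.prod isCompact_Icc) (lipΦ'Y T hT)
      (exists_lipschitzOnWith_mono (lipYx T) (hsub T))
  have hsol : IsSol3 v φ a (fun t x => Φ (Y t x)) (fun t x => Φ' (Y t x) * (-V t x * Yx t x))
      (fun t x => Φ' (Y t x) * Yx t x) := by
    refine ⟨fun q hq => ?_, continuousOn_Ici_prod lipwt, continuousOn_Ici_prod lipwx,
      fun t ht x hx => ⟨?_, ?_⟩, fun t ht x hx => ?_, fun x hx => ?_, fun t ht => ?_⟩
    · exact ((dΦY q.1 hq.1 q.2 hq.2).continuousAt.comp (f := fun q : ℝ × ℝ => Y q.1 q.2)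
        cY.continuousAt).continuousWithinAt
    · exact ((dΦY t ht x hx).comp t (dYt t x)).hasDerivWithinAt
    · exact ((dΦY t ht x hx).comp x (dYx t x)).hasDerivWithinAt
    · simp only [hVv t ht x hx]
      ring
    · simp only [hY0]
      exact hΦφ x hx
    · exact hΦb t ht
  refine ⟨_, _, _, hsol, fun T hT => ?_,
    hsol.abs_le_max hvnn (fun x hx => (hφ x hx).continuousWithinAt)
      (fun t ht => (ha t ht).continuousWithinAt),
    fun w₂ wt₂ wx₂ h₂ => hsol.unique hvnn h₂⟩
  obtain ⟨L, hL⟩ := lipwt T hT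
  obtain ⟨M, hM⟩ := lipwx T hT
  exact ⟨max L M, hL.weaken (le_max_left L M), hM.weaken (le_max_right L M)⟩
end
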